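/- Let S>0 and let U ∈ L^{α+1}_loc((0,S)×ℝ^N) be continuous on (0,S)×(ℝ^N∖{0}) and satisfy, for some constant C₀, the estimate | |x|^{2/α} U(t,x) − β^{1/α} | ≤ C₀[(|x|/(|x|+√t))^ρ + |x|^{2/α}] for all 0<t<S and x≠0. Assume there exists U₀ ∈ L¹_loc(ℝ^N) such that U(t,·) → U₀ in L¹_loc(ℝ^N) as t→0. Then for every δ>0 and every u₀ ∈ L¹_loc(ℝ^N) that is essentially bounded on {|x|>δ} and satisfies u₀(x)=U₀(x) a.e. on {|x|<δ}, there exist T ∈ (0,S), a constant C, and a function u ∈ L^{α+1}_loc((0,T)×ℝ^N), continuous on (0,T)×(ℝ^N∖{0}), such that: (a) for every test function ζ ∈ C_c^∞ with compact support contained in (0,T)×ℝ^N, ∫₀^T∫_{ℝ^N} (u−U)(−∂_tζ−Δζ) dx dt = ∫₀^T∫_{ℝ^N} (|u|^α u − |U|^α U) ζ dx dt (i.e. u solves ∂_t u − Δu = |u|^α u − [∂_t U − ΔU − |U|^α U] in the sense of distributions); (b) u(t,·) → u₀ in L¹_loc(ℝ^N) as t→0; (c) |u(t,x) − U(t,x)|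 ≤ C(1+|x|^{−η}) for all 0<t<T and x≠0. -/

import Mathlib

open MeasureTheory Filter

noncomputable section

/-- `N`-dimensional Euclidean space. -/
abbrev Euc (N : ℕ) := EuclideanSpace ℝ (Fin N)

/-- The Laplacian of a function on `ℝ^N`, as the sum of the second partial derivatives. -/
def lapl {N : ℕ} (f : Euc N → ℝ) (x : Euc N) : ℝ :=
  ∑ i : Fin N,
    fderiv ℝ (fderiv ℝ f) x (EuclideanSpace.single i (1 : ℝ)) (EuclideanSpace.single i (1 : ℝ))

namespace HeatAux

set_option linter.all false

open Set Topology

variable {N : ℕ}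

def gE (z : Euc N) : ℝ := Real.exp (-(1/4 : ℝ) * ‖z‖ ^ 2)

lemma integrable_gauss {b : ℝ} (hb : 0 < b) :
    Integrable (fun z : Euc N => Real.exp (-b * ‖z‖ ^ 2)) := by
  have h := GaussianFourier.integrable_cexp_neg_mul_sq_norm_add (V := Euc N) (b := (b : ℂ))
    (by simpa using hb) 0 0
  have h2 := h.norm
  refine h2.congr (Eventually.of_forall fun z => ?_)
  simp only [Complex.norm_exp]
  congr 1
  simp
  left
  norm_cast

lemma gE_pos (z : Euc N) : 0 < gE z := Real.exp_pos _

lemma gE_integrable : Integrable (gE : Euc N → ℝ) := integrable_gauss (by norm_num)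

lemma gE_cont : Continuous (gE : Euc N → ℝ) := by unfold gE; fun_prop

lemma gE_int_pos : 0 < ∫ z : Euc N, gE z := by
  have := integral_exp_pos (μ := (volume : Measure (Euc N)))
    (f := fun z : Euc N => -(1/4 : ℝ) * ‖z‖ ^ 2) gE_integrable
  exact this

def G1 (z : Euc N) : ℝ := (∫ z : Euc N, gE z)⁻¹ * gE z

lemma G1_pos (z : Euc N) : 0 < G1 z := mul_pos (inv_pos.2 gE_int_pos) (gE_pos z)

lemma G1_cont : Continuous (G1 : Euc N → ℝ) := continuous_const.mul gE_cont

lemma G1_integrable : Integrable (G1 : Euc N → ℝ) := gE_integrable.const_mul _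

lemma G1_integral : ∫ z : Euc N, G1 z = 1 := by
  unfold G1
  rw [integral_const_mul, inv_mul_cancel₀ gE_int_pos.ne']

lemma G1_neg (z : Euc N) : G1 (-z) = G1 z := by simp [G1, gE]

/-- polynomial weights times the Gaussian are bounded by a wider Gaussian -/
lemma G1_pow_le (j : ℕ) : ∃ C : ℝ, 0 < C ∧ ∀ z : Euc N, ‖z‖ ^ j * G1 z ≤ C * Real.exp (-(1/8 : ℝ) * ‖z‖ ^ 2) := by
  have h0 := @gE_int_pos N
  refine ⟨(∫ z : Euc N, gE z)⁻¹ * ((1 + j.factorial * 8 ^ j) : ℝ), by positivity, fun z => ?_⟩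
  unfold G1 gE
  have h1 : Real.exp (-(1/4 : ℝ) * ‖z‖ ^ 2) = Real.exp (-(1/8 : ℝ) * ‖z‖ ^ 2) * Real.exp (-(1/8 : ℝ) * ‖z‖ ^ 2) := by
    rw [← Real.exp_add]; ring_nf
  have h2 : ‖z‖ ^ j * Real.exp (-(1/8 : ℝ) * ‖z‖ ^ 2) ≤ 1 + j.factorial * 8 ^ j := by
    have h3 : ‖z‖ ^ j ≤ 1 + (‖z‖ ^ 2) ^ j := by
      rcases le_total ‖z‖ 1 with h | h
      · have : ‖z‖ ^ j ≤ 1 := pow_le_one₀ (norm_nonneg _) h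
        have : 0 ≤ (‖z‖ ^ 2) ^ j := by positivity
        linarith
      · rw [← pow_mul]
        have : ‖z‖ ^ j ≤ ‖z‖ ^ (2 * j) := pow_le_pow_right₀ h (by omega)
        linarith
    have h4 := Real.pow_div_factorial_le_exp (1/8 * ‖z‖ ^ 2) (by positivity) j
    have h5 : (‖z‖ ^ 2) ^ j ≤ j.factorial * 8 ^ j * Real.exp (1/8 * ‖z‖ ^ 2) := by
      rw [div_le_iff₀ (by positivity)] at h4
      rw [mul_pow] at h4
      have : (1/8:ℝ)^j * 8 ^ j = 1 := by rw [← mul_pow]; norm_num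
      calc (‖z‖ ^ 2) ^ j = ((1/8:ℝ)^j * (‖z‖ ^ 2) ^ j) * 8 ^ j := by
            rw [mul_right_comm, this, one_mul]
        _ ≤ (Real.exp (1/8 * ‖z‖ ^ 2) * j.factorial) * 8 ^ j := by gcongr
        _ = _ := by ring
    have h6 : Real.exp (-(1/8 : ℝ) * ‖z‖ ^ 2) ≤ 1 := by
      rw [Real.exp_le_one_iff]; nlinarith [sq_nonneg ‖z‖]
    have h7 : Real.exp (1/8 * ‖z‖ ^ 2) * Real.exp (-(1/8 : ℝ) * ‖z‖ ^ 2) = 1 := by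
      rw [← Real.exp_add]; ring_nf; simp
    calc ‖z‖ ^ j * Real.exp (-(1/8 : ℝ) * ‖z‖ ^ 2)
        ≤ (1 + j.factorial * 8 ^ j * Real.exp (1/8 * ‖z‖ ^ 2)) * Real.exp (-(1/8 : ℝ) * ‖z‖ ^ 2) := by
          gcongr; linarith
      _ = Real.exp (-(1/8 : ℝ) * ‖z‖ ^ 2) + j.factorial * 8 ^ j * (Real.exp (1/8 * ‖z‖ ^ 2) * Real.exp (-(1/8 : ℝ) * ‖z‖ ^ 2)) := by ring
      _ ≤ _ := by rw [h7]; linarith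
  rw [h1]
  calc ‖z‖ ^ j * ((∫ z : Euc N, Real.exp (-(1/4 : ℝ) * ‖z‖ ^ 2))⁻¹ * (Real.exp (-(1/8 : ℝ) * ‖z‖ ^ 2) * Real.exp (-(1/8 : ℝ) * ‖z‖ ^ 2)))
      = (∫ z : Euc N, Real.exp (-(1/4 : ℝ) * ‖z‖ ^ 2))⁻¹ * (‖z‖ ^ j * Real.exp (-(1/8 : ℝ) * ‖z‖ ^ 2)) * Real.exp (-(1/8 : ℝ) * ‖z‖ ^ 2) := by ring
    _ ≤ _ := by
      have : 0 < (∫ z : Euc N, Real.exp (-(1/4 : ℝ) * ‖z‖ ^ 2)) := h0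
      gcongr

lemma G1_pow_integrable (j : ℕ) : Integrable (fun z : Euc N => ‖z‖ ^ j * G1 z) := by
  obtain ⟨C, hC, h⟩ := G1_pow_le (N := N) j
  refine ((integrable_gauss (N := N) (b := 1/8) (by norm_num)).const_mul C).mono'
    ((continuous_norm.pow j).mul G1_cont).aestronglyMeasurable (Eventually.of_forall fun z => ?_)
  rw [Real.norm_of_nonneg (mul_nonneg (by positivity) (G1_pos z).le)]
  exact h z

lemma G1_le_pow (j : ℕ) : ∃ C : ℝ, 0 < C ∧ ∀ z : Euc N, ‖z‖ ^ j * G1 z ≤ C := by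
  obtain ⟨C, hC, h⟩ := G1_pow_le (N := N) j
  refine ⟨C, hC, fun z => (h z).trans ?_⟩
  have h6 : Real.exp (-(1/8 : ℝ) * ‖z‖ ^ 2) ≤ 1 := by
    rw [Real.exp_le_one_iff]; nlinarith [sq_nonneg ‖z‖]
  nlinarith

lemma G1_hasFDeriv_single (z : Euc N) (i : Fin N) :
    HasLineDerivAt ℝ (G1 : Euc N → ℝ) (-(1/2) * z i * G1 z) z (EuclideanSpace.single i (1 : ℝ)) := by
  have h1 : HasFDerivAt (fun z : Euc N => ‖z‖ ^ 2) (2 • (innerSL ℝ z)) z := by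
    simpa using (hasStrictFDerivAt_norm_sq z).hasFDerivAt
  have h2 := (((h1.const_mul (-(1/4 : ℝ))).exp).const_mul (∫ z : Euc N, gE z)⁻¹)
  have h3 := h2.hasLineDerivAt (EuclideanSpace.single i (1 : ℝ))
  have h4 : (fun z : Euc N => (∫ z : Euc N, gE z)⁻¹ * Real.exp (-(1/4 : ℝ) * ‖z‖ ^ 2)) = G1 := rfl
  rw [h4] at h3
  refine HasDerivAt.congr_deriv h3 ?_
  simp [G1, gE, EuclideanSpace.inner_single_right]
  ring

/-- heat kernel -/
def hk (τ : ℝ) (z : Euc N) : ℝ :=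
  if 0 < τ then (Real.sqrt τ ^ N)⁻¹ * G1 ((Real.sqrt τ)⁻¹ • z) else 0

lemma hk_nonneg (τ : ℝ) (z : Euc N) : 0 ≤ hk τ z := by
  unfold hk; split_ifs with h
  · have := G1_pos ((Real.sqrt τ)⁻¹ • z); positivity
  · exact le_rfl

lemma hk_of_nonpos {τ : ℝ} (h : τ ≤ 0) (z : Euc N) : hk τ z = 0 := by
  unfold hk; rw [if_neg (not_lt.2 h)]

lemma hk_neg (τ : ℝ) (z : Euc N) : hk τ (-z) = hk τ z := by
  unfold hk; simp only [smul_neg, G1_neg]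

lemma hk_measurable : Measurable (fun p : ℝ × Euc N => hk p.1 p.2) := by
  unfold hk
  refine Measurable.ite (measurableSet_lt measurable_const measurable_fst) ?_ measurable_const
  have := (G1_cont (N := N)).measurable
  refine Measurable.mul (by fun_prop) (this.comp ?_)
  exact ((Real.continuous_sqrt.measurable.comp measurable_fst).inv).smul measurable_snd

lemma hk_contAt {p : ℝ × Euc N} (hp : 0 < p.1) : ContinuousAt (fun p : ℝ × Euc N => hk p.1 p.2) p := by
  have h1 : ContinuousAt (fun p : ℝ × Euc N => (Real.sqrt p.1 ^ N)⁻¹ * G1 ((Real.sqrt p.1)⁻¹ • p.2)) p := by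
    have h0 : Real.sqrt p.1 ≠ 0 := (Real.sqrt_pos.2 hp).ne'
    have hs : ContinuousAt (fun p : ℝ × Euc N => Real.sqrt p.1) p := (Real.continuous_sqrt.comp continuous_fst).continuousAt
    refine ContinuousAt.mul ((hs.pow N).inv₀ (pow_ne_zero _ h0)) ?_
    exact (G1_cont.continuousAt).comp ((hs.inv₀ h0).smul continuousAt_snd)
  refine h1.congr ?_
  filter_upwards [(isOpen_lt continuous_const continuous_fst).mem_nhds hp] with q hq
  unfold hk; rw [if_pos hq]

lemma hk_scale {τ : ℝ} (hτ : 0 < τ) (f : Euc N → ℝ) :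
    ∫ z, hk τ z * f z = ∫ z, G1 z * f (Real.sqrt τ • z) := by
  have hs := Real.sqrt_pos.2 hτ
  have := Measure.integral_comp_smul_of_nonneg (volume : Measure (Euc N)) (fun z => hk τ z * f z) (Real.sqrt τ) (hR := hs.le)
  rw [finrank_euclideanSpace, Fintype.card_fin] at this
  have h2 : ∫ z, hk τ z * f z = Real.sqrt τ ^ N • ∫ z, hk τ (Real.sqrt τ • z) * f (Real.sqrt τ • z) := by
    rw [this, smul_smul, mul_inv_cancel₀ (by positivity), one_smul]
  rw [h2, ← integral_smul]
  congr 1; ext z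
  unfold hk
  rw [if_pos hτ, smul_smul, inv_mul_cancel₀ hs.ne', one_smul, smul_eq_mul]
  field_simp

lemma hk_scale_integrable {τ : ℝ} (hτ : 0 < τ) (f : Euc N → ℝ) :
    Integrable (fun z => hk τ z * f z) ↔ Integrable (fun z => G1 z * f (Real.sqrt τ • z)) := by
  have hs := Real.sqrt_pos.2 hτ
  rw [← integrable_comp_smul_iff volume (fun z => hk τ z * f z) hs.ne']
  have : (fun z : Euc N => G1 z * f (Real.sqrt τ • z)) = fun z => (Real.sqrt τ ^ N) * (hk τ (Real.sqrt τ • z) * f (Real.sqrt τ • z)) := by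
    ext z
    unfold hk
    rw [if_pos hτ, smul_smul, inv_mul_cancel₀ hs.ne', one_smul]
    field_simp
  rw [this, integrable_const_mul_iff]
  exact (isUnit_iff_ne_zero.2 (by positivity))

lemma hk_integral {τ : ℝ} (hτ : 0 < τ) : ∫ z : Euc N, hk τ z = 1 := by
  have := hk_scale hτ (fun _ : Euc N => 1)
  simpa [G1_integral] using this

lemma hk_integrable {τ : ℝ} : Integrable (fun z : Euc N => hk τ z) := by
  rcases lt_or_ge 0 τ with h | h
  · have := (hk_scale_integrable h (fun _ : Euc N => 1))
    simp only [mul_one] at this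
    exact this.2 G1_integrable
  · simp [hk_of_nonpos h]

/-- `τ^{-N/2} G(z/√τ) ≤ C |z|^{-N}` -/
lemma hk_le_norm : ∃ C : ℝ, 0 < C ∧ ∀ (τ : ℝ) (z : Euc N), ‖z‖ ^ N * hk τ z ≤ C := by
  obtain ⟨C, hC, h⟩ := G1_le_pow (N := N) N
  refine ⟨C, hC, fun τ z => ?_⟩
  unfold hk
  split_ifs with hτ
  · refine le_trans (le_of_eq ?_) (h ((Real.sqrt τ)⁻¹ • z))
    have hs := Real.sqrt_pos.2 hτ
    rw [norm_smul, Real.norm_of_nonneg (by positivity), mul_pow, inv_pow]; ring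
  · simpa using hC.le

lemma hk_comp_sub_integrable {τ : ℝ} (x : Euc N) : Integrable (fun y : Euc N => hk τ (x - y)) :=
  (hk_integrable (τ := τ)).comp_sub_left x

/-- the weight `1 + |x|^{-γ}` -/
def wt (γ : ℝ) (x : Euc N) : ℝ := 1 + ‖x‖ ^ (-γ)

lemma wt_pos (γ : ℝ) (x : Euc N) : 0 < wt γ x := by unfold wt; positivity

lemma wt_measurable (γ : ℝ) : Measurable (wt γ : Euc N → ℝ) := by
  unfold wt; fun_prop

lemma wt_contAt (γ : ℝ) {x : Euc N} (hx : x ≠ 0) : ContinuousAt (wt γ : Euc N → ℝ) x := by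
  unfold wt
  exact continuousAt_const.add (continuous_norm.continuousAt.rpow_const (Or.inl (norm_ne_zero_iff.2 hx)))

lemma ball_rpow_integrable [NeZero N] {γ : ℝ} (hγ : γ < N) (R : ℝ) :
    IntegrableOn (fun x : Euc N => ‖x‖ ^ (-γ)) (Metric.ball 0 R) := by
  haveI : Nontrivial (Euc N) := by
    refine Module.nontrivial_of_finrank_pos (R := ℝ) ?_
    rw [finrank_euclideanSpace, Fintype.card_fin]; exact Nat.pos_of_ne_zero (NeZero.ne N)
  rw [integrableOn_fun_norm_addHaar (volume : Measure (Euc N)) (f := fun y : ℝ => y ^ (-γ))]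
  rw [finrank_euclideanSpace, Fintype.card_fin]
  have h1 : IntegrableOn (fun y : ℝ => y ^ ((N:ℝ) - 1 - γ)) (Ioo 0 R) := by
    rcases le_or_gt R 0 with h | h
    · simp [h]
    · have := intervalIntegral.intervalIntegrable_rpow' (a := 0) (b := R) (r := (N:ℝ) - 1 - γ) (by linarith)
      rw [intervalIntegrable_iff_integrableOn_Ioo_of_le h.le] at this
      exact this
  refine h1.congr_fun (fun y hy => ?_) measurableSet_Ioo
  have hN : 1 ≤ N := Nat.one_le_iff_ne_zero.2 (NeZero.ne N)
  simp only [smul_eq_mul]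
  rw [← Real.rpow_natCast, ← Real.rpow_add hy.1]
  congr 1
  push_cast [hN]; ring

lemma wt_integrableOn_ball [NeZero N] {γ : ℝ} (hγ : γ < N) (R : ℝ) :
    IntegrableOn (wt γ : Euc N → ℝ) (Metric.ball 0 R) := by
  unfold wt
  exact (integrableOn_const (by exact Metric.isBounded_ball.measure_lt_top.ne)).add (ball_rpow_integrable hγ R)

lemma ball_rpow_scale {γ : ℝ} {R : ℝ} (hR : 0 < R) :
    ∫ x in Metric.ball (0 : Euc N) R, ‖x‖ ^ (-γ) = R ^ ((N:ℝ) - γ) * ∫ x in Metric.ball (0 : Euc N) 1, ‖x‖ ^ (-γ) := by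
  have := Measure.setIntegral_comp_smul_of_pos (volume : Measure (Euc N)) (fun x => ‖x‖ ^ (-γ)) (Metric.ball (0 : Euc N) 1) hR
  rw [finrank_euclideanSpace, Fintype.card_fin, smul_unitBall hR.ne'] at this
  simp only [Real.norm_of_nonneg hR.le] at this
  have h2 : ∫ x in Metric.ball (0 : Euc N) 1, ‖R • x‖ ^ (-γ) = R ^ (-γ) * ∫ x in Metric.ball (0 : Euc N) 1, ‖x‖ ^ (-γ) := by
    rw [← integral_const_mul]
    congr 1; ext x
    rw [norm_smul, Real.norm_of_nonneg hR.le, Real.mul_rpow hR.le (norm_nonneg _)]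
  rw [h2, smul_eq_mul] at this
  have h3 : R ^ ((N:ℝ) - γ) = R ^ N * R ^ (-γ) := by
    rw [sub_eq_add_neg, Real.rpow_add hR, Real.rpow_natCast]
  rw [h3, mul_assoc, this, ← mul_assoc, mul_inv_cancel₀ (by positivity), one_mul]

/-- Lemma K -/
lemma hk_wt [NeZero N] {γ : ℝ} (hγ0 : 0 ≤ γ) (hγ : γ < N) :
    ∃ C : ℝ, 0 < C ∧ ∀ (τ : ℝ) (x : Euc N), x ≠ 0 →
      Integrable (fun y => hk τ (x - y) * wt γ y) ∧ ∫ y, hk τ (x - y) * wt γ y ≤ C * wt γ x := by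
  obtain ⟨C1, hC1, h1⟩ := hk_le_norm (N := N)
  set I := ∫ x in Metric.ball (0 : Euc N) 1, ‖x‖ ^ (-γ) with hI
  have hI0 : 0 ≤ I := integral_nonneg (fun x => by positivity)
  refine ⟨1 + 2 ^ γ + C1 * 2 ^ γ * I , by positivity, fun τ x hx => ?_⟩
  have hx0 : 0 < ‖x‖ := norm_pos_iff.2 hx
  set R := ‖x‖ / 2 with hR
  have hR0 : 0 < R := by positivity
  set B : Set (Euc N) := Metric.ball 0 R with hB
  -- dominating function
  set D : Euc N → ℝ := fun y => (1 + R ^ (-γ)) * hk τ (x - y) + B.indicator (fun y => C1 * (R ^ N)⁻¹ * ‖y‖ ^ (-γ)) y with hD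
  have hDint : Integrable D := by
    refine ((hk_comp_sub_integrable x).const_mul _).add ?_
    rw [integrable_indicator_iff Metric.isOpen_ball.measurableSet]
    exact (ball_rpow_integrable hγ R).const_mul _
  have hle : ∀ y, hk τ (x - y) * wt γ y ≤ D y := by
    intro y
    have hk0 := hk_nonneg τ (x - y)
    simp only [hD, wt]
    by_cases hy : y ∈ B
    · rw [indicator_of_mem hy]
      have hy' : ‖y‖ < R := by simpa [hB] using hy
      have h3 : R ≤ ‖x - y‖ := by
        have := norm_sub_norm_le x y
        linarith
      have h4 : hk τ (x - y) ≤ C1 * (R ^ N)⁻¹ := by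
        rw [← div_eq_mul_inv, le_div_iff₀ (by positivity)]
        refine le_trans ?_ (h1 τ (x - y))
        rw [mul_comm]
        gcongr
      have h5 : 0 ≤ ‖y‖ ^ (-γ) := by positivity
      have h6 : 0 ≤ R ^ (-γ) := by positivity
      nlinarith [mul_le_mul_of_nonneg_right h4 h5, mul_nonneg h6 hk0]
    · rw [indicator_of_notMem hy, add_zero, mul_comm]
      have hy' : R ≤ ‖y‖ := by simpa [hB] using hy
      have : ‖y‖ ^ (-γ) ≤ R ^ (-γ) := Real.rpow_le_rpow_of_nonpos hR0 hy' (by linarith)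
      gcongr
  have hm : AEStronglyMeasurable (fun y => hk τ (x - y) * wt γ y) := by
    refine Measurable.aestronglyMeasurable (Measurable.mul ?_ (wt_measurable γ))
    exact hk_measurable.comp (measurable_const.prodMk (measurable_const.sub measurable_id))
  have hh_int : Integrable (fun y => hk τ (x - y) * wt γ y) := by
    refine hDint.mono' hm (Eventually.of_forall fun y => ?_)
    rw [Real.norm_of_nonneg (mul_nonneg (hk_nonneg _ _) (wt_pos _ _).le)]
    exact hle y
  refine ⟨hh_int, (integral_mono hh_int hDint hle).trans ?_⟩
  simp only [hD]
  rw [integral_add ((hk_comp_sub_integrable x).const_mul _)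
    ((integrable_indicator_iff Metric.isOpen_ball.measurableSet).2 ((ball_rpow_integrable hγ R).const_mul _)),
    integral_const_mul, integral_indicator Metric.isOpen_ball.measurableSet, integral_const_mul,
    ball_rpow_scale hR0]
  have h7 : ∫ y, hk τ (x - y) ≤ 1 := by
    rw [integral_sub_left_eq_self (fun y => hk τ y) volume x]
    rcases lt_or_ge 0 τ with h | h
    · rw [hk_integral h]
    · simp [hk_of_nonpos h]
  have h8 : R ^ (-γ) = 2 ^ γ * ‖x‖ ^ (-γ) := by
    rw [hR, Real.div_rpow hx0.le (by norm_num), Real.rpow_neg (by norm_num : (0:ℝ) ≤ 2)]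
    field_simp
  have h9 : C1 * (R ^ N)⁻¹ * (R ^ ((N:ℝ) - γ) * I) = C1 * I * R ^ (-γ) := by
    rw [sub_eq_add_neg, Real.rpow_add hR0, Real.rpow_natCast]
    field_simp
  rw [← hI, h9, h8]
  clear_value I
  unfold wt
  have e1 : 0 ≤ ‖x‖ ^ (-γ) := by positivity
  have e2 : (0:ℝ) < 2 ^ γ := by positivity
  have e3 : (1 + 2 ^ γ * ‖x‖ ^ (-γ)) * ∫ y, hk τ (x - y) ≤ (1 + 2 ^ γ * ‖x‖ ^ (-γ)) * 1 :=
    mul_le_mul_of_nonneg_left h7 (by positivity)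
  have e4 : 0 ≤ C1 * 2 ^ γ * I := by positivity
  nlinarith [mul_nonneg e4 e1, mul_nonneg e2.le e1]

end HeatAux

namespace HeatAux

set_option linter.all false
open Set Topology

variable {N : ℕ}

lemma hk_integrable_strip (a b : ℝ) :
    Integrable (fun p : ℝ × Euc N => hk p.1 p.2) ((volume.restrict (Ioo a b)).prod volume) := by
  rw [integrable_prod_iff hk_measurable.aestronglyMeasurable]
  refine ⟨Eventually.of_forall fun τ => hk_integrable, ?_⟩
  have hm : AEStronglyMeasurable (fun τ : ℝ => ∫ y : Euc N, ‖hk τ y‖) (volume.restrict (Ioo a b)) := by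
    exact (hk_measurable.norm.stronglyMeasurable.integral_prod_right').aestronglyMeasurable
  refine (integrable_const (1:ℝ)).mono' hm (Eventually.of_forall fun τ => ?_)
  simp only [Real.norm_of_nonneg (hk_nonneg _ _)]
  rw [Real.norm_of_nonneg (integral_nonneg fun y => hk_nonneg _ _)]
  rcases lt_or_ge 0 τ with h | h
  · rw [hk_integral h]
  · simp [hk_of_nonpos h]

lemma gauss_ibp (g H : Euc N → ℝ) (i : Fin N) (c C : ℝ) (hgc : Continuous g) (hHc : Continuous H)
    (hgb : ∀ y, |g y| ≤ C) (hHb : ∀ y, |H y| ≤ C)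
    (h2 : ∀ y, HasLineDerivAt ℝ g (H y) y (EuclideanSpace.single i (1:ℝ))) :
    ∫ z, G1 z * (g (c • z) * z i) = 2 * c * ∫ z, G1 z * H (c • z) := by
  have hC : 0 ≤ C := (abs_nonneg _).trans (hgb 0)
  have hline : ∀ z, HasLineDerivAt ℝ (fun z => g (c • z)) (c * H (c • z)) z (EuclideanSpace.single i (1:ℝ)) := by
    intro z
    have := h2 (c • z)
    unfold HasLineDerivAt at this ⊢
    have h3 : HasDerivAt (fun t : ℝ => c * t) c 0 := by simpa using (hasDerivAt_id (0:ℝ)).const_mul c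
    have h4 := HasDerivAt.scomp_of_eq (0:ℝ) this h3 (by simp)
    simp only [smul_eq_mul] at h4
    convert h4 using 1
    ext t
    simp [smul_add, smul_smul]
  have hh_int1 : ∀ f : Euc N → ℝ, Continuous f → ∀ D, (∀ y, |f y| ≤ D) → Integrable (fun z => G1 z * f (c • z)) := by
    intro f hf D hD
    refine (G1_integrable.mul_const D).mono' (by exact (G1_cont.mul (hf.comp (continuous_const_smul c))).aestronglyMeasurable) (Eventually.of_forall fun z => ?_)
    rw [norm_mul, Real.norm_of_nonneg (G1_pos z).le]
    exact mul_le_mul_of_nonneg_left (hD _) (G1_pos z).le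
  have hB := integral_bilinear_hasLineDerivAt_right_eq_neg_left_of_integrable
    (μ := (volume : Measure (Euc N))) (f := G1) (f' := fun z => -(1/2) * z i * G1 z)
    (g := fun z => g (c • z)) (g' := fun z => c * H (c • z)) (v := EuclideanSpace.single i (1:ℝ))
    (B := ContinuousLinearMap.mul ℝ ℝ) ?_ ?_ ?_ (fun x _ => G1_hasFDeriv_single x i) (fun x _ => hline x)
  · simp only [ContinuousLinearMap.mul_apply'] at hB
    have e1 : ∫ z, G1 z * (c * H (c • z)) = c * ∫ z, G1 z * H (c • z) := by
      rw [← integral_const_mul]; congr 1; ext z; ring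
    have e2 : ∫ z : Euc N, -(1/2) * z i * G1 z * g (c • z) = -(1/2) * ∫ z, G1 z * (g (c • z) * z i) := by
      rw [← integral_const_mul]; congr 1; ext z; ring
    rw [e1, e2] at hB
    linarith
  · simp only [ContinuousLinearMap.mul_apply']
    refine ((G1_pow_integrable 1).mul_const (C)).mono' ?_ (Eventually.of_forall fun z => ?_)
    · refine Continuous.aestronglyMeasurable ?_
      have := G1_cont (N := N)
      exact ((continuous_const.mul (by fun_prop)).mul this).mul (hgc.comp (continuous_const_smul c))
    · have h5 : |z i| ≤ ‖z‖ := by simpa using PiLp.norm_apply_le z i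
      have := G1_pos z
      rw [norm_mul, norm_mul, norm_mul, Real.norm_of_nonneg this.le, pow_one]
      simp only [Real.norm_eq_abs]
      have e : |-(1/2:ℝ)| = 1/2 := by norm_num
      rw [e]
      have : 1/2 * |z i| * G1 z ≤ ‖z‖ * G1 z := by
        gcongr; linarith [abs_nonneg (z i)]
      have h0 := abs_nonneg (g (c • z))
      exact mul_le_mul this (hgb _) h0 (by positivity)
  · simp only [ContinuousLinearMap.mul_apply']
    have := (hh_int1 H hHc C hHb).const_mul c
    refine this.congr (Eventually.of_forall fun z => ?_)
    simp only []; ring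
  · simp only [ContinuousLinearMap.mul_apply']
    exact hh_int1 g hgc C hgb

set_option maxHeartbeats 1000000 in
lemma heat_identity {τ1 : ℝ} (hτ1 : 0 < τ1) (θ θt : ℝ → Euc N → ℝ)
    (g H : ℝ → Euc N → Fin N → ℝ) (C : ℝ)
    (hθc : ContinuousOn (fun p : ℝ × Euc N => θ p.1 p.2) (Icc 0 τ1 ×ˢ univ))
    (hθtc : ContinuousOn (fun p : ℝ × Euc N => θt p.1 p.2) (Ioo 0 τ1 ×ˢ univ))
    (hgc : ∀ i, ContinuousOn (fun p : ℝ × Euc N => g p.1 p.2 i) (Ioo 0 τ1 ×ˢ univ))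
    (hHc : ∀ i, ContinuousOn (fun p : ℝ × Euc N => H p.1 p.2 i) (Ioo 0 τ1 ×ˢ univ))
    (hθb : ∀ τ ∈ Icc 0 τ1, ∀ z, |θ τ z| ≤ C)
    (hθtb : ∀ τ ∈ Ioo 0 τ1, ∀ z, |θt τ z| ≤ C)
    (hgb : ∀ τ ∈ Ioo 0 τ1, ∀ z i, |g τ z i| ≤ C)
    (hHb : ∀ τ ∈ Ioo 0 τ1, ∀ z i, |H τ z i| ≤ C)
    (h1 : ∀ τ ∈ Ioo 0 τ1, ∀ z, HasDerivAt (fun s => θ s (Real.sqrt s • z))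
      (θt τ (Real.sqrt τ • z) + (1 / (2 * Real.sqrt τ)) * ∑ i, g τ (Real.sqrt τ • z) i * z i) τ)
    (h2 : ∀ τ ∈ Ioo 0 τ1, ∀ y i, HasLineDerivAt ℝ (fun y => g τ y i) (H τ y i) y
      (EuclideanSpace.single i (1:ℝ))) :
    ∫ p in Ioo 0 τ1 ×ˢ (univ : Set (Euc N)), hk p.1 p.2 * (θt p.1 p.2 + ∑ i, H p.1 p.2 i)
      = (∫ z, hk τ1 z * θ τ1 z) - θ 0 0 := by
  have hC : 0 ≤ C := (abs_nonneg _).trans (hθb 0 ⟨le_rfl, hτ1.le⟩ 0)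
  -- slices are continuous
  have slice : ∀ (f : ℝ × Euc N → ℝ) (s : Set ℝ), ContinuousOn f (s ×ˢ univ) → ∀ τ ∈ s, ∀ c : ℝ,
      Continuous (fun z : Euc N => f (τ, c • z)) := by
    intro f s hf τ hτ c
    rw [← continuousOn_univ]
    refine hf.comp (Continuous.continuousOn (by fun_prop)) (fun z _ => ⟨hτ, mem_univ _⟩)
  set φ : ℝ → ℝ := fun s => ∫ z, G1 z * θ s (Real.sqrt s • z) with hφ
  set R : ℝ → Euc N → ℝ := fun τ y => θt τ y + ∑ i, H τ y i with hR
  -- φ is continuous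
  have hφc : ContinuousOn φ (Icc 0 τ1) := by
    refine continuousOn_of_dominated (bound := fun z => G1 z * C) ?_ ?_ (G1_integrable.mul_const _) ?_
    · intro τ hτ
      exact (G1_cont.mul (slice _ _ hθc τ hτ (Real.sqrt τ))).aestronglyMeasurable
    · intro τ hτ
      refine Eventually.of_forall fun z => ?_
      rw [norm_mul, Real.norm_of_nonneg (G1_pos z).le]
      exact mul_le_mul_of_nonneg_left (hθb τ hτ _) (G1_pos z).le
    · refine Eventually.of_forall fun z => continuousOn_const.mul ?_
      refine hθc.comp (f := fun s : ℝ => (s, Real.sqrt s • z)) (Continuous.continuousOn (by fun_prop)) (fun s hs => ⟨hs, mem_univ _⟩)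
  -- derivative
  have hder : ∀ τ ∈ Ioo 0 τ1, HasDerivAt φ (∫ z, hk τ z * R τ z) τ := by
    intro τ hτ
    have hsτ := Real.sqrt_pos.2 hτ.1
    have hcg : ∀ τ ∈ Ioo 0 τ1, Continuous (fun z : Euc N => ∑ i, g τ (Real.sqrt τ • z) i * z i) := by
      intro τ hτ
      refine continuous_finsetSum _ fun i _ => ?_
      exact (slice _ _ (hgc i) τ hτ (Real.sqrt τ)).mul (by fun_prop)
    have hsum : ∀ τ ∈ Ioo 0 τ1, ∀ z : Euc N, |∑ i, g τ (Real.sqrt τ • z) i * z i| ≤ N * C * ‖z‖ := by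
      intro τ hτ z
      refine (Finset.abs_sum_le_sum_abs _ _).trans ?_
      have : ∀ i ∈ (Finset.univ : Finset (Fin N)), |g τ (Real.sqrt τ • z) i * z i| ≤ C * ‖z‖ := by
        intro i _
        rw [abs_mul]
        have h5 : |z i| ≤ ‖z‖ := by simpa using PiLp.norm_apply_le z i
        exact mul_le_mul (hgb τ hτ _ i) h5 (abs_nonneg _) hC
      refine (Finset.sum_le_sum this).trans (le_of_eq ?_)
      simp; ring
    have hmain := hasDerivAt_integral_of_dominated_loc_of_deriv_le
      (μ := (volume : Measure (Euc N))) (x₀ := τ) (s := Ioo (τ/2) τ1)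
      (F := fun s z => G1 z * θ s (Real.sqrt s • z))
      (F' := fun s z => G1 z * (θt s (Real.sqrt s • z) + (1 / (2 * Real.sqrt s)) * ∑ i, g s (Real.sqrt s • z) i * z i))
      (bound := fun z => C * G1 z + (1 / (2 * Real.sqrt (τ/2))) * (N * C) * (‖z‖ ^ 1 * G1 z))
      (Ioo_mem_nhds (by linarith [hτ.1]) hτ.2) ?_ ?_ ?_ ?_ ?_ ?_
    · have hv : ∫ z, hk τ z * R τ z = ∫ z, G1 z * (θt τ (Real.sqrt τ • z) + (1 / (2 * Real.sqrt τ)) * ∑ i, g τ (Real.sqrt τ • z) i * z i) := by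
        rw [hk_scale hτ.1]
        have i1 : Integrable (fun z => G1 z * θt τ (Real.sqrt τ • z)) := by
          refine (G1_integrable.mul_const C).mono' (G1_cont.mul (slice _ _ hθtc τ hτ (Real.sqrt τ))).aestronglyMeasurable (Eventually.of_forall fun z => ?_)
          rw [norm_mul, Real.norm_of_nonneg (G1_pos z).le]
          exact mul_le_mul_of_nonneg_left (hθtb τ hτ _) (G1_pos z).le
        have i2 : ∀ i, Integrable (fun z => G1 z * H τ (Real.sqrt τ • z) i) := by
          intro i
          refine (G1_integrable.mul_const C).mono' (G1_cont.mul (slice _ _ (hHc i) τ hτ (Real.sqrt τ))).aestronglyMeasurable (Eventually.of_forall fun z => ?_)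
          rw [norm_mul, Real.norm_of_nonneg (G1_pos z).le]
          exact mul_le_mul_of_nonneg_left (hHb τ hτ _ i) (G1_pos z).le
        have i3 : ∀ i, Integrable (fun z : Euc N => G1 z * (g τ (Real.sqrt τ • z) i * z i)) := by
          intro i
          refine ((G1_pow_integrable 1).mul_const (C)).mono' ?_ (Eventually.of_forall fun z => ?_)
          · exact (G1_cont.mul ((slice _ _ (hgc i) τ hτ (Real.sqrt τ)).mul (by fun_prop))).aestronglyMeasurable
          · have h5 : |z i| ≤ ‖z‖ := by simpa using PiLp.norm_apply_le z i
            rw [norm_mul, norm_mul, Real.norm_of_nonneg (G1_pos z).le]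
            have := mul_le_mul (hgb τ hτ (Real.sqrt τ • z) i) h5 (abs_nonneg _) hC
            calc G1 z * (‖g τ (Real.sqrt τ • z) i‖ * ‖z i‖) ≤ G1 z * (C * ‖z‖) :=
                  mul_le_mul_of_nonneg_left this (G1_pos z).le
              _ = _ := by ring
        simp only [hR, mul_add]
        rw [integral_add i1, integral_add i1]
        · congr 1
          have e1 : ∀ z : Euc N, G1 z * (1 / (2 * Real.sqrt τ) * ∑ i, g τ (Real.sqrt τ • z) i * z i) = ∑ i, (1 / (2 * Real.sqrt τ)) * (G1 z * (g τ (Real.sqrt τ • z) i * z i)) := by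
            intro z
            rw [Finset.mul_sum, Finset.mul_sum]
            exact Finset.sum_congr rfl fun i _ => by ring
          have e2 : ∀ z : Euc N, G1 z * ∑ i, H τ (Real.sqrt τ • z) i = ∑ i, G1 z * H τ (Real.sqrt τ • z) i :=
            fun z => Finset.mul_sum _ _ _
          simp only [e1, e2]
          rw [integral_finsetSum _ (fun i _ => i2 i), integral_finsetSum _ (fun i _ => (i3 i).const_mul _)]
          refine Finset.sum_congr rfl fun i _ => ?_
          rw [integral_const_mul, gauss_ibp (fun y => g τ y i) (fun y => H τ y i) i (Real.sqrt τ) C ?_ ?_ (fun y => hgb τ hτ y i) (fun y => hHb τ hτ y i) (fun y => h2 τ hτ y i)]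
          · field_simp
          · simpa using slice _ _ (hgc i) τ hτ 1
          · simpa using slice _ _ (hHc i) τ hτ 1
        · have e1 : ∀ z : Euc N, G1 z * (1 / (2 * Real.sqrt τ) * ∑ i, g τ (Real.sqrt τ • z) i * z i) = ∑ i, (1 / (2 * Real.sqrt τ)) * (G1 z * (g τ (Real.sqrt τ • z) i * z i)) := by
            intro z
            rw [Finset.mul_sum, Finset.mul_sum]
            exact Finset.sum_congr rfl fun i _ => by ring
          simp only [e1]
          exact integrable_finsetSum _ (fun i _ => (i3 i).const_mul _)
        · simp only [Finset.mul_sum]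
          exact integrable_finsetSum _ (fun i _ => i2 i)
      rw [hv]; exact hmain.2
    · filter_upwards [Ioo_mem_nhds hτ.1 hτ.2] with s hs
      exact (G1_cont.mul (slice _ _ hθc s (Ioo_subset_Icc_self hs) (Real.sqrt s))).aestronglyMeasurable
    · refine (G1_integrable.mul_const C).mono' (G1_cont.mul (slice _ _ hθc τ (Ioo_subset_Icc_self hτ) (Real.sqrt τ))).aestronglyMeasurable (Eventually.of_forall fun z => ?_)
      rw [norm_mul, Real.norm_of_nonneg (G1_pos z).le]
      exact mul_le_mul_of_nonneg_left (hθb τ (Ioo_subset_Icc_self hτ) _) (G1_pos z).le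
    · exact (G1_cont.mul ((slice _ _ hθtc τ hτ (Real.sqrt τ)).add (continuous_const.mul (hcg τ hτ)))).aestronglyMeasurable
    · refine Eventually.of_forall fun z s hs => ?_
      have hs' : s ∈ Ioo 0 τ1 := ⟨by linarith [hs.1, hτ.1], hs.2⟩
      rw [norm_mul, Real.norm_of_nonneg (G1_pos z).le, pow_one]
      have hG := G1_pos z
      have hsq : 0 < Real.sqrt (τ/2) := Real.sqrt_pos.2 (by linarith [hτ.1])
      have hsq2 : Real.sqrt (τ/2) ≤ Real.sqrt s := Real.sqrt_le_sqrt hs.1.le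
      have hb : ‖θt s (Real.sqrt s • z) + 1 / (2 * Real.sqrt s) * ∑ i, g s (Real.sqrt s • z) i * z i‖ ≤ C + (1 / (2 * Real.sqrt (τ/2))) * (N * C * ‖z‖) := by
        refine (norm_add_le _ _).trans (add_le_add (hθtb s hs' _) ?_)
        rw [norm_mul, Real.norm_of_nonneg (by positivity)]
        exact mul_le_mul (by gcongr) (hsum s hs' z) (norm_nonneg _) (by positivity)
      calc G1 z * _ ≤ G1 z * (C + (1 / (2 * Real.sqrt (τ/2))) * (N * C * ‖z‖)) := mul_le_mul_of_nonneg_left hb hG.le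
        _ = _ := by ring
    · exact (G1_integrable.const_mul C).add ((G1_pow_integrable 1).const_mul _)
    · refine Eventually.of_forall fun z s hs => ?_
      have hs' : s ∈ Ioo 0 τ1 := ⟨by linarith [hs.1, hτ.1], hs.2⟩
      exact (h1 s hs' z).const_mul (G1 z)
  -- integrability on the strip
  have hRc : ContinuousOn (fun p : ℝ × Euc N => R p.1 p.2) (Ioo 0 τ1 ×ˢ univ) :=
    hθtc.add (continuousOn_finsetSum _ fun i _ => hHc i)
  have hRb : ∀ τ ∈ Ioo 0 τ1, ∀ z, |R τ z| ≤ C + N * C := by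
    intro τ hτ z
    refine (abs_add_le _ _).trans (add_le_add (hθtb τ hτ z) ((Finset.abs_sum_le_sum_abs _ _).trans ?_))
    refine (Finset.sum_le_sum fun i _ => hHb τ hτ z i).trans (le_of_eq ?_)
    simp
  have hprod : ((volume : Measure (ℝ × Euc N)).restrict (Ioo 0 τ1 ×ˢ univ)) = ((volume : Measure ℝ).restrict (Ioo 0 τ1)).prod (volume : Measure (Euc N)) := by
    rw [Measure.volume_eq_prod, ← Measure.prod_restrict, Measure.restrict_univ]
  have hh_int : Integrable (fun p : ℝ × Euc N => hk p.1 p.2 * R p.1 p.2) ((volume.restrict (Ioo 0 τ1)).prod volume) := by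
    refine ((hk_integrable_strip 0 τ1).mul_const (C + N * C)).mono' ?_ ?_
    · refine hk_measurable.aestronglyMeasurable.mul ?_
      rw [← hprod]
      exact hRc.aestronglyMeasurable (measurableSet_Ioo.prod MeasurableSet.univ)
    · rw [← hprod]
      filter_upwards [ae_restrict_mem (measurableSet_Ioo.prod MeasurableSet.univ)] with p hp
      rw [norm_mul, Real.norm_of_nonneg (hk_nonneg _ _)]
      exact mul_le_mul_of_nonneg_left (hRb _ hp.1 _) (hk_nonneg _ _)
  have hmain : ∫ p in Ioo 0 τ1 ×ˢ (univ : Set (Euc N)), hk p.1 p.2 * R p.1 p.2 = ∫ τ in (0:ℝ)..τ1, ∫ z, hk τ z * R τ z := by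
    rw [hprod, integral_prod _ hh_int, intervalIntegral.integral_of_le hτ1.le, integral_Ioc_eq_integral_Ioo]
  rw [hmain, intervalIntegral.integral_eq_sub_of_hasDerivAt_of_le hτ1.le hφc hder]
  · congr 1
    · simp only [hφ]; rw [hk_scale hτ1]
    · simp only [hφ, Real.sqrt_zero, zero_smul]
      rw [integral_mul_const, G1_integral, one_mul]
  · rw [intervalIntegrable_iff_integrableOn_Ioo_of_le hτ1.le]
    exact hh_int.integral_prod_left

end HeatAux

namespace HeatAux

set_option linter.all false
open Set Topology

variable {N : ℕ}

/-- backward heat operator applied to a test function, as in the statement -/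
def bh (ζ : ℝ × Euc N → ℝ) (p : ℝ × Euc N) : ℝ :=
  -(deriv (fun s => ζ (s, p.2)) p.1) - lapl (fun y => ζ (p.1, y)) p.2

abbrev eN (i : Fin N) : Euc N := EuclideanSpace.single i (1:ℝ)

lemma hasFDerivAt_right (t : ℝ) (x : Euc N) :
    HasFDerivAt (fun y : Euc N => (t, y)) (ContinuousLinearMap.inr ℝ ℝ (Euc N)) x := by
  simpa using (hasFDerivAt_prodMk_right t x)

lemma bh_eq {ζ : ℝ × Euc N → ℝ} (hζ : ContDiff ℝ (⊤ : ℕ∞) ζ) (p : ℝ × Euc N) :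
    bh ζ p = -(fderiv ℝ ζ p (1, 0)) - ∑ i, fderiv ℝ (fderiv ℝ ζ) p (0, eN i) (0, eN i) := by
  have hd : Differentiable ℝ ζ := hζ.differentiable (by simp)
  have hd2 : Differentiable ℝ (fderiv ℝ ζ) := (hζ.fderiv_right (m := (⊤ : ℕ∞)) (by simp)).differentiable (by simp)
  unfold bh lapl
  congr 1
  · congr 1
    have h1 : HasDerivAt (fun s : ℝ => (s, p.2)) ((1 : ℝ), (0 : Euc N)) p.1 :=
      (hasDerivAt_id p.1).prodMk (hasDerivAt_const _ _)
    exact ((hd p).hasFDerivAt.comp_hasDerivAt p.1 h1).deriv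
  · refine Finset.sum_congr rfl fun i _ => ?_
    have h1 : fderiv ℝ (fun y => ζ (p.1, y)) = fun y => (fderiv ℝ ζ (p.1, y)).comp (ContinuousLinearMap.inr ℝ ℝ (Euc N)) := by
      ext1 y
      exact ((hd (p.1, y)).hasFDerivAt.comp y (hasFDerivAt_right p.1 y)).fderiv
    rw [h1]
    have h2 : HasFDerivAt (fun y => fderiv ℝ ζ (p.1, y)) ((fderiv ℝ (fderiv ℝ ζ) p).comp (ContinuousLinearMap.inr ℝ ℝ (Euc N))) p.2 :=
      (hd2 (p.1, p.2)).hasFDerivAt.comp p.2 (hasFDerivAt_right p.1 p.2)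
    have h3 := h2.clm_comp (hasFDerivAt_const (ContinuousLinearMap.inr ℝ ℝ (Euc N)) p.2)
    rw [h3.fderiv]
    simp

lemma bh_cont {ζ : ℝ × Euc N → ℝ} (hζ : ContDiff ℝ (⊤ : ℕ∞) ζ) : Continuous (bh ζ) := by
  have hc1 : Continuous (fderiv ℝ ζ) := hζ.continuous_fderiv (by simp)
  have hc2 : Continuous (fderiv ℝ (fderiv ℝ ζ)) := (hζ.fderiv_right (m := (⊤ : ℕ∞)) (by simp)).continuous_fderiv (by simp)
  have : bh ζ = fun p => -(fderiv ℝ ζ p (1, 0)) - ∑ i, fderiv ℝ (fderiv ℝ ζ) p (0, eN i) (0, eN i) := by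
    ext p; exact bh_eq hζ p
  rw [this]
  refine (hc1.clm_apply continuous_const).neg.sub (continuous_finsetSum _ fun i _ => ?_)
  exact (hc2.clm_apply continuous_const).clm_apply continuous_const

lemma bh_zero {ζ : ℝ × Euc N → ℝ} (hζ : ContDiff ℝ (⊤ : ℕ∞) ζ) {p : ℝ × Euc N} (hp : p ∉ tsupport ζ) : bh ζ p = 0 := by
  rw [bh_eq hζ]
  have h1 : fderiv ℝ ζ p = 0 := by
    by_contra h
    exact hp (support_fderiv_subset ℝ h)
  have h2 : fderiv ℝ (fderiv ℝ ζ) p = 0 := by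
    by_contra h
    exact hp ((tsupport_fderiv_subset ℝ) (support_fderiv_subset ℝ h))
  simp [h1, h2]

lemma bh_compact {ζ : ℝ × Euc N → ℝ} (hζ : ContDiff ℝ (⊤ : ℕ∞) ζ) (hs : HasCompactSupport ζ) : HasCompactSupport (bh ζ) :=
  HasCompactSupport.intro hs (fun p hp => bh_zero hζ hp)

lemma euc_decomp (z : Euc N) : z = ∑ i, z i • eN i := by
  ext j
  simp [eN, Pi.single_apply]


lemma ti_h1 {ζ : ℝ × Euc N → ℝ} (hd : Differentiable ℝ ζ) (q : ℝ × Euc N) {τ : ℝ} (hτ : 0 < τ) (z : Euc N) :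
    HasDerivAt (fun s => ζ (q.1 + s, q.2 + Real.sqrt s • z))
      (fderiv ℝ ζ (q.1 + τ, q.2 + Real.sqrt τ • z) (1, 0) + (1 / (2 * Real.sqrt τ)) * ∑ i, fderiv ℝ ζ (q.1 + τ, q.2 + Real.sqrt τ • z) (0, eN i) * z i) τ := by
    have hc : HasDerivAt (fun s : ℝ => (q.1 + s, q.2 + Real.sqrt s • z)) ((1:ℝ), (1 / (2 * Real.sqrt τ)) • z) τ := by
      refine HasDerivAt.prodMk ((hasDerivAt_id τ).const_add q.1) ?_
      exact ((Real.hasDerivAt_sqrt hτ.ne').smul_const z).const_add q.2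
    have := (hd (q.1 + τ, q.2 + Real.sqrt τ • z)).hasFDerivAt.comp_hasDerivAt τ hc
    refine this.congr_deriv ?_
    have e : ((1:ℝ), (1 / (2 * Real.sqrt τ)) • z) = ((1:ℝ), (0 : Euc N)) + (1 / (2 * Real.sqrt τ)) • ContinuousLinearMap.inr ℝ ℝ (Euc N) z := by
      simp
    rw [e, map_add, map_smul]
    congr 1
    rw [smul_eq_mul]
    congr 1
    conv_lhs => rw [euc_decomp z]
    rw [map_sum, map_sum]
    refine Finset.sum_congr rfl fun i _ => ?_
    rw [map_smul, map_smul, smul_eq_mul, mul_comm, ← euc_decomp z]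
    simp

lemma ti_h2 {ζ : ℝ × Euc N → ℝ} (hd2 : Differentiable ℝ (fderiv ℝ ζ)) (q : ℝ × Euc N) (τ : ℝ) (y : Euc N) (i : Fin N) :
    HasLineDerivAt ℝ (fun y => fderiv ℝ ζ (q.1 + τ, q.2 + y) (0, eN i)) (fderiv ℝ (fderiv ℝ ζ) (q.1 + τ, q.2 + y) (0, eN i) (0, eN i)) y
      (EuclideanSpace.single i (1:ℝ)) := by
    have h2 : HasFDerivAt (fun y => fderiv ℝ ζ (q.1 + τ, q.2 + y)) ((fderiv ℝ (fderiv ℝ ζ) (q.1 + τ, q.2 + y)).comp (ContinuousLinearMap.inr ℝ ℝ (Euc N))) y :=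
      (hd2 (q.1 + τ, q.2 + y)).hasFDerivAt.comp y ((hasFDerivAt_right (q.1 + τ) (q.2 + y)).comp y ((hasFDerivAt_id y).const_add q.2))
    have h3 := h2.clm_apply (hasFDerivAt_const ((0:ℝ), eN i) y)
    have h4 := h3.hasLineDerivAt (eN i)
    refine HasDerivAt.congr_deriv h4 ?_
    simp


lemma fd2_zero {ζ : ℝ × Euc N → ℝ} {p : ℝ × Euc N} (hp : p ∉ tsupport ζ) : fderiv ℝ (fderiv ℝ ζ) p = 0 := by
  by_contra h
  exact hp ((tsupport_fderiv_subset ℝ) (support_fderiv_subset ℝ h))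

lemma fd2_norm {ζ : ℝ × Euc N → ℝ} {p : ℝ × Euc N} (hp : p ∉ tsupport ζ) : ‖fderiv ℝ (fderiv ℝ ζ) p‖ = 0 := by
  rw [fd2_zero hp]; exact ContinuousLinearMap.opNorm_zero

lemma fd1_norm {ζ : ℝ × Euc N → ℝ} {p : ℝ × Euc N} (hp : p ∉ tsupport ζ) : ‖fderiv ℝ ζ p‖ = 0 := by
  have : fderiv ℝ ζ p = 0 := by
    by_contra h
    exact hp (support_fderiv_subset ℝ h)
  rw [this]; exact ContinuousLinearMap.opNorm_zero

instance prod_rinv : (volume : Measure (ℝ × Euc N)).IsAddRightInvariant :=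
  inferInstanceAs (((volume : Measure ℝ).prod (volume : Measure (Euc N))).IsAddRightInvariant)

lemma cs_bound {X F : Type*} [TopologicalSpace X] [NormedAddCommGroup F] {f : X → F} {K : Set X} (hK : IsCompact K)
    (hc : Continuous f) (h0 : ∀ x, x ∉ K → ‖f x‖ = 0) : ∃ C : ℝ, 0 ≤ C ∧ ∀ x, ‖f x‖ ≤ C := by
  obtain ⟨C, hC⟩ := hK.exists_bound_of_continuousOn hc.continuousOn
  refine ⟨max C 0, le_max_right _ _, fun x => ?_⟩
  by_cases hx : x ∈ K
  · exact (hC x hx).trans (le_max_left _ _)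
  · rw [h0 x hx]; exact le_max_right _ _

set_option maxHeartbeats 1000000 in
lemma test_identity {ζ : ℝ × Euc N → ℝ} (hζ : ContDiff ℝ (⊤ : ℕ∞) ζ) (hs : HasCompactSupport ζ)
    (q : ℝ × Euc N) : ∫ p : ℝ × Euc N, hk (p.1 - q.1) (p.2 - q.2) * bh ζ p = ζ q := by
  have hd : Differentiable ℝ ζ := hζ.differentiable (by simp)
  have hζ1 : ContDiff ℝ (⊤ : ℕ∞) (fderiv ℝ ζ) := hζ.fderiv_right (m := (⊤ : ℕ∞)) (by simp)
  have hd2 : Differentiable ℝ (fderiv ℝ ζ) := hζ1.differentiable (by simp)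
  have hc1 : Continuous (fderiv ℝ ζ) := hζ.continuous_fderiv (by simp)
  have hc2 : Continuous (fderiv ℝ (fderiv ℝ ζ)) := hζ1.continuous_fderiv (by simp)
  obtain ⟨C0, hC0', hC0⟩ := cs_bound (f := ζ) hs.isCompact hζ.continuous (fun x hx => by
    rw [image_eq_zero_of_notMem_tsupport hx]; exact norm_zero)
  obtain ⟨C1, hC1', hC1⟩ := cs_bound (f := fderiv ℝ ζ) hs.isCompact hc1 (fun x hx => fd1_norm hx)
  obtain ⟨C2, hC2', hC2⟩ := cs_bound (f := fderiv ℝ (fderiv ℝ ζ)) hs.isCompact hc2 (fun x hx => fd2_norm hx)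
  obtain ⟨M, hM⟩ := hs.isCompact.isBounded.exists_norm_le
  obtain ⟨τ1, hτ1⟩ : ∃ τ1 : ℝ, τ1 = |M| + 1 + |q.1| := ⟨_, rfl⟩
  have hτ0 : 0 < τ1 := by rw [hτ1]; positivity
  have hout : ∀ τ : ℝ, τ1 ≤ τ → ∀ z : Euc N, (q.1 + τ, z) ∉ tsupport ζ := by
    intro τ hτ z hz
    have h1 := hM _ hz
    have h2 : ‖q.1 + τ‖ ≤ M := (norm_fst_le (q.1 + τ, z)).trans h1
    rw [Real.norm_eq_abs] at h2
    have := le_abs_self (q.1 + τ)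
    have := neg_abs_le q.1
    have := le_abs_self M
    linarith
  have ne : ∀ i : Fin N, ‖((0:ℝ), eN i)‖ ≤ 1 := by
    intro i; simp [Prod.norm_def]
  have B0 : ContinuousOn (fun p : ℝ × Euc N => ζ (q.1 + p.1, q.2 + p.2)) (Icc 0 τ1 ×ˢ univ) := by
    exact (hζ.continuous.comp (by fun_prop)).continuousOn
  have B1 : ContinuousOn (fun p : ℝ × Euc N => fderiv ℝ ζ (q.1 + p.1, q.2 + p.2) (1, 0)) (Ioo 0 τ1 ×ˢ univ) := by
    exact ((hc1.comp (g := fderiv ℝ ζ) (f := fun p : ℝ × Euc N => (q.1 + p.1, q.2 + p.2)) (by fun_prop)).clm_apply continuous_const).continuousOn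
  have B2 : ∀ i : Fin N, ContinuousOn (fun p : ℝ × Euc N => fderiv ℝ ζ (q.1 + p.1, q.2 + p.2) (0, eN i)) (Ioo 0 τ1 ×ˢ univ) := by
    intro i
    exact ((hc1.comp (g := fderiv ℝ ζ) (f := fun p : ℝ × Euc N => (q.1 + p.1, q.2 + p.2)) (by fun_prop)).clm_apply continuous_const).continuousOn
  have B3 : ∀ i : Fin N, ContinuousOn (fun p : ℝ × Euc N => fderiv ℝ (fderiv ℝ ζ) (q.1 + p.1, q.2 + p.2) (0, eN i) (0, eN i)) (Ioo 0 τ1 ×ˢ univ) := by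
    intro i
    exact (((hc2.comp (g := fderiv ℝ (fderiv ℝ ζ)) (f := fun p : ℝ × Euc N => (q.1 + p.1, q.2 + p.2)) (by fun_prop)).clm_apply continuous_const).clm_apply continuous_const).continuousOn
  have B4 : ∀ τ ∈ Icc 0 τ1, ∀ z, |ζ (q.1 + τ, q.2 + z)| ≤ C0 + C1 + C2 := by
    intro τ _ z
    have := hC0 (q.1 + τ, q.2 + z)
    rw [Real.norm_eq_abs] at this; linarith
  have B5 : ∀ τ ∈ Ioo 0 τ1, ∀ z, |fderiv ℝ ζ (q.1 + τ, q.2 + z) (1, 0)| ≤ C0 + C1 + C2 := by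
    intro τ _ z
    have := (fderiv ℝ ζ (q.1 + τ, q.2 + z)).le_of_opNorm_le (hC1 _) ((1:ℝ), (0:Euc N))
    have h1 : ‖((1:ℝ), (0:Euc N))‖ = 1 := by simp [Prod.norm_def]
    rw [h1, Real.norm_eq_abs] at this; linarith
  have B6 : ∀ τ ∈ Ioo 0 τ1, ∀ z, ∀ i : Fin N, |fderiv ℝ ζ (q.1 + τ, q.2 + z) (0, eN i)| ≤ C0 + C1 + C2 := by
    intro τ _ z i
    have := (fderiv ℝ ζ (q.1 + τ, q.2 + z)).le_of_opNorm_le (hC1 _) ((0:ℝ), eN i)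
    rw [Real.norm_eq_abs] at this
    have := mul_le_mul_of_nonneg_left (ne i) hC1'
    linarith
  have B7 : ∀ τ ∈ Ioo 0 τ1, ∀ z, ∀ i : Fin N, |fderiv ℝ (fderiv ℝ ζ) (q.1 + τ, q.2 + z) (0, eN i) (0, eN i)| ≤ C0 + C1 + C2 := by
    intro τ _ z i
    have h1 := (fderiv ℝ (fderiv ℝ ζ) (q.1 + τ, q.2 + z)).le_of_opNorm_le (hC2 _) ((0:ℝ), eN i)
    have h2 := (fderiv ℝ (fderiv ℝ ζ) (q.1 + τ, q.2 + z) (0, eN i)).le_of_opNorm_le h1 ((0:ℝ), eN i)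
    rw [Real.norm_eq_abs] at h2
    have h3 := mul_le_mul_of_nonneg_left (ne i) hC2'
    have h4 : C2 * ‖((0:ℝ), eN i)‖ * ‖((0:ℝ), eN i)‖ ≤ C2 * ‖((0:ℝ), eN i)‖ * 1 :=
      mul_le_mul_of_nonneg_left (ne i) (by positivity)
    linarith
  have key := heat_identity hτ0 (fun τ z => ζ (q.1 + τ, q.2 + z))
    (fun τ z => fderiv ℝ ζ (q.1 + τ, q.2 + z) (1, 0))
    (fun τ z i => fderiv ℝ ζ (q.1 + τ, q.2 + z) (0, eN i))
    (fun τ z i => fderiv ℝ (fderiv ℝ ζ) (q.1 + τ, q.2 + z) (0, eN i) (0, eN i))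
    (C0 + C1 + C2) B0 B1 B2 B3 B4 B5 B6 B7 (fun τ hτ z => ti_h1 hd q hτ.1 z) (fun τ hτ y i => ti_h2 hd2 q τ y i)
  · have e1 : ∫ p : ℝ × Euc N, hk (p.1 - q.1) (p.2 - q.2) * bh ζ p = ∫ p : ℝ × Euc N, hk p.1 p.2 * bh ζ (p + q) := by
      rw [← integral_add_right_eq_self (fun p : ℝ × Euc N => hk (p.1 - q.1) (p.2 - q.2) * bh ζ p) q]
      simp
    rw [e1, ← setIntegral_eq_integral_of_forall_compl_eq_zero (s := Ioo 0 τ1 ×ˢ univ)]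
    · have e2 : ∫ p in Ioo 0 τ1 ×ˢ (univ : Set (Euc N)), hk p.1 p.2 * bh ζ (p + q) = - ∫ p in Ioo 0 τ1 ×ˢ (univ : Set (Euc N)), hk p.1 p.2 * (fderiv ℝ ζ (q.1 + p.1, q.2 + p.2) (1, 0) + ∑ i, fderiv ℝ (fderiv ℝ ζ) (q.1 + p.1, q.2 + p.2) (0, eN i) (0, eN i)) := by
        rw [← integral_neg]
        congr 1; ext p
        rw [bh_eq hζ, add_comm p q]
        have : q + p = (q.1 + p.1, q.2 + p.2) := rfl
        rw [this]; ring
      rw [e2, key]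
      have e3 : ∀ z, ζ (q.1 + τ1, q.2 + z) = 0 := fun z => image_eq_zero_of_notMem_tsupport (hout τ1 le_rfl _)
      simp [e3]
    · intro p hp
      rcases le_or_gt p.1 0 with h | h
      · simp [hk_of_nonpos h]
      · have : τ1 ≤ p.1 := by
          by_contra h'
          exact hp ⟨⟨h, not_le.1 h'⟩, mem_univ _⟩
        rw [bh_zero hζ, mul_zero]
        have h3 := hout p.1 this (q.2 + p.2)
        rwa [add_comm p q]

end HeatAux

namespace HeatAux

set_option linter.all false
open Set Topology

variable {N : ℕ}

/-- Duhamel operator -/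
def Dh (f : ℝ × Euc N → ℝ) (p : ℝ × Euc N) : ℝ :=
  ∫ q : ℝ × Euc N, hk (p.1 - q.1) (p.2 - q.2) * f q

/-- heat semigroup -/
def He (w : Euc N → ℝ) (p : ℝ × Euc N) : ℝ := ∫ y, hk p.1 (p.2 - y) * w y

lemma hk_meas_sub (p : ℝ × Euc N) :
    Measurable (fun q : ℝ × Euc N => hk (p.1 - q.1) (p.2 - q.2)) :=
  hk_measurable.comp (g := fun p : ℝ × Euc N => hk p.1 p.2)
    (f := fun q : ℝ × Euc N => (p.1 - q.1, p.2 - q.2)) (by fun_prop)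

lemma dh_core [NeZero N] {γ : ℝ} (hγ0 : 0 ≤ γ) (hγ : γ < N) :
    ∃ K : ℝ, 0 < K ∧ ∀ (a : ℝ) (p : ℝ × Euc N), p.2 ≠ 0 → a ≤ p.1 →
      Integrable (fun q : ℝ × Euc N => hk (p.1 - q.1) (p.2 - q.2) * (if a < q.1 then wt γ q.2 else 0)) ∧
      ∫ q : ℝ × Euc N, hk (p.1 - q.1) (p.2 - q.2) * (if a < q.1 then wt γ q.2 else 0)
        ≤ (p.1 - a) * (K * wt γ p.2) := by
  obtain ⟨K, hK, h⟩ := hk_wt (N := N) hγ0 hγ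
  refine ⟨K, hK, fun a p hp hap => ?_⟩
  have hm : Measurable (fun q : ℝ × Euc N => hk (p.1 - q.1) (p.2 - q.2) * (if a < q.1 then wt γ q.2 else 0)) := by
    refine (hk_meas_sub p).mul (Measurable.ite ?_ ((wt_measurable γ).comp measurable_snd) measurable_const)
    exact measurableSet_lt measurable_const measurable_fst
  have hin : ∀ s : ℝ, Integrable (fun y : Euc N => hk (p.1 - s) (p.2 - y) * (if a < s then wt γ y else 0)) := by
    intro s
    split_ifs
    · exact (h (p.1 - s) p.2 hp).1
    · simp
  have hval : ∀ s : ℝ, ∫ y : Euc N, hk (p.1 - s) (p.2 - y) * (if a < s then wt γ y else 0) ≤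
      indicator (Ioo a p.1) (fun _ => K * wt γ p.2) s := by
    intro s
    by_cases h1 : a < s
    · by_cases h2 : s < p.1
      · rw [indicator_of_mem (show s ∈ Ioo a p.1 from ⟨h1, h2⟩)]
        simp only [h1, if_true]
        exact (h (p.1 - s) p.2 hp).2
      · rw [indicator_of_notMem (fun hh => h2 hh.2)]
        simp [hk_of_nonpos (show p.1 - s ≤ 0 by linarith)]
    · rw [indicator_of_notMem (fun hh => h1 hh.1)]
      simp [h1]
  have hnn : ∀ s (y : Euc N), 0 ≤ hk (p.1 - s) (p.2 - y) * (if a < s then wt γ y else 0) := by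
    intro s y
    refine mul_nonneg (hk_nonneg _ _) ?_
    split_ifs
    · exact (wt_pos _ _).le
    · exact le_rfl
  have hind : Integrable (indicator (Ioo a p.1) (fun _ : ℝ => K * wt γ p.2)) :=
    (integrable_indicator_iff measurableSet_Ioo).2 (integrableOn_const measure_Ioo_lt_top.ne)
  have hh_int : Integrable (fun q : ℝ × Euc N => hk (p.1 - q.1) (p.2 - q.2) * (if a < q.1 then wt γ q.2 else 0)) := by
    rw [Measure.volume_eq_prod, integrable_prod_iff hm.aestronglyMeasurable]
    refine ⟨ae_of_all _ hin, ?_⟩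
    refine hind.mono' (hm.norm.stronglyMeasurable.integral_prod_right').aestronglyMeasurable (ae_of_all _ fun s => ?_)
    simp only [Real.norm_eq_abs]
    rw [abs_of_nonneg (integral_nonneg fun y => abs_nonneg _)]
    simp only [abs_of_nonneg (hnn s _)]
    exact hval s
  refine ⟨hh_int, ?_⟩
  rw [Measure.volume_eq_prod] at hh_int ⊢
  rw [integral_prod _ hh_int]
  calc _ ≤ ∫ s, indicator (Ioo a p.1) (fun _ : ℝ => K * wt γ p.2) s :=
        integral_mono hh_int.integral_prod_left hind hval
    _ = _ := by
        rw [integral_indicator measurableSet_Ioo]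
        simp [hap]

lemma dh_bound [NeZero N] {γ : ℝ} (hγ0 : 0 ≤ γ) (hγ : γ < N) :
    ∃ K : ℝ, 0 < K ∧ ∀ (a C : ℝ) (f : ℝ × Euc N → ℝ), Measurable f → (∀ q, |f q| ≤ C * wt γ q.2) →
      (∀ q, q.1 ≤ a → f q = 0) → ∀ (p : ℝ × Euc N), p.2 ≠ 0 → a ≤ p.1 →
      Integrable (fun q : ℝ × Euc N => hk (p.1 - q.1) (p.2 - q.2) * f q) ∧
      |Dh f p| ≤ C * ((p.1 - a) * (K * wt γ p.2)) := by
  obtain ⟨K, hK, h⟩ := dh_core (N := N) hγ0 hγ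
  refine ⟨K, hK, fun a C f hf hfb hf0 p hp hap => ?_⟩
  obtain ⟨h1, h2⟩ := h a p hp hap
  have hb : ∀ q : ℝ × Euc N, ‖hk (p.1 - q.1) (p.2 - q.2) * f q‖ ≤
      C * (hk (p.1 - q.1) (p.2 - q.2) * (if a < q.1 then wt γ q.2 else 0)) := by
    intro q
    rw [norm_mul, Real.norm_eq_abs, Real.norm_eq_abs, abs_of_nonneg (hk_nonneg _ _)]
    by_cases ha : a < q.1
    · simp only [ha, if_true]
      have := mul_le_mul_of_nonneg_left (hfb q) (hk_nonneg (p.1 - q.1) (p.2 - q.2))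
      linarith
    · rw [hf0 q (not_lt.1 ha)]
      simp [ha]
  have hC : 0 ≤ C := by
    have h3 := (abs_nonneg _).trans (hfb p)
    exact le_of_mul_le_mul_right (by simpa using h3) (wt_pos γ p.2)
  refine ⟨(h1.const_mul C).mono' ((hk_meas_sub p).mul hf).aestronglyMeasurable (ae_of_all _ hb), ?_⟩
  calc |Dh f p| ≤ ∫ q : ℝ × Euc N, C * (hk (p.1 - q.1) (p.2 - q.2) * (if a < q.1 then wt γ q.2 else 0)) :=
        norm_integral_le_of_norm_le (h1.const_mul C) (ae_of_all _ hb)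
    _ = C * ∫ q : ℝ × Euc N, (hk (p.1 - q.1) (p.2 - q.2) * (if a < q.1 then wt γ q.2 else 0)) := integral_const_mul _ _
    _ ≤ _ := mul_le_mul_of_nonneg_left h2 hC

lemma hk_dom {ε T : ℝ} (hε : 0 < ε) (hT : 0 < T) : ∃ K : ℝ, 0 < K ∧ ∀ τ (x x0 y : Euc N), ε ≤ τ → τ ≤ T →
    ‖x - x0‖ ≤ 1 → hk τ (x - y) ≤ K * hk (2 * T) (x0 - y) := by
  have h2T : 0 < Real.sqrt (2 * T) := Real.sqrt_pos.2 (by linarith)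
  have hsε : 0 < Real.sqrt ε := Real.sqrt_pos.2 hε
  refine ⟨(Real.sqrt ε ^ N)⁻¹ * Real.exp (1 / (4 * ε)) * Real.sqrt (2 * T) ^ N, by positivity, fun τ x x0 y h1 h2 h3 => ?_⟩
  have hτ : 0 < τ := by linarith
  have hsτ : 0 < Real.sqrt τ := Real.sqrt_pos.2 hτ
  simp only [hk, if_pos hτ, if_pos (show 0 < 2 * T by linarith)]
  have e : (Real.sqrt ε ^ N)⁻¹ * Real.exp (1 / (4 * ε)) * Real.sqrt (2 * T) ^ N *
      ((Real.sqrt (2 * T) ^ N)⁻¹ * G1 ((Real.sqrt (2 * T))⁻¹ • (x0 - y))) =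
      (Real.sqrt ε ^ N)⁻¹ * (Real.exp (1 / (4 * ε)) * G1 ((Real.sqrt (2 * T))⁻¹ • (x0 - y))) := by
    field_simp
  rw [e]
  have hs : Real.sqrt ε ≤ Real.sqrt τ := Real.sqrt_le_sqrt h1
  refine mul_le_mul ?_ ?_ (G1_pos _).le (by positivity)
  · gcongr
  · unfold G1 gE
    have hc : 0 < (∫ z : Euc N, gE z)⁻¹ := inv_pos.2 gE_int_pos
    have hc' : (∫ z : Euc N, Real.exp (-(1/4 : ℝ) * ‖z‖ ^ 2))⁻¹ = (∫ z : Euc N, gE z)⁻¹ := rfl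
    rw [hc']
    rw [mul_left_comm]
    refine mul_le_mul_of_nonneg_left ?_ hc.le
    rw [← Real.exp_add, Real.exp_le_exp]
    rw [norm_smul, norm_smul, mul_pow, mul_pow, norm_inv, norm_inv, inv_pow, inv_pow, Real.norm_eq_abs, Real.norm_eq_abs,
      sq_abs, sq_abs, Real.sq_sqrt hτ.le, Real.sq_sqrt (by linarith)]
    have h4 : ‖x0 - y‖ ≤ ‖x - y‖ + 1 := by
      have : x0 - y = (x - y) - (x - x0) := by abel
      rw [this]
      exact (norm_sub_le _ _).trans (by linarith)
    have h5 : ‖x0 - y‖ ^ 2 ≤ 2 * ‖x - y‖ ^ 2 + 2 := by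
      nlinarith [norm_nonneg (x0 - y), norm_nonneg (x - y), sq_nonneg (‖x - y‖ - 1)]
    have h6 : (2 * T)⁻¹ * ‖x0 - y‖ ^ 2 ≤ τ⁻¹ * ‖x - y‖ ^ 2 + ε⁻¹ := by
      have h7 : (2 * T)⁻¹ ≤ (2 * τ)⁻¹ := by gcongr
      have h8 : τ⁻¹ ≤ ε⁻¹ := by gcongr
      calc (2 * T)⁻¹ * ‖x0 - y‖ ^ 2 ≤ (2 * τ)⁻¹ * (2 * ‖x - y‖ ^ 2 + 2) := by gcongr
        _ = τ⁻¹ * ‖x - y‖ ^ 2 + τ⁻¹ := by rw [mul_inv]; ring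
        _ ≤ _ := by linarith
    have h9 : 1 / (4 * ε) = ε⁻¹ / 4 := by rw [one_div, mul_inv]; ring
    rw [h9]; linarith

lemma hk_sub_cont {p : ℝ × Euc N} {q : ℝ × Euc N} (h : q.1 < p.1) :
    ContinuousAt (fun p : ℝ × Euc N => hk (p.1 - q.1) (p.2 - q.2)) p := by
  have h1 : ContinuousAt (fun p : ℝ × Euc N => (p.1 - q.1, p.2 - q.2)) p := by fun_prop
  exact ContinuousAt.comp (g := fun p : ℝ × Euc N => hk p.1 p.2) (f := fun p : ℝ × Euc N => (p.1 - q.1, p.2 - q.2)) (x := p) (hk_contAt (p := (p.1 - q.1, p.2 - q.2)) (by simpa using h)) h1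

lemma He_cont {w : Euc N → ℝ} (hw : Measurable w) {M : ℝ} (hM : ∀ y, |w y| ≤ M) {p0 : ℝ × Euc N} (hp : 0 < p0.1) :
    ContinuousAt (He w) p0 := by
  obtain ⟨K, hK, hdom⟩ := hk_dom (N := N) (ε := p0.1 / 2) (T := 2 * p0.1) (by linarith) (by linarith)
  have hn : ∀ᶠ p : ℝ × Euc N in 𝓝 p0, p0.1 / 2 ≤ p.1 ∧ p.1 ≤ 2 * p0.1 ∧ ‖p.2 - p0.2‖ ≤ 1 := by
    have h1 : ∀ᶠ p : ℝ × Euc N in 𝓝 p0, p0.1 / 2 < p.1 := continuousAt_fst.eventually_const_lt (by linarith)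
    have h2 : ∀ᶠ p : ℝ × Euc N in 𝓝 p0, p.1 < 2 * p0.1 := continuousAt_fst.eventually_lt_const (by linarith)
    have h3 : ∀ᶠ p : ℝ × Euc N in 𝓝 p0, ‖p.2 - p0.2‖ < 1 := by
      have : ContinuousAt (fun p : ℝ × Euc N => ‖p.2 - p0.2‖) p0 := by fun_prop
      exact this.eventually_lt_const (by simp)
    filter_upwards [h1, h2, h3] with p a b c using ⟨a.le, b.le, c.le⟩
  unfold He
  refine continuousAt_of_dominated (bound := fun y => K * hk (2 * (2 * p0.1)) (p0.2 - y) * M) ?_ ?_ ?_ ?_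
  · refine Eventually.of_forall fun p => ?_
    have : Measurable (fun y : Euc N => hk p.1 (p.2 - y)) :=
      hk_measurable.comp (g := fun p : ℝ × Euc N => hk p.1 p.2) (f := fun y : Euc N => (p.1, p.2 - y)) (by fun_prop)
    exact (this.mul hw).aestronglyMeasurable
  · filter_upwards [hn] with p hp
    refine ae_of_all _ fun y => ?_
    rw [norm_mul, Real.norm_eq_abs, Real.norm_eq_abs, abs_of_nonneg (hk_nonneg _ _)]
    exact mul_le_mul (hdom _ _ _ _ hp.1 hp.2.1 hp.2.2) (hM y) (abs_nonneg _) (mul_nonneg hK.le (hk_nonneg _ _))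
  · exact ((hk_comp_sub_integrable p0.2).const_mul K).mul_const M
  · refine ae_of_all _ fun y => ?_
    have := hk_sub_cont (p := p0) (q := ((0:ℝ), y)) hp
    simp only [sub_zero] at this
    exact this.mul continuousAt_const

lemma dh_trunc_cont [NeZero N] {γ : ℝ} (hγ0 : 0 ≤ γ) (hγ : γ < N) {C : ℝ} {f : ℝ × Euc N → ℝ} (hf : Measurable f)
    (hfb : ∀ q, |f q| ≤ C * wt γ q.2) (hf0 : ∀ q, q.1 ≤ 0 → f q = 0) {p0 : ℝ × Euc N} (hx : p0.2 ≠ 0) {ε : ℝ} (hε : 0 < ε)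
    (hp : ε < p0.1) :
    ContinuousAt (Dh (fun q => if q.1 ≤ p0.1 - ε then f q else 0)) p0 := by
  obtain ⟨K, hK, hdom⟩ := hk_dom (N := N) (ε := ε / 2) (T := p0.1 + ε) (by linarith) (by linarith)
  obtain ⟨K2, hK2, hw⟩ := hk_wt (N := N) hγ0 hγ
  have hC : 0 ≤ C := by
    have h3 := (abs_nonneg _).trans (hfb p0)
    exact le_of_mul_le_mul_right (by simpa using h3) (wt_pos γ p0.2)
  have hn : ∀ᶠ p : ℝ × Euc N in 𝓝 p0, p0.1 - ε / 2 ≤ p.1 ∧ p.1 ≤ p0.1 + ε ∧ ‖p.2 - p0.2‖ ≤ 1 := by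
    have h1 : ∀ᶠ p : ℝ × Euc N in 𝓝 p0, p0.1 - ε / 2 < p.1 := continuousAt_fst.eventually_const_lt (by linarith)
    have h2 : ∀ᶠ p : ℝ × Euc N in 𝓝 p0, p.1 < p0.1 + ε := continuousAt_fst.eventually_lt_const (by linarith)
    have h3 : ∀ᶠ p : ℝ × Euc N in 𝓝 p0, ‖p.2 - p0.2‖ < 1 := by
      have : ContinuousAt (fun p : ℝ × Euc N => ‖p.2 - p0.2‖) p0 := by fun_prop
      exact this.eventually_lt_const (by simp)
    filter_upwards [h1, h2, h3] with p a b c using ⟨a.le, b.le, c.le⟩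
  have hm : Measurable (fun q : ℝ × Euc N => if q.1 ≤ p0.1 - ε then f q else 0) :=
    Measurable.ite (measurableSet_le measurable_fst measurable_const) hf measurable_const
  unfold Dh
  refine continuousAt_of_dominated (bound := fun q : ℝ × Euc N => (indicator (Ioc 0 (p0.1 - ε)) (fun _ => K * C) q.1) * (hk (2 * (p0.1 + ε)) (p0.2 - q.2) * wt γ q.2)) ?_ ?_ ?_ ?_
  · exact Eventually.of_forall fun p => ((hk_meas_sub p).mul hm).aestronglyMeasurable
  · filter_upwards [hn] with p hp
    refine ae_of_all _ fun q => ?_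
    rw [norm_mul, Real.norm_eq_abs, Real.norm_eq_abs, abs_of_nonneg (hk_nonneg _ _)]
    by_cases h1 : q.1 ≤ p0.1 - ε
    · by_cases h2 : q.1 ≤ 0
      · have : q.1 ∉ Ioc 0 (p0.1 - ε) := fun h => absurd h.1 (not_lt.2 h2)
        simp [h1, hf0 q h2, this]
      · rw [indicator_of_mem (show q.1 ∈ Ioc 0 (p0.1 - ε) from ⟨not_le.1 h2, h1⟩)]
        simp only [h1, if_true]
        have h4 := mul_le_mul (hdom (p.1 - q.1) p.2 p0.2 q.2 (by linarith) (by linarith) hp.2.2) (hfb q) (abs_nonneg _) (mul_nonneg hK.le (hk_nonneg _ _))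
        linarith
    · have : q.1 ∉ Ioc 0 (p0.1 - ε) := fun h => h1 h.2
      simp [h1, this]
  · rw [Measure.volume_eq_prod]
    refine Integrable.mul_prod (f := fun s => indicator (Ioc 0 (p0.1 - ε)) (fun _ => K * C) s)
      (g := fun y => hk (2 * (p0.1 + ε)) (p0.2 - y) * wt γ y) ?_ (hw _ _ hx).1
    exact (integrable_indicator_iff measurableSet_Ioc).2 (integrableOn_const measure_Ioc_lt_top.ne)
  · refine ae_of_all _ fun q => ?_
    by_cases h1 : q.1 ≤ p0.1 - ε
    · exact (hk_sub_cont (by linarith)).mul continuousAt_const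
    · simp only [h1, if_false, mul_zero]; exact continuousAt_const

lemma Dh_cont [NeZero N] {γ : ℝ} (hγ0 : 0 ≤ γ) (hγ : γ < N) {C : ℝ} {f : ℝ × Euc N → ℝ} (hf : Measurable f)
    (hfb : ∀ q, |f q| ≤ C * wt γ q.2) (hf0 : ∀ q, q.1 ≤ 0 → f q = 0) {p0 : ℝ × Euc N} (hx : p0.2 ≠ 0)
    (hp : 0 < p0.1) : ContinuousAt (Dh f) p0 := by
  obtain ⟨K, hK, hb⟩ := dh_bound (N := N) hγ0 hγ
  have hC : 0 ≤ C := by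
    have h3 := (abs_nonneg _).trans (hfb p0)
    exact le_of_mul_le_mul_right (by simpa using h3) (wt_pos γ p0.2)
  rw [Metric.continuousAt_iff']
  intro e he
  -- choose ε
  obtain ⟨ε, hε, hε1, hε2⟩ : ∃ ε : ℝ, 0 < ε ∧ ε < p0.1 ∧ C * (2 * ε * (K * (wt γ p0.2 + 1))) < e / 4 := by
    have hw := wt_pos γ p0.2
    have ht : Tendsto (fun ε : ℝ => C * (2 * ε * (K * (wt γ p0.2 + 1)))) (𝓝[>] 0) (𝓝 0) := by
      have : Continuous (fun ε : ℝ => C * (2 * ε * (K * (wt γ p0.2 + 1)))) := by fun_prop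
      have h := this.tendsto 0
      simp only [mul_zero, zero_mul] at h
      exact h.mono_left nhdsWithin_le_nhds
    have h1 := ht.eventually_lt_const (show (0:ℝ) < e / 4 by linarith)
    have h2 : ∀ᶠ ε in 𝓝[>] (0:ℝ), ε ∈ Ioo 0 p0.1 := Ioo_mem_nhdsGT hp
    obtain ⟨ε, h3, h4⟩ := (h1.and h2).exists
    exact ⟨ε, h4.1, h4.2, h3⟩
  set f1 : ℝ × Euc N → ℝ := fun q => if q.1 ≤ p0.1 - ε then f q else 0 with hf1
  set f2 : ℝ × Euc N → ℝ := fun q => if q.1 ≤ p0.1 - ε then 0 else f q with hf2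
  have hm1 : Measurable f1 := Measurable.ite (measurableSet_le measurable_fst measurable_const) hf measurable_const
  have hm2 : Measurable f2 := Measurable.ite (measurableSet_le measurable_fst measurable_const) measurable_const hf
  have hwp : ∀ q : ℝ × Euc N, 0 ≤ C * wt γ q.2 := fun q => mul_nonneg hC (wt_pos _ _).le
  have hb1 : ∀ q, |f1 q| ≤ C * wt γ q.2 := by
    intro q; simp only [hf1]; split_ifs
    · exact hfb q
    · simpa using hwp q
  have hb2 : ∀ q, |f2 q| ≤ C * wt γ q.2 := by
    intro q; simp only [hf2]; split_ifs
    · simpa using hwp q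
    · exact hfb q
  have hz1 : ∀ q : ℝ × Euc N, q.1 ≤ 0 → f1 q = 0 := by
    intro q hq; simp only [hf1]; split_ifs
    · exact hf0 q hq
    · rfl
  have hz2 : ∀ q : ℝ × Euc N, q.1 ≤ p0.1 - ε → f2 q = 0 := by
    intro q hq; simp only [hf2]; rw [if_pos hq]
  have hsum : ∀ p : ℝ × Euc N, p.2 ≠ 0 → p0.1 - ε ≤ p.1 → Dh f p = Dh f1 p + Dh f2 p := by
    intro p hp1 hp2
    unfold Dh
    rw [← integral_add (hb 0 C f1 hm1 hb1 hz1 p hp1 (by linarith)).1 (hb _ C f2 hm2 hb2 hz2 p hp1 hp2).1]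
    congr 1; ext q
    rw [← mul_add]; congr 1
    simp only [hf1, hf2]; split_ifs <;> simp
  have hc1 := dh_trunc_cont hγ0 hγ hf hfb hf0 hx hε hε1
  rw [Metric.continuousAt_iff'] at hc1
  have hc1' := hc1 (e / 4) (by linarith)
  have n1 : ∀ᶠ p : ℝ × Euc N in 𝓝 p0, p.2 ≠ 0 := continuousAt_snd.eventually_ne hx
  have n2 : ∀ᶠ p : ℝ × Euc N in 𝓝 p0, p0.1 - ε < p.1 := continuousAt_fst.eventually_const_lt (by linarith)
  have n3 : ∀ᶠ p : ℝ × Euc N in 𝓝 p0, p.1 < p0.1 + ε := continuousAt_fst.eventually_lt_const (by linarith)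
  have n4 : ∀ᶠ p : ℝ × Euc N in 𝓝 p0, wt γ p.2 < wt γ p0.2 + 1 := by
    have : ContinuousAt (fun p : ℝ × Euc N => wt γ p.2) p0 :=
      ContinuousAt.comp (g := wt γ) (wt_contAt γ hx) continuousAt_snd
    exact this.eventually_lt_const (by linarith)
  have small : ∀ p : ℝ × Euc N, p.2 ≠ 0 → p0.1 - ε ≤ p.1 → p.1 ≤ p0.1 + ε → wt γ p.2 ≤ wt γ p0.2 + 1 → |Dh f2 p| < e / 4 := by
    intro p a1 a2 a3 a4
    refine lt_of_le_of_lt ((hb _ C f2 hm2 hb2 hz2 p a1 a2).2) (lt_of_le_of_lt ?_ hε2)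
    have := wt_pos γ p.2
    refine mul_le_mul_of_nonneg_left ?_ hC
    refine mul_le_mul (by linarith) ?_ (by positivity) (by linarith)
    exact mul_le_mul_of_nonneg_left a4 hK.le
  filter_upwards [hc1', n1, n2, n3, n4] with p g1 g2 g3 g4 g5
  have s1 := small p g2 g3.le g4.le g5.le
  have s2 := small p0 hx (by linarith) (by linarith) (by linarith)
  rw [Real.dist_eq] at g1 ⊢
  rw [hsum p g2 g3.le, hsum p0 hx (by linarith)]
  have := abs_lt.1 s1
  have := abs_lt.1 s2
  have := abs_lt.1 g1
  rw [abs_lt]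
  constructor <;> linarith

end HeatAux

namespace HeatAux

set_option linter.all false
open Set Topology

variable {N : ℕ}

lemma ae_snd_ne [NeZero N] : ∀ᵐ p : ℝ × Euc N, p.2 ≠ 0 := by
  have h : ∀ᵐ x : Euc N, x ≠ 0 := by
    rw [ae_iff]; simp
  rw [Measure.volume_eq_prod]
  exact Measure.quasiMeasurePreserving_snd.ae h

lemma bh_dom {ζ : ℝ × Euc N → ℝ} {T : ℝ} (hζ : ContDiff ℝ (⊤ : ℕ∞) ζ) (hs : HasCompactSupport ζ)
    (ht : tsupport ζ ⊆ Ioo 0 T ×ˢ (univ : Set (Euc N))) :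
    ∃ B R : ℝ, 0 ≤ B ∧ 0 < R ∧ ∀ p, |bh ζ p| ≤ indicator (Ioo 0 T) (fun _ => B) p.1 * indicator (Metric.ball (0 : Euc N) R) (fun _ => 1) p.2
      ∧ |ζ p| ≤ indicator (Ioo 0 T) (fun _ => B) p.1 * indicator (Metric.ball (0 : Euc N) R) (fun _ => 1) p.2 := by
  obtain ⟨B, hB0, hB⟩ := cs_bound (f := bh ζ) hs.isCompact (bh_cont hζ) (fun x hx => by rw [bh_zero hζ hx]; exact norm_zero)
  obtain ⟨B2, hB20, hB2⟩ := cs_bound (f := ζ) hs.isCompact hζ.continuous (fun x hx => by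
    rw [image_eq_zero_of_notMem_tsupport hx]; exact norm_zero)
  obtain ⟨M, hM⟩ := hs.isCompact.isBounded.exists_norm_le
  refine ⟨B + B2, |M| + 1, by positivity, by positivity, fun p => ?_⟩
  have hn1 : 0 ≤ indicator (Ioo 0 T) (fun _ => B + B2) p.1 := indicator_nonneg (fun _ _ => by positivity) _
  have hn2 : 0 ≤ indicator (Metric.ball (0 : Euc N) (|M| + 1)) (fun _ => (1:ℝ)) p.2 := indicator_nonneg (fun _ _ => by positivity) _
  by_cases hp : p ∈ tsupport ζ
  · have h1 : p.1 ∈ Ioo 0 T := (ht hp).1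
    have h2 : p.2 ∈ Metric.ball (0 : Euc N) (|M| + 1) := by
      rw [mem_ball_zero_iff]
      have := (norm_snd_le p).trans (hM p hp)
      have := le_abs_self M
      linarith
    rw [indicator_of_mem h1, indicator_of_mem h2]
    have a1 := hB p
    have a2 := hB2 p
    rw [Real.norm_eq_abs] at a1 a2
    constructor <;> linarith
  · rw [bh_zero hζ hp, image_eq_zero_of_notMem_tsupport hp]
    simp only [abs_zero]
    exact ⟨mul_nonneg hn1 hn2, mul_nonneg hn1 hn2⟩

lemma hk_meas2 : Measurable (fun z : (ℝ × Euc N) × (ℝ × Euc N) => hk (z.1.1 - z.2.1) (z.1.2 - z.2.2)) :=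
  hk_measurable.comp (g := fun p : ℝ × Euc N => hk p.1 p.2)
    (f := fun z : (ℝ × Euc N) × (ℝ × Euc N) => (z.1.1 - z.2.1, z.1.2 - z.2.2)) (by fun_prop)

lemma hk_meas3 : Measurable (fun z : (ℝ × Euc N) × Euc N => hk z.1.1 (z.1.2 - z.2)) :=
  hk_measurable.comp (g := fun p : ℝ × Euc N => hk p.1 p.2)
    (f := fun z : (ℝ × Euc N) × Euc N => (z.1.1, z.1.2 - z.2)) (by fun_prop)

lemma strip_wt_integrable [NeZero N] {γ : ℝ} (hγ : γ < N) (B T R : ℝ) :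
    Integrable (fun p : ℝ × Euc N => indicator (Ioo 0 T) (fun _ => B) p.1 * indicator (Metric.ball (0 : Euc N) R) (wt γ) p.2) := by
  rw [Measure.volume_eq_prod]
  refine Integrable.mul_prod (f := fun s => indicator (Ioo 0 T) (fun _ => B) s)
      (g := fun y => indicator (Metric.ball (0 : Euc N) R) (wt γ) y) ?_ ?_
  · exact (integrable_indicator_iff measurableSet_Ioo).2 (integrableOn_const measure_Ioo_lt_top.ne)
  · exact (integrable_indicator_iff measurableSet_ball).2 (wt_integrableOn_ball hγ R)

set_option maxHeartbeats 400000 in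
lemma Dh_test [NeZero N] {γ : ℝ} (hγ0 : 0 ≤ γ) (hγ : γ < N) {C T : ℝ} {f : ℝ × Euc N → ℝ} (hf : Measurable f)
    (hfb : ∀ q, |f q| ≤ C * wt γ q.2) (hf0 : ∀ q, q.1 ≤ 0 → f q = 0)
    {ζ : ℝ × Euc N → ℝ} (hζ : ContDiff ℝ (⊤ : ℕ∞) ζ) (hs : HasCompactSupport ζ)
    (ht : tsupport ζ ⊆ Ioo 0 T ×ˢ (univ : Set (Euc N))) :
    Integrable (fun p => Dh f p * bh ζ p) ∧ ∫ p, Dh f p * bh ζ p = ∫ p, f p * ζ p := by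
  obtain ⟨K, hK, hb⟩ := dh_bound (N := N) hγ0 hγ
  obtain ⟨B, R, hB, hR, hdom⟩ := bh_dom hζ hs ht
  have hC : 0 ≤ C := by
    have h3 := (abs_nonneg _).trans (hfb 0)
    exact le_of_mul_le_mul_right (by simpa using h3) (wt_pos γ _)
  have hfa : Measurable (fun q => |f q|) := continuous_abs.measurable.comp hf
  have hfab : ∀ q, |(|f q|)| ≤ C * wt γ q.2 := by simpa using hfb
  have hfa0 : ∀ q, q.1 ≤ 0 → |f q| = 0 := by intro q hq; simp [hf0 q hq]
  have hbz : ∀ p : ℝ × Euc N, p.1 ≤ 0 → bh ζ p = 0 := by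
    intro p hp
    have := (hdom p).1
    rw [indicator_of_notMem (fun h => absurd h.1 (not_lt.2 hp)), zero_mul] at this
    exact abs_nonpos_iff.1 this
  have hm : Measurable (fun z : (ℝ × Euc N) × (ℝ × Euc N) => hk (z.1.1 - z.2.1) (z.1.2 - z.2.2) * f z.2 * bh ζ z.1) :=
    (hk_meas2.mul (hf.comp measurable_snd)).mul ((bh_cont hζ).measurable.comp measurable_fst)
  have hh_int : Integrable (fun z : (ℝ × Euc N) × (ℝ × Euc N) => hk (z.1.1 - z.2.1) (z.1.2 - z.2.2) * f z.2 * bh ζ z.1)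
      ((volume : Measure (ℝ × Euc N)).prod (volume : Measure (ℝ × Euc N))) := by
    rw [integrable_prod_iff hm.aestronglyMeasurable]
    constructor
    · filter_upwards [ae_snd_ne] with p hp
      rcases le_or_gt p.1 0 with h | h
      · simp [hbz p h]
      · exact (hb 0 C f hf hfb hf0 p hp h.le).1.mul_const _
    · refine (strip_wt_integrable hγ (C * (T * K) * B) T R).mono' (hm.norm.stronglyMeasurable.integral_prod_right').aestronglyMeasurable ?_
      filter_upwards [ae_snd_ne] with p hp
      have e : ∀ q : ℝ × Euc N, ‖hk (p.1 - q.1) (p.2 - q.2) * f q * bh ζ p‖ = hk (p.1 - q.1) (p.2 - q.2) * |f q| * |bh ζ p| := by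
        intro q
        rw [norm_mul, norm_mul, Real.norm_eq_abs, Real.norm_eq_abs, Real.norm_eq_abs, abs_of_nonneg (hk_nonneg _ _)]
      simp only [e]
      rw [integral_mul_const, Real.norm_eq_abs, abs_mul, abs_abs]
      have hd := (hdom p).1
      by_cases h1 : p.1 ∈ Ioo 0 T
      · by_cases h2 : p.2 ∈ Metric.ball (0 : Euc N) R
        · rw [indicator_of_mem h1, indicator_of_mem h2] at hd ⊢
          have h3 := (hb 0 C _ hfa hfab hfa0 p hp h1.1.le).2
          have hw := wt_pos γ p.2
          have h4 : C * ((p.1 - 0) * (K * wt γ p.2)) ≤ C * (T * (K * wt γ p.2)) := by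
            have := h1.2.le
            gcongr
            linarith
          calc _ ≤ C * (T * (K * wt γ p.2)) * (B * 1) := mul_le_mul (h3.trans h4) hd (abs_nonneg _) (by have := h1.1.trans h1.2; positivity)
            _ = _ := by ring
        · rw [indicator_of_notMem h2, mul_zero] at hd ⊢
          rw [le_antisymm hd (abs_nonneg _)]; simp
      · rw [indicator_of_notMem h1, zero_mul] at hd ⊢
        rw [le_antisymm hd (abs_nonneg _)]; simp
  have eD : ∀ p, Dh f p * bh ζ p = ∫ q : ℝ × Euc N, hk (p.1 - q.1) (p.2 - q.2) * f q * bh ζ p := by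
    intro p; rw [integral_mul_const]; rfl
  constructor
  · have := hh_int.integral_prod_left
    simpa only [eD] using this
  · simp only [eD]
    rw [integral_integral_swap (f := fun p q : ℝ × Euc N => hk (p.1 - q.1) (p.2 - q.2) * f q * bh ζ p) hh_int]
    congr 1; ext q
    rw [← test_identity hζ hs q, ← integral_const_mul]
    congr 1; ext p; ring

lemma He_bound {w : Euc N → ℝ} {M : ℝ} (hM : ∀ y, |w y| ≤ M) (p : ℝ × Euc N) : |He w p| ≤ M := by
  have hM0 : 0 ≤ M := (abs_nonneg _).trans (hM 0)
  have h1 : |He w p| ≤ ∫ y, hk p.1 (p.2 - y) * M := by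
    refine norm_integral_le_of_norm_le (f := fun y => hk p.1 (p.2 - y) * w y) ((hk_comp_sub_integrable p.2).mul_const M) (ae_of_all _ fun y => ?_)
    rw [norm_mul, Real.norm_eq_abs, Real.norm_eq_abs, abs_of_nonneg (hk_nonneg _ _)]
    exact mul_le_mul_of_nonneg_left (hM y) (hk_nonneg _ _)
  rw [integral_mul_const, integral_sub_left_eq_self (fun y => hk p.1 y) volume p.2] at h1
  rcases le_or_gt p.1 0 with h | h
  · simp only [hk_of_nonpos h] at h1
    simp at h1
    have : |He w p| = 0 := by rw [h1]; simp
    linarith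
  · rw [hk_integral h] at h1; linarith

lemma He_test [NeZero N] {M T : ℝ} {w : Euc N → ℝ} (hw : Measurable w)
    (hM : ∀ y, |w y| ≤ M)
    {ζ : ℝ × Euc N → ℝ} (hζ : ContDiff ℝ (⊤ : ℕ∞) ζ) (hs : HasCompactSupport ζ)
    (ht : tsupport ζ ⊆ Ioo 0 T ×ˢ (univ : Set (Euc N))) :
    Integrable (fun p => He w p * bh ζ p) ∧ ∫ p, He w p * bh ζ p = 0 := by
  obtain ⟨B, R, hB, hR, hdom⟩ := bh_dom hζ hs ht
  have hM0 : 0 ≤ M := (abs_nonneg _).trans (hM 0)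
  have hm : Measurable (fun z : (ℝ × Euc N) × Euc N => hk z.1.1 (z.1.2 - z.2) * w z.2 * bh ζ z.1) :=
    (hk_meas3.mul (hw.comp measurable_snd)).mul ((bh_cont hζ).measurable.comp measurable_fst)
  have hin : ∀ p : ℝ × Euc N, Integrable (fun y => hk p.1 (p.2 - y) * w y) := by
    intro p
    exact (hk_comp_sub_integrable p.2).mul_bdd (c := M) hw.aestronglyMeasurable (ae_of_all _ hM)
  have hbi : Integrable (fun p => |bh ζ p|) := ((bh_cont hζ).integrable_of_hasCompactSupport (bh_compact hζ hs)).abs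
  have hh_int : Integrable (fun z : (ℝ × Euc N) × Euc N => hk z.1.1 (z.1.2 - z.2) * w z.2 * bh ζ z.1)
      ((volume : Measure (ℝ × Euc N)).prod (volume : Measure (Euc N))) := by
    rw [integrable_prod_iff hm.aestronglyMeasurable]
    constructor
    · exact ae_of_all _ fun p => (hin p).mul_const (bh ζ p)
    · refine (hbi.const_mul M).mono' (hm.norm.stronglyMeasurable.integral_prod_right').aestronglyMeasurable ?_
      refine ae_of_all _ fun p => ?_
      have e : ∀ y : Euc N, ‖hk p.1 (p.2 - y) * w y * bh ζ p‖ = hk p.1 (p.2 - y) * |w y| * |bh ζ p| := by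
        intro q
        rw [norm_mul, norm_mul, Real.norm_eq_abs, Real.norm_eq_abs, Real.norm_eq_abs, abs_of_nonneg (hk_nonneg _ _)]
      simp only [e]
      rw [integral_mul_const, Real.norm_eq_abs, abs_mul, abs_abs]
      exact mul_le_mul_of_nonneg_right (He_bound (w := fun y => |w y|) (by simpa using hM) p) (abs_nonneg _)
  have eD : ∀ p, He w p * bh ζ p = ∫ y : Euc N, hk p.1 (p.2 - y) * w y * bh ζ p := by
    intro p; rw [integral_mul_const]; rfl
  constructor
  · have := hh_int.integral_prod_left
    simpa only [eD] using this
  · simp only [eD]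
    rw [integral_integral_swap (f := fun (p : ℝ × Euc N) (y : Euc N) => hk p.1 (p.2 - y) * w y * bh ζ p) hh_int]
    rw [← integral_zero (α := Euc N) (G := ℝ) (μ := volume)]
    congr 1; ext y
    have h := test_identity hζ hs ((0:ℝ), y)
    have h0 : ζ ((0:ℝ), y) = 0 := by
      have := (hdom ((0:ℝ), y)).2
      rw [indicator_of_notMem (by simp), zero_mul] at this
      exact abs_nonpos_iff.1 this
    rw [h0] at h
    simp only [sub_zero] at h
    have e2 : ∀ p : ℝ × Euc N, hk p.1 (p.2 - y) * w y * bh ζ p = w y * (hk p.1 (p.2 - y) * bh ζ p) := fun p => by ring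
    simp only [e2]
    rw [integral_const_mul, h, mul_zero]

lemma transl {w : Euc N → ℝ} (hw : Measurable w) {M : ℝ} (hM : ∀ y, |w y| ≤ M) (R : ℝ) :
    Tendsto (fun h : Euc N => ∫ x in Metric.ball (0 : Euc N) R, |w (x - h) - w x|) (𝓝 0) (𝓝 0) := by
  have hM0 : 0 ≤ M := (abs_nonneg _).trans (hM 0)
  set v : Euc N → ℝ := indicator (Metric.ball 0 (R + 1)) w with hv
  have hvi : Integrable v := by
    rw [hv, integrable_indicator_iff measurableSet_ball]
    exact Measure.integrableOn_of_bounded (measure_ball_lt_top.ne) hw.aestronglyMeasurable (ae_of_all _ hM)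
  have hvm : Measurable v := hw.indicator measurableSet_ball
  rw [Metric.tendsto_nhds]
  intro e he
  obtain ⟨g, hgs, hg1, hgc, hgi⟩ := hvi.exists_hasCompactSupport_integral_sub_le (show 0 < e / 4 by linarith)
  obtain ⟨B, hB⟩ := hgs.exists_bound_of_continuous hgc
  have hlim : Tendsto (fun h : Euc N => ∫ x in Metric.ball (0 : Euc N) R, |g (x - h) - g x|) (𝓝 0) (𝓝 0) := by
    have := tendsto_integral_filter_of_dominated_convergence (μ := volume.restrict (Metric.ball (0 : Euc N) R))
      (F := fun (h x : Euc N) => |g (x - h) - g x|) (f := fun x => 0) (l := 𝓝 (0 : Euc N)) (fun _ => 2 * B) ?_ ?_ ?_ ?_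
    · simpa using this
    · refine Eventually.of_forall fun h => ?_
      have : Continuous (fun x => |g (x - h) - g x|) := by fun_prop
      exact this.aestronglyMeasurable
    · refine Eventually.of_forall fun h => ae_of_all _ fun x => ?_
      rw [Real.norm_eq_abs, abs_abs]
      have h1 := hB (x - h)
      have h2 := hB x
      rw [Real.norm_eq_abs] at h1 h2
      calc |g (x - h) - g x| ≤ |g (x - h)| + |g x| := abs_sub _ _
        _ ≤ _ := by linarith
    · exact integrableOn_const measure_ball_lt_top.ne
    · refine ae_of_all _ fun x => ?_
      have : Continuous (fun h => |g (x - h) - g x|) := by fun_prop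
      simpa using this.tendsto 0
  have h1 := (Metric.tendsto_nhds.1 hlim) (e / 4) (by linarith)
  filter_upwards [h1, Metric.ball_mem_nhds (0 : Euc N) one_pos] with h h2 h3
  rw [Real.dist_eq, sub_zero] at h2 ⊢
  rw [mem_ball_zero_iff] at h3
  rw [abs_of_nonneg (integral_nonneg fun x => abs_nonneg _)] at h2 ⊢
  have hvg : Integrable (fun x => |v x - g x|) := (hvi.sub hgi).abs
  have hvg' : Integrable (fun x => |v (x - h) - g (x - h)|) := hvg.comp_sub_right h
  have hgg : IntegrableOn (fun x => |g (x - h) - g x|) (Metric.ball (0 : Euc N) R) :=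
    ((hgi.comp_sub_right h).sub hgi).abs.integrableOn
  have e1 : ∫ x in Metric.ball (0 : Euc N) R, |w (x - h) - w x| ≤
      ∫ x in Metric.ball (0 : Euc N) R, (|v (x - h) - g (x - h)| + |g (x - h) - g x| + |v x - g x|) := by
    refine setIntegral_mono_on ?_ ((hvg'.integrableOn.add hgg).add hvg.integrableOn) measurableSet_ball fun x hx => ?_
    · refine Measure.integrableOn_of_bounded (M := 2 * M) (measure_ball_lt_top.ne) ?_ (ae_of_all _ fun x => ?_)
      · exact (continuous_abs.measurable.comp ((hw.comp (measurable_id.sub_const h)).sub hw)).aestronglyMeasurable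
      · rw [Real.norm_eq_abs, abs_abs]
        have h1 := hM (x - h)
        have h2 := hM x
        calc |w (x - h) - w x| ≤ |w (x - h)| + |w x| := abs_sub _ _
          _ ≤ _ := by linarith
    · rw [mem_ball_zero_iff] at hx
      have m1 : v x = w x := indicator_of_mem (by rw [mem_ball_zero_iff]; linarith) _
      have m2 : v (x - h) = w (x - h) := indicator_of_mem (by
        rw [mem_ball_zero_iff]; exact lt_of_le_of_lt (norm_sub_le _ _) (by linarith)) _
      rw [← m1, ← m2]
      have : v (x - h) - v x = (v (x - h) - g (x - h)) + (g (x - h) - g x) + (-(v x - g x)) := by ring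
      rw [this]
      refine (abs_add_three _ _ _).trans ?_
      rw [abs_neg]
  have hsum : IntegrableOn (fun x => |v (x - h) - g (x - h)| + |g (x - h) - g x|) (Metric.ball (0 : Euc N) R) := hvg'.integrableOn.add hgg
  rw [integral_add hsum hvg.integrableOn, integral_add hvg'.integrableOn hgg] at e1
  have e2 : ∫ x in Metric.ball (0 : Euc N) R, |v x - g x| ≤ e / 4 :=
    (setIntegral_le_integral hvg (ae_of_all _ fun x => abs_nonneg _)).trans hg1
  have e3 : ∫ x in Metric.ball (0 : Euc N) R, |v (x - h) - g (x - h)| ≤ e / 4 := by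
    refine (setIntegral_le_integral hvg' (ae_of_all _ fun x => abs_nonneg _)).trans ?_
    rw [integral_sub_right_eq_self (fun x => |v x - g x|) h]
    exact hg1
  linarith

lemma He_eq {w : Euc N → ℝ} {t : ℝ} (ht : 0 < t) (x : Euc N) :
    He w (t, x) = ∫ z, G1 z * w (x - Real.sqrt t • z) := by
  unfold He
  simp only
  rw [← hk_scale ht (fun z => w (x - z)), ← integral_sub_left_eq_self (fun y => hk t (x - y) * w y) volume x]
  simp

lemma He_tendsto {w : Euc N → ℝ} (hw : Measurable w) {M : ℝ} (hM : ∀ y, |w y| ≤ M) (R : ℝ) :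
    Tendsto (fun t : ℝ => ∫ x in Metric.ball (0 : Euc N) R, |He w (t, x) - w x|) (𝓝[>] 0) (𝓝 0) := by
  have hM0 : 0 ≤ M := (abs_nonneg _).trans (hM 0)
  set V : ℝ := volume.real (Metric.ball (0 : Euc N) R) with hV
  set φ : Euc N → ℝ := fun h => ∫ x in Metric.ball (0 : Euc N) R, |w (x - h) - w x| with hφ
  have hbd : ∀ h x : Euc N, |w (x - h) - w x| ≤ 2 * M := by
    intro h x
    have h1 := hM (x - h)
    have h2 := hM x
    calc |w (x - h) - w x| ≤ |w (x - h)| + |w x| := abs_sub _ _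
      _ ≤ _ := by linarith
  have hφm : Measurable φ := by
    have : Measurable (fun z : Euc N × Euc N => |w (z.2 - z.1) - w z.2|) :=
      continuous_abs.measurable.comp ((hw.comp (measurable_snd.sub measurable_fst)).sub (hw.comp measurable_snd))
    exact (this.stronglyMeasurable.integral_prod_right' (ν := volume.restrict (Metric.ball (0 : Euc N) R))).measurable
  have hφ0 : ∀ h, 0 ≤ φ h := fun h => integral_nonneg fun x => abs_nonneg _
  have hφb : ∀ h, φ h ≤ 2 * M * V := by
    intro h
    have : ‖φ h‖ ≤ 2 * M * V := norm_setIntegral_le_of_norm_le_const measure_ball_lt_top (fun x _ => by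
      rw [Real.norm_eq_abs, abs_abs]; exact hbd h x)
    exact (le_abs_self _).trans this
  have hlim : Tendsto (fun t : ℝ => ∫ z, G1 z * φ (Real.sqrt t • z)) (𝓝[>] 0) (𝓝 0) := by
    have := tendsto_integral_filter_of_dominated_convergence (μ := (volume : Measure (Euc N)))
      (F := fun (t : ℝ) (z : Euc N) => G1 z * φ (Real.sqrt t • z)) (f := fun x => 0) (l := 𝓝[>] (0 : ℝ)) (fun z => G1 z * (2 * M * V)) ?_ ?_ ?_ ?_
    · simpa using this
    · refine Eventually.of_forall fun t => ?_
      exact (G1_cont.measurable.mul (hφm.comp (measurable_const_smul _))).aestronglyMeasurable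
    · refine Eventually.of_forall fun t => ae_of_all _ fun z => ?_
      rw [Real.norm_eq_abs, abs_mul, abs_of_pos (G1_pos z), abs_of_nonneg (hφ0 _)]
      exact mul_le_mul_of_nonneg_left (hφb _) (G1_pos z).le
    · exact G1_integrable.mul_const _
    · refine ae_of_all _ fun z => ?_
      have h1 : Tendsto (fun t : ℝ => Real.sqrt t • z) (𝓝[>] 0) (𝓝 0) := by
        have : Continuous (fun t : ℝ => Real.sqrt t • z) := by fun_prop
        have := this.tendsto 0
        simp at this
        exact this.mono_left nhdsWithin_le_nhds
      have := ((transl hw hM R).comp h1).const_mul (G1 z)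
      simpa using this
  refine squeeze_zero' (Eventually.of_forall fun t => integral_nonneg fun x => abs_nonneg _) ?_ hlim
  filter_upwards [self_mem_nhdsWithin] with t ht
  have hm : Measurable (fun z : Euc N × Euc N => G1 z.2 * |w (z.1 - Real.sqrt t • z.2) - w z.1|) :=
    (G1_cont.measurable.comp measurable_snd).mul (continuous_abs.measurable.comp
      ((hw.comp (measurable_fst.sub (measurable_snd.const_smul (Real.sqrt t)))).sub (hw.comp measurable_fst)))
  have hh_int : Integrable (fun z : Euc N × Euc N => G1 z.2 * |w (z.1 - Real.sqrt t • z.2) - w z.1|)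
      ((volume.restrict (Metric.ball (0 : Euc N) R)).prod volume) := by
    have h1 : Integrable (fun z : Euc N × Euc N => (2 * M) * G1 z.2) ((volume.restrict (Metric.ball (0 : Euc N) R)).prod volume) :=
      Integrable.mul_prod (f := fun _ => 2 * M) (g := G1) (integrableOn_const measure_ball_lt_top.ne) G1_integrable
    refine h1.mono' hm.aestronglyMeasurable (ae_of_all _ fun z => ?_)
    rw [Real.norm_eq_abs, abs_mul, abs_of_pos (G1_pos z.2), abs_abs, mul_comm]
    exact mul_le_mul_of_nonneg_right (hbd _ _) (G1_pos _).le
  have e1 : ∫ z, G1 z * φ (Real.sqrt t • z) = ∫ x in Metric.ball (0 : Euc N) R, ∫ z, G1 z * |w (x - Real.sqrt t • z) - w x| := by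
    rw [integral_integral_swap (f := fun x z => G1 z * |w (x - Real.sqrt t • z) - w x|) hh_int]
    congr 1; ext z
    rw [integral_const_mul]
  rw [e1]
  have hpt : ∀ x, |He w (t, x) - w x| ≤ ∫ z, G1 z * |w (x - Real.sqrt t • z) - w x| := by
    intro x
    have i1 : Integrable (fun z => G1 z * w (x - Real.sqrt t • z)) :=
      G1_integrable.mul_bdd (c := M) (hw.comp (measurable_const.sub (measurable_id.const_smul (Real.sqrt t)))).aestronglyMeasurable (ae_of_all _ fun z => hM _)
    have e2 : He w (t, x) - w x = ∫ z, G1 z * (w (x - Real.sqrt t • z) - w x) := by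
      rw [He_eq ht]
      simp only [mul_sub]
      rw [integral_sub i1 (G1_integrable.mul_const _), integral_mul_const, G1_integral, one_mul]
    rw [e2]
    refine (abs_integral_le_integral_abs).trans (le_of_eq ?_)
    congr 1; ext z
    rw [abs_mul, abs_of_pos (G1_pos z)]
  refine integral_mono_of_nonneg (ae_of_all _ fun x => abs_nonneg _) hh_int.integral_prod_left (ae_of_all _ hpt)

end HeatAux

namespace HeatAux

set_option linter.all false
open Set Topology

variable {N : ℕ}

def mono (Λ A a b c s X : ℝ) : ℝ := Real.exp (Λ * s) * X ^ a * (1 + X) ^ b * (X + A * s) ^ c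
def ell (A a b c s X : ℝ) : ℝ := a / X + b / (1 + X) + c / (X + A * s)
def ell2 (A a b c s X : ℝ) : ℝ := -a / X ^ 2 - b / (1 + X) ^ 2 - c / (X + A * s) ^ 2
def LM (n : ℕ) (Λ A a b c s X r : ℝ) : ℝ :=
  mono Λ A a b c s X * (Λ + c * A / (X + A * s) - 2 * n * ell A a b c s X
    - 4 * r * (ell A a b c s X ^ 2 + ell2 A a b c s X))

lemma mono_deriv {Λ A a b c : ℝ} (hA : 0 ≤ A) {S X : ℝ → ℝ} {S' X' τ : ℝ} (hS : HasDerivAt S S' τ)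
    (hX : HasDerivAt X X' τ) (hs : 0 ≤ S τ) (hx : 0 < X τ) :
    HasDerivAt (fun σ => mono Λ A a b c (S σ) (X σ))
      (mono Λ A a b c (S τ) (X τ) * ((Λ + c * A / (X τ + A * S τ)) * S' + ell A a b c (S τ) (X τ) * X')) τ := by
  have hp : 0 < X τ + A * S τ := by positivity
  have hp1 : 0 < 1 + X τ := by positivity
  have h1 := (hS.const_mul Λ).exp
  have h2 := hX.rpow_const (p := a) (Or.inl hx.ne')
  have h3 := (hX.const_add 1).rpow_const (p := b) (Or.inl hp1.ne')
  have h4 := (hX.add (hS.const_mul A)).rpow_const (p := c) (Or.inl hp.ne')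
  refine (((h1.mul h2).mul h3).mul h4).congr_deriv ?_
  simp only [Pi.add_apply, Pi.mul_apply, mono, ell]
  rw [Real.rpow_sub_one hx.ne', Real.rpow_sub_one hp1.ne', Real.rpow_sub_one hp.ne']
  field_simp
  ring

lemma ell_deriv {A a b c s : ℝ} (hA : 0 ≤ A) {X : ℝ → ℝ} {X' τ : ℝ} 
    (hX : HasDerivAt X X' τ) (hs : 0 ≤ s) (hx : 0 < X τ) :
    HasDerivAt (fun σ => ell A a b c s (X σ)) (ell2 A a b c s (X τ) * X') τ := by
  have hp : 0 < X τ + A * s := by positivity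
  have hp1 : 0 < 1 + X τ := by positivity
  have h2 := (hasDerivAt_const τ a).div hX hx.ne'
  have h3 := (hasDerivAt_const τ b).div (hX.const_add 1) hp1.ne'
  have h4 := (hasDerivAt_const τ c).div (hX.add_const (A * s)) hp.ne'
  refine ((h2.add h3).add h4).congr_deriv ?_
  simp only [Pi.add_apply, ell2]
  field_simp
  ring

lemma mono_contOn {Λ A a b c : ℝ} (hA : 0 ≤ A) {E : Type*} [TopologicalSpace E] {s : Set E} {S X : E → ℝ} (hS : ContinuousOn S s)
    (hX : ContinuousOn X s) (hs : ∀ p ∈ s, 0 ≤ S p) (hx : ∀ p ∈ s, 0 < X p) :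
    ContinuousOn (fun p => mono Λ A a b c (S p) (X p)) s := by
  unfold mono
  refine (((hS.const_mul Λ |>.rexp).mul (hX.rpow_const fun p hp => Or.inl (hx p hp).ne')).mul
    ((continuousOn_const.add hX).rpow_const fun p hp => Or.inl ?_)).mul
    ((hX.add (hS.const_mul A)).rpow_const fun p hp => Or.inl ?_)
  · have := hx p hp; exact (by positivity : (0:ℝ) < 1 + X p).ne'
  · have := hx p hp; have := hs p hp; exact (by positivity : (0:ℝ) < X p + A * S p).ne'

lemma ell_contOn {A a b c : ℝ} (hA : 0 ≤ A) {E : Type*} [TopologicalSpace E] {s : Set E} {S X : E → ℝ} (hS : ContinuousOn S s)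
    (hX : ContinuousOn X s) (hs : ∀ p ∈ s, 0 ≤ S p) (hx : ∀ p ∈ s, 0 < X p) :
    ContinuousOn (fun p => ell A a b c (S p) (X p)) s := by
  unfold ell
  refine ((continuousOn_const.div hX fun p hp => (hx p hp).ne').add
    (continuousOn_const.div (continuousOn_const.add hX) fun p hp => ?_)).add
    (continuousOn_const.div (hX.add (hS.const_mul A)) fun p hp => ?_)
  · have := hx p hp; exact (by positivity : (0:ℝ) < 1 + X p).ne'
  · have := hx p hp; have := hs p hp; positivity

lemma ell2_contOn {A a b c : ℝ} (hA : 0 ≤ A) {E : Type*} [TopologicalSpace E] {s : Set E} {S X : E → ℝ} (hS : ContinuousOn S s)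
    (hX : ContinuousOn X s) (hs : ∀ p ∈ s, 0 ≤ S p) (hx : ∀ p ∈ s, 0 < X p) :
    ContinuousOn (fun p => ell2 A a b c (S p) (X p)) s := by
  unfold ell2
  refine ((continuousOn_const.div (hX.pow 2) fun p hp => (pow_pos (hx p hp) 2).ne').sub
    (continuousOn_const.div ((continuousOn_const.add hX).pow 2) fun p hp => ?_)).sub
    (continuousOn_const.div ((hX.add (hS.const_mul A)).pow 2) fun p hp => ?_)
  · have := hx p hp; exact (by positivity : (0:ℝ) < (1 + X p) ^ 2).ne'
  · have := hx p hp; have := hs p hp; positivity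

lemma tA_contOn {A c : ℝ} (hA : 0 ≤ A) {E : Type*} [TopologicalSpace E] {s : Set E} {S X : E → ℝ} (hS : ContinuousOn S s)
    (hX : ContinuousOn X s) (hs : ∀ p ∈ s, 0 ≤ S p) (hx : ∀ p ∈ s, 0 < X p) :
    ContinuousOn (fun p => c * A / (X p + A * S p)) s := by
  refine (continuousOn_const.div (hX.add (hS.const_mul A)) fun p hp => ?_)
  have := hx p hp; have := hs p hp; positivity

lemma LM_contOn {n : ℕ} {Λ A a b c : ℝ} (hA : 0 ≤ A) {E : Type*} [TopologicalSpace E] {s : Set E} {S X r : E → ℝ} (hS : ContinuousOn S s)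
    (hX : ContinuousOn X s) (hr : ContinuousOn r s) (hs : ∀ p ∈ s, 0 ≤ S p) (hx : ∀ p ∈ s, 0 < X p) :
    ContinuousOn (fun p => LM n Λ A a b c (S p) (X p) (r p)) s := by
  unfold LM
  have e := ell_contOn (a := a) (b := b) (c := c) hA hS hX hs hx
  have e2 := ell2_contOn (a := a) (b := b) (c := c) hA hS hX hs hx
  refine (mono_contOn hA hS hX hs hx).mul ?_
  exact ((continuousOn_const.add (tA_contOn hA hS hX hs hx)).sub (continuousOn_const.mul e)).sub
    ((continuousOn_const.mul hr).mul ((e.pow 2).add e2))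

lemma mono_nonneg {Λ A a b c s X : ℝ} (hA : 0 ≤ A) (hs : 0 ≤ s) (hX : 0 ≤ X) : 0 ≤ mono Λ A a b c s X := by
  unfold mono; positivity

/-- basic bound -/
lemma mono_le {Λ A a b c k s X : ℝ} (hA : 1 ≤ A) (hΛ : 0 ≤ Λ) (hak : -a ≤ k) (hc : 0 ≤ c) (habc : a + b + c = 0)
    (hs0 : 0 ≤ s) (hs : s ≤ 1) (hX : 0 < X) :
    mono Λ A a b c s X ≤ Real.exp Λ * A ^ c * (1 + X⁻¹) ^ k := by
  unfold mono
  have hA0 : 0 < A := by linarith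
  have h1 : Real.exp (Λ * s) ≤ Real.exp Λ := Real.exp_le_exp.2 (by nlinarith)
  have h2 : (X + A * s) ^ c ≤ A ^ c * (1 + X) ^ c := by
    rw [← Real.mul_rpow hA0.le (by positivity)]
    refine Real.rpow_le_rpow (by positivity) ?_ hc
    nlinarith
  have h3 : X ^ a * (1 + X) ^ b * (1 + X) ^ c = (1 + X⁻¹) ^ (-a) := by
    have : 1 + X⁻¹ = (1 + X) / X := by field_simp; ring
    rw [this, Real.div_rpow (by positivity) hX.le, mul_assoc, ← Real.rpow_add (by positivity),
      show b + c = -a by linarith, Real.rpow_neg hX.le, Real.rpow_neg (by positivity)]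
    field_simp
  have h4 : (1 + X⁻¹) ^ (-a) ≤ (1 + X⁻¹) ^ k := Real.rpow_le_rpow_of_exponent_le (by
    have : 0 < X⁻¹ := by positivity
    linarith) hak
  calc Real.exp (Λ * s) * X ^ a * (1 + X) ^ b * (X + A * s) ^ c
      ≤ Real.exp Λ * X ^ a * (1 + X) ^ b * (A ^ c * (1 + X) ^ c) := by gcongr
    _ = Real.exp Λ * A ^ c * (X ^ a * (1 + X) ^ b * (1 + X) ^ c) := by ring
    _ ≤ _ := by rw [h3]; gcongr

lemma ell_abs {A a b c s X : ℝ} (hA : 0 ≤ A) (hs0 : 0 ≤ s) (hX : 0 < X) :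
    |ell A a b c s X| ≤ (|a| + |b| + |c|) * X⁻¹ := by
  unfold ell
  have e1 : |a / X| = |a| * X⁻¹ := by rw [abs_div, abs_of_pos hX]; rfl
  have e2 : |b / (1 + X)| ≤ |b| * X⁻¹ := by
    rw [abs_div, abs_of_pos (by positivity : 0 < 1 + X), div_eq_mul_inv]
    gcongr; linarith
  have e3 : |c / (X + A * s)| ≤ |c| * X⁻¹ := by
    have h : 0 ≤ A * s := by positivity
    rw [abs_div, abs_of_pos (by positivity : 0 < X + A * s), div_eq_mul_inv]
    gcongr; linarith
  have := abs_add_three (a / X) (b / (1 + X)) (c / (X + A * s))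
  linarith

lemma ell2_abs {A a b c s X : ℝ} (hA : 0 ≤ A) (hs0 : 0 ≤ s) (hX : 0 < X) :
    |ell2 A a b c s X| ≤ (|a| + |b| + |c|) * X⁻¹ ^ 2 := by
  unfold ell2
  have e1 : |-a / X ^ 2| = |a| * X⁻¹ ^ 2 := by rw [abs_div, abs_of_pos (by positivity : 0 < X ^ 2), abs_neg, inv_pow]; rfl
  have e2 : |b / (1 + X) ^ 2| ≤ |b| * X⁻¹ ^ 2 := by
    rw [abs_div, abs_of_pos (by positivity : 0 < (1 + X) ^ 2), div_eq_mul_inv, inv_pow]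
    gcongr; linarith
  have e3 : |c / (X + A * s) ^ 2| ≤ |c| * X⁻¹ ^ 2 := by
    have h : 0 ≤ A * s := by positivity
    rw [abs_div, abs_of_pos (by positivity : 0 < (X + A * s) ^ 2), div_eq_mul_inv, inv_pow]
    gcongr; linarith
  have := abs_add_three (-a / X ^ 2) (-(b / (1 + X) ^ 2)) (-(c / (X + A * s) ^ 2))
  rw [abs_neg, abs_neg] at this
  have e : -a / X ^ 2 - b / (1 + X) ^ 2 - c / (X + A * s) ^ 2 = -a / X ^ 2 + -(b / (1 + X) ^ 2) + -(c / (X + A * s) ^ 2) := by ring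
  rw [e]
  linarith

lemma tA_abs {A c s X : ℝ} (hA : 0 ≤ A) (hs0 : 0 ≤ s) (hX : 0 < X) :
    |c * A / (X + A * s)| ≤ |c| * A * X⁻¹ := by
  have h : 0 ≤ A * s := by positivity
  rw [abs_div, abs_of_pos (by positivity : 0 < X + A * s), div_eq_mul_inv, abs_mul, abs_of_nonneg hA]
  gcongr; linarith

lemma LM_le {n : ℕ} {Λ A a b c k : ℝ} (hA : 1 ≤ A) (hΛ : 0 ≤ Λ) (hak : -a ≤ k) (hk : 0 ≤ k) (hc : 0 ≤ c) (habc : a + b + c = 0) :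
    ∃ C : ℝ, 0 < C ∧ ∀ s X r : ℝ, 0 ≤ s → s ≤ 1 → 0 < X → 0 ≤ r → r ≤ X →
      |LM n Λ A a b c s X r| ≤ C * (1 + X⁻¹) ^ (k + 1) := by
  set K := |a| + |b| + |c| with hK
  have hA0 : 0 < A := by linarith
  refine ⟨Real.exp Λ * A ^ c * (1 + Λ + |c| * A + 2 * n * K + 4 * (K ^ 2 + K)), by positivity, fun s X r hs0 hs hX hr hrX => ?_⟩
  have m := mono_le hA hΛ hak hc habc hs0 hs hX
  have e1 := ell_abs (a := a) (b := b) (c := c) hA0.le hs0 hX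
  have e2 := ell2_abs (a := a) (b := b) (c := c) hA0.le hs0 hX
  have e3 := tA_abs (c := c) hA0.le hs0 hX
  rw [← hK] at e1 e2
  have hXi : 0 < X⁻¹ := by positivity
  have hK0 : 0 ≤ K := by positivity
  have b1 : |Λ + c * A / (X + A * s) - 2 * n * ell A a b c s X - 4 * r * (ell A a b c s X ^ 2 + ell2 A a b c s X)| ≤
      (1 + Λ + |c| * A + 2 * n * K + 4 * (K ^ 2 + K)) * (1 + X⁻¹) := by
    have f1 : |2 * n * ell A a b c s X| ≤ 2 * n * K * X⁻¹ := by
      rw [abs_mul, abs_of_nonneg (by positivity : (0:ℝ) ≤ 2 * n)]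
      have := mul_le_mul_of_nonneg_left e1 (by positivity : (0:ℝ) ≤ 2 * n)
      linarith
    have f2 : |4 * r * (ell A a b c s X ^ 2 + ell2 A a b c s X)| ≤ 4 * (K ^ 2 + K) * X⁻¹ := by
      rw [abs_mul, abs_of_nonneg (by positivity : (0:ℝ) ≤ 4 * r)]
      have g1 : |ell A a b c s X ^ 2 + ell2 A a b c s X| ≤ (K * X⁻¹) ^ 2 + K * X⁻¹ ^ 2 := by
        refine (abs_add_le _ _).trans (add_le_add ?_ e2)
        rw [abs_pow]; gcongr
      calc 4 * r * |ell A a b c s X ^ 2 + ell2 A a b c s X| ≤ 4 * X * ((K * X⁻¹) ^ 2 + K * X⁻¹ ^ 2) := by gcongr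
        _ = _ := by field_simp
    have t : |Λ + c * A / (X + A * s) - 2 * n * ell A a b c s X - 4 * r * (ell A a b c s X ^ 2 + ell2 A a b c s X)| ≤
       |Λ| + |c * A / (X + A * s)| + |2 * n * ell A a b c s X| + |4 * r * (ell A a b c s X ^ 2 + ell2 A a b c s X)| := by
      refine (abs_sub _ _).trans ?_
      gcongr
      refine (abs_sub _ _).trans ?_
      gcongr
      exact abs_add_le _ _
    rw [abs_of_nonneg hΛ] at t
    refine t.trans ?_
    have p1 : 0 ≤ Λ * X⁻¹ := by positivity
    have p2 : 0 ≤ |c| * A := by positivity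
    have p3 : 0 ≤ 2 * n * K := by positivity
    have p4 : 0 ≤ 4 * (K ^ 2 + K) := by positivity
    have : (1 + Λ + |c| * A + 2 * n * K + 4 * (K ^ 2 + K)) * (1 + X⁻¹) = (1 + Λ + |c| * A + 2 * n * K + 4 * (K ^ 2 + K))
      + X⁻¹ + Λ * X⁻¹ + |c| * A * X⁻¹ + 2 * n * K * X⁻¹ + 4 * (K ^ 2 + K) * X⁻¹ := by ring
    rw [this]
    linarith
  unfold LM
  rw [abs_mul, abs_of_nonneg (mono_nonneg hA0.le hs0 hX.le), Real.rpow_add (by positivity), Real.rpow_one]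
  calc _ ≤ (Real.exp Λ * A ^ c * (1 + X⁻¹) ^ k) * ((1 + Λ + |c| * A + 2 * n * K + 4 * (K ^ 2 + K)) * (1 + X⁻¹)) :=
        mul_le_mul m b1 (abs_nonneg _) (by positivity)
    _ = _ := by ring

end HeatAux

namespace HeatAux

set_option linter.all false
open Set Topology

variable {N : ℕ}

def Qd (x y : Euc N) : ℝ := ∑ i, (y i - x i) ^ 2

lemma Qd_eq (x y : Euc N) : Qd x y = ‖x - y‖ ^ 2 := by
  rw [EuclideanSpace.norm_sq_eq, Qd]
  refine Finset.sum_congr rfl fun i _ => ?_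
  rw [Real.norm_eq_abs, sq_abs]
  simp only [PiLp.sub_apply]
  ring

lemma Qd_nonneg (x y : Euc N) : 0 ≤ Qd x y := Finset.sum_nonneg fun i _ => sq_nonneg _

lemma Qd_coord (x y : Euc N) (i : Fin N) : (y i - x i) ^ 2 ≤ Qd x y :=
  Finset.single_le_sum (f := fun i => (y i - x i) ^ 2) (fun i _ => sq_nonneg _) (Finset.mem_univ i)

lemma Qd_cont (x : Euc N) : Continuous (Qd x) := by unfold Qd; fun_prop

lemma Qd_curve (x z : Euc N) {τ : ℝ} (hτ : 0 < τ) (ε : ℝ) :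
    HasDerivAt (fun s => Qd x (Real.sqrt s • z) + ε)
      (1 / (2 * Real.sqrt τ) * ∑ i, 2 * ((Real.sqrt τ • z) i - x i) * z i) τ := by
  have h : ∀ i ∈ Finset.univ, HasDerivAt (fun s => ((Real.sqrt s • z) i - x i) ^ 2)
      (1 / (2 * Real.sqrt τ) * (2 * ((Real.sqrt τ • z) i - x i) * z i)) τ := by
    intro i _
    have h1 : HasDerivAt (fun s => (Real.sqrt s • z) i - x i) (1 / (2 * Real.sqrt τ) * z i) τ := by
      simpa using ((Real.hasDerivAt_sqrt hτ.ne').mul_const (z i)).sub_const (x i)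
    refine (h1.pow 2).congr_deriv ?_
    simp only [Nat.cast_ofNat, Nat.add_one_sub_one, pow_one]
    ring
  have := (HasDerivAt.fun_sum h).add_const ε
  rw [← Finset.mul_sum] at this
  exact this

lemma Qd_line (x y : Euc N) (i : Fin N) (ε : ℝ) :
    HasDerivAt (fun u : ℝ => Qd x (y + u • eN i) + ε) (2 * (y i - x i)) 0 := by
  have h : ∀ j ∈ Finset.univ, HasDerivAt (fun u : ℝ => ((y + u • eN i) j - x j) ^ 2)
      (if j = i then 2 * (y j - x j) else 0) 0 := by
    intro j _
    have h1 : HasDerivAt (fun u : ℝ => (y + u • eN i) j - x j) ((eN i : Euc N) j) 0 := by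
      have := (((hasDerivAt_id (0:ℝ)).mul_const ((eN i : Euc N) j)).const_add (y j)).sub_const (x j)
      simpa using this
    refine (h1.pow 2).congr_deriv ?_
    by_cases hj : j = i
    · subst hj; simp [eN]
    · simp [eN, hj]
  have := (HasDerivAt.fun_sum h).add_const ε
  rw [Finset.sum_ite_eq' Finset.univ i] at this
  simp only [Finset.mem_univ, if_true] at this
  exact this

lemma reg_h2 {Λ A a b c ε : ℝ} (hA : 0 ≤ A) (hε : 0 < ε) (x : Euc N) {s : ℝ} (hs : 0 ≤ s) (y : Euc N) (i : Fin N) :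
    HasLineDerivAt ℝ (fun y : Euc N => mono Λ A a b c s (Qd x y + ε) * ell A a b c s (Qd x y + ε) * (2 * (y i - x i)))
      (mono Λ A a b c s (Qd x y + ε) * (2 * ell A a b c s (Qd x y + ε) + 4 * (y i - x i) ^ 2 *
        (ell A a b c s (Qd x y + ε) ^ 2 + ell2 A a b c s (Qd x y + ε)))) y (EuclideanSpace.single i (1:ℝ)) := by
  have hQ := Qd_line x y i ε
  have e0 : y + (0:ℝ) • eN i = y := by simp
  have hx : 0 < Qd x (y + (0:ℝ) • eN i) + ε := by have := Qd_nonneg x (y + (0:ℝ) • eN i); linarith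
  have m := mono_deriv (Λ := Λ) (a := a) (b := b) (c := c) hA (hasDerivAt_const (0:ℝ) s) hQ hs hx
  have l := ell_deriv (a := a) (b := b) (c := c) hA hQ hs hx
  have h1 : HasDerivAt (fun u : ℝ => 2 * ((y + u • eN i) i - x i)) 2 0 := by
    have := ((((hasDerivAt_id (0:ℝ)).mul_const ((eN i : Euc N) i)).const_add (y i)).sub_const (x i)).const_mul 2
    simpa [eN] using this
  refine HasDerivAt.congr_deriv ((m.mul l).mul h1) ?_
  simp only [Pi.mul_apply, e0]
  ring

lemma reg_h1 {Λ A a b c ε t : ℝ} (hA : 0 ≤ A) (hε : 0 < ε) (x : Euc N) {τ : ℝ} (hτ : τ ∈ Ioo 0 t) (z : Euc N) :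
    HasDerivAt (fun s => mono Λ A a b c (t - s) (Qd x (Real.sqrt s • z) + ε))
      (-(mono Λ A a b c (t - τ) (Qd x (Real.sqrt τ • z) + ε) * (Λ + c * A / (Qd x (Real.sqrt τ • z) + ε + A * (t - τ))))
       + (1 / (2 * Real.sqrt τ)) * ∑ i, (mono Λ A a b c (t - τ) (Qd x (Real.sqrt τ • z) + ε) *
         ell A a b c (t - τ) (Qd x (Real.sqrt τ • z) + ε) * (2 * ((Real.sqrt τ • z) i - x i))) * z i) τ := by
  have hx : 0 < Qd x (Real.sqrt τ • z) + ε := by have := Qd_nonneg x (Real.sqrt τ • z); linarith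
  have hS : HasDerivAt (fun s : ℝ => t - s) (-1) τ := by simpa using (hasDerivAt_id τ).const_sub t
  have m := mono_deriv (Λ := Λ) (a := a) (b := b) (c := c) hA hS (Qd_curve x z hτ.1 ε) (by linarith [hτ.2]) hx
  refine m.congr_deriv ?_
  have : ∀ i, (mono Λ A a b c (t - τ) (Qd x (Real.sqrt τ • z) + ε) *
         ell A a b c (t - τ) (Qd x (Real.sqrt τ • z) + ε) * (2 * ((Real.sqrt τ • z) i - x i))) * z i =
      (mono Λ A a b c (t - τ) (Qd x (Real.sqrt τ • z) + ε) *
         ell A a b c (t - τ) (Qd x (Real.sqrt τ • z) + ε)) * (2 * ((Real.sqrt τ • z) i - x i) * z i) := fun i => by ring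
  simp only [this]
  rw [← Finset.mul_sum]
  ring

set_option maxHeartbeats 1000000 in
lemma reg_identity {Λ A a b c k ε t : ℝ} (hA : 1 ≤ A) (hΛ : 0 ≤ Λ) (hak : -a ≤ k) (hk0 : 0 ≤ k) (hc : 0 ≤ c) (habc : a + b + c = 0)
    (hε : 0 < ε) (ht : 0 < t) (ht1 : t ≤ 1) (x : Euc N) :
    ∫ p in Ioo 0 t ×ˢ (univ : Set (Euc N)), hk p.1 p.2 * LM N Λ A a b c (t - p.1) (Qd x p.2 + ε) (Qd x p.2) =
      mono Λ A a b c t (Qd x 0 + ε) - ∫ z : Euc N, hk t z * mono Λ A a b c 0 (Qd x z + ε) := by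
  have hA0 : 0 ≤ A := by linarith
  have hQp : ∀ z, 0 < Qd x z + ε := fun z => by have := Qd_nonneg x z; linarith
  have hQi : ∀ z, (Qd x z + ε)⁻¹ ≤ ε⁻¹ := fun z => by
    have := Qd_nonneg x z
    gcongr; linarith
  obtain ⟨M, hM⟩ : ∃ M, M = Real.exp Λ * A ^ c * (1 + ε⁻¹) ^ k := ⟨_, rfl⟩
  have hM0 : 0 ≤ M := by rw [hM]; positivity
  have mb : ∀ s, 0 ≤ s → s ≤ t → ∀ z, 0 ≤ mono Λ A a b c s (Qd x z + ε) ∧ mono Λ A a b c s (Qd x z + ε) ≤ M := by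
    intro s h0 h1 z
    have hp := hQp z
    refine ⟨mono_nonneg hA0 h0 hp.le, (mono_le hA hΛ hak hc habc h0 (h1.trans ht1) hp).trans ?_⟩
    rw [hM]
    have := hQi z
    gcongr
  obtain ⟨K, hK⟩ : ∃ K, K = |a| + |b| + |c| := ⟨_, rfl⟩
  have hK0 : 0 ≤ K := by rw [hK]; positivity
  have hε' : 0 < ε⁻¹ := by positivity
  have lb : ∀ s, 0 ≤ s → ∀ z, |ell A a b c s (Qd x z + ε)| ≤ K * (Qd x z + ε)⁻¹ := by
    intro s h0 z; rw [hK]; exact ell_abs hA0 h0 (hQp z)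
  have lb2 : ∀ s, 0 ≤ s → ∀ z, |ell2 A a b c s (Qd x z + ε)| ≤ K * (Qd x z + ε)⁻¹ ^ 2 := by
    intro s h0 z; rw [hK]; exact ell2_abs hA0 h0 (hQp z)
  have cS : ∀ s : Set (ℝ × Euc N), ContinuousOn (fun p : ℝ × Euc N => t - p.1) s := fun s => by fun_prop
  have cX : ∀ s : Set (ℝ × Euc N), ContinuousOn (fun p : ℝ × Euc N => Qd x p.2 + ε) s := fun s =>
    (((Qd_cont x).comp continuous_snd).add continuous_const).continuousOn
  have s1 : ∀ p ∈ Ioo 0 t ×ˢ (univ : Set (Euc N)), 0 ≤ t - p.1 := fun p hp => by linarith [hp.1.2]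
  have s2 : ∀ p ∈ Icc 0 t ×ˢ (univ : Set (Euc N)), 0 ≤ t - p.1 := fun p hp => by linarith [hp.1.2]
  obtain ⟨C1, hC1⟩ : ∃ C1, C1 = M * (Λ + |c| * A * ε⁻¹) := ⟨_, rfl⟩
  obtain ⟨C2, hC2⟩ : ∃ C2, C2 = M * K * 2 * (1 + ε⁻¹) := ⟨_, rfl⟩
  obtain ⟨C3, hC3⟩ : ∃ C3, C3 = M * ((2 * K + 4 * (K ^ 2 + K)) * ε⁻¹) := ⟨_, rfl⟩
  have hC10 : 0 ≤ C1 := by rw [hC1]; positivity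
  have hC20 : 0 ≤ C2 := by rw [hC2]; positivity
  have hC30 : 0 ≤ C3 := by rw [hC3]; positivity
  have B4 : ∀ τ ∈ Icc 0 t, ∀ z, |mono Λ A a b c (t - τ) (Qd x z + ε)| ≤ M + C1 + C2 + C3 := by
    intro τ hτ z
    obtain ⟨h1, h2⟩ := mb (t - τ) (by linarith [hτ.2]) (by linarith [hτ.1]) z
    rw [abs_of_nonneg h1]; linarith
  have B5 : ∀ τ ∈ Ioo 0 t, ∀ z, |-(mono Λ A a b c (t - τ) (Qd x z + ε) * (Λ + c * A / (Qd x z + ε + A * (t - τ))))| ≤ M + C1 + C2 + C3 := by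
    intro τ hτ z
    have hs : 0 ≤ t - τ := by linarith [hτ.2]
    obtain ⟨h1, h2⟩ := mb (t - τ) hs (by linarith [hτ.1]) z
    rw [abs_neg, abs_mul, abs_of_nonneg h1]
    have h3 := tA_abs (c := c) hA0 hs (hQp z)
    have h4 := hQi z
    have h5 : |c| * A * (Qd x z + ε)⁻¹ ≤ |c| * A * ε⁻¹ := by gcongr
    have h6 : |Λ + c * A / (Qd x z + ε + A * (t - τ))| ≤ Λ + |c| * A * ε⁻¹ := by
      refine (abs_add_le _ _).trans ?_
      rw [abs_of_nonneg hΛ]; linarith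
    have := mul_le_mul h2 h6 (abs_nonneg _) hM0
    rw [← hC1] at this; linarith
  have B6 : ∀ τ ∈ Ioo 0 t, ∀ z, ∀ i : Fin N, |mono Λ A a b c (t - τ) (Qd x z + ε) * ell A a b c (t - τ) (Qd x z + ε) * (2 * (z i - x i))| ≤ M + C1 + C2 + C3 := by
    intro τ hτ z i
    have hs : 0 ≤ t - τ := by linarith [hτ.2]
    obtain ⟨h1, h2⟩ := mb (t - τ) hs (by linarith [hτ.1]) z
    have h3 := lb (t - τ) hs z
    have hp := hQp z
    have hi := hQi z
    have h4 : |2 * (z i - x i)| ≤ 2 * (1 + Qd x z) := by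
      rw [abs_mul, abs_two]
      have := Qd_coord x z i
      have h := sq_nonneg (|z i - x i| - 1)
      have h' := sq_abs (z i - x i)
      have h'' := abs_nonneg (z i - x i)
      nlinarith
    have h5 : (Qd x z + ε)⁻¹ * (1 + Qd x z) ≤ 1 + ε⁻¹ := by
      have : (Qd x z + ε)⁻¹ * (1 + Qd x z) ≤ (Qd x z + ε)⁻¹ * (1 + (Qd x z + ε)) := by gcongr; linarith
      have e : (Qd x z + ε)⁻¹ * (1 + (Qd x z + ε)) = (Qd x z + ε)⁻¹ + 1 := by field_simp
      linarith
    rw [abs_mul, abs_mul, abs_of_nonneg h1]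
    have h6 : mono Λ A a b c (t - τ) (Qd x z + ε) * |ell A a b c (t - τ) (Qd x z + ε)| * |2 * (z i - x i)| ≤
      M * (K * (Qd x z + ε)⁻¹) * (2 * (1 + Qd x z)) := by gcongr
    have h7 : M * (K * (Qd x z + ε)⁻¹) * (2 * (1 + Qd x z)) = M * K * 2 * ((Qd x z + ε)⁻¹ * (1 + Qd x z)) := by ring
    have h8 : M * K * 2 * ((Qd x z + ε)⁻¹ * (1 + Qd x z)) ≤ C2 := by rw [hC2]; gcongr
    linarith
  have B7 : ∀ τ ∈ Ioo 0 t, ∀ z, ∀ i : Fin N, |mono Λ A a b c (t - τ) (Qd x z + ε) * (2 * ell A a b c (t - τ) (Qd x z + ε) + 4 * (z i - x i) ^ 2 *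
        (ell A a b c (t - τ) (Qd x z + ε) ^ 2 + ell2 A a b c (t - τ) (Qd x z + ε)))| ≤ M + C1 + C2 + C3 := by
    intro τ hτ z i
    have hs : 0 ≤ t - τ := by linarith [hτ.2]
    obtain ⟨h1, h2⟩ := mb (t - τ) hs (by linarith [hτ.1]) z
    have h3 := lb (t - τ) hs z
    have h4 := lb2 (t - τ) hs z
    have hp := hQp z
    have hi := hQi z
    have h5 : (z i - x i) ^ 2 ≤ Qd x z + ε := by have := Qd_coord x z i; linarith
    have h6 : |2 * ell A a b c (t - τ) (Qd x z + ε) + 4 * (z i - x i) ^ 2 *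
        (ell A a b c (t - τ) (Qd x z + ε) ^ 2 + ell2 A a b c (t - τ) (Qd x z + ε))| ≤ (2 * K + 4 * (K ^ 2 + K)) * ε⁻¹ := by
      refine (abs_add_le _ _).trans ?_
      rw [abs_mul, abs_mul, abs_two, abs_of_nonneg (by positivity : 0 ≤ 4 * (z i - x i) ^ 2)]
      have g1 : |ell A a b c (t - τ) (Qd x z + ε) ^ 2 + ell2 A a b c (t - τ) (Qd x z + ε)| ≤ (K * (Qd x z + ε)⁻¹) ^ 2 + K * (Qd x z + ε)⁻¹ ^ 2 := by
        refine (abs_add_le _ _).trans (add_le_add ?_ h4)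
        rw [abs_pow]; gcongr
      have g2 : 2 * |ell A a b c (t - τ) (Qd x z + ε)| + 4 * (z i - x i) ^ 2 * |ell A a b c (t - τ) (Qd x z + ε) ^ 2 + ell2 A a b c (t - τ) (Qd x z + ε)|
        ≤ 2 * (K * (Qd x z + ε)⁻¹) + 4 * (Qd x z + ε) * ((K * (Qd x z + ε)⁻¹) ^ 2 + K * (Qd x z + ε)⁻¹ ^ 2) := by gcongr
      have g3 : 2 * (K * (Qd x z + ε)⁻¹) + 4 * (Qd x z + ε) * ((K * (Qd x z + ε)⁻¹) ^ 2 + K * (Qd x z + ε)⁻¹ ^ 2) =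
        (2 * K + 4 * (K ^ 2 + K)) * (Qd x z + ε)⁻¹ := by field_simp
      have g4 : (2 * K + 4 * (K ^ 2 + K)) * (Qd x z + ε)⁻¹ ≤ (2 * K + 4 * (K ^ 2 + K)) * ε⁻¹ := by gcongr
      linarith
    rw [abs_mul, abs_of_nonneg h1]
    have := mul_le_mul h2 h6 (abs_nonneg _) hM0
    rw [← hC3] at this; linarith
  have hm1 := mono_contOn (Λ := Λ) (a := a) (b := b) (c := c) hA0 (cS _) (cX _) s1 (fun p _ => hQp p.2)
  have hl1 := ell_contOn (a := a) (b := b) (c := c) hA0 (cS _) (cX _) s1 (fun p _ => hQp p.2)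
  have hl2 := ell2_contOn (a := a) (b := b) (c := c) hA0 (cS _) (cX _) s1 (fun p _ => hQp p.2)
  have ht1' := tA_contOn (c := c) hA0 (cS _) (cX _) s1 (fun p _ => hQp p.2)
  have key := heat_identity ht (fun τ z => mono Λ A a b c (t - τ) (Qd x z + ε))
    (fun τ z => -(mono Λ A a b c (t - τ) (Qd x z + ε) * (Λ + c * A / (Qd x z + ε + A * (t - τ)))))
    (fun τ z i => mono Λ A a b c (t - τ) (Qd x z + ε) * ell A a b c (t - τ) (Qd x z + ε) * (2 * (z i - x i)))
    (fun τ z i => mono Λ A a b c (t - τ) (Qd x z + ε) * (2 * ell A a b c (t - τ) (Qd x z + ε) + 4 * (z i - x i) ^ 2 *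
        (ell A a b c (t - τ) (Qd x z + ε) ^ 2 + ell2 A a b c (t - τ) (Qd x z + ε))))
    (M + C1 + C2 + C3)
    (mono_contOn hA0 (cS _) (cX _) s2 (fun p _ => hQp p.2))
    ((hm1.mul (continuousOn_const.add ht1')).neg)
    (fun i => (hm1.mul hl1).mul (by fun_prop))
    (fun i => hm1.mul ((continuousOn_const.mul hl1).add ((by fun_prop : ContinuousOn (fun p : ℝ × Euc N => 4 * (p.2 i - x i) ^ 2) _).mul ((hl1.pow 2).add hl2))))
    B4 B5 B6 B7 (fun τ hτ z => reg_h1 hA0 hε x hτ z) (fun τ hτ y i => reg_h2 hA0 hε x (by linarith [hτ.2]) y i)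
  simp only [sub_self, sub_zero] at key
  rw [← neg_inj, ← integral_neg, neg_sub, ← key]
  congr 1; ext p
  rw [Finset.sum_congr rfl (fun i _ => by rw [mul_add]), Finset.sum_add_distrib, ← Finset.mul_sum]
  have e1 : ∀ i, mono Λ A a b c (t - p.1) (Qd x p.2 + ε) * (4 * (p.2 i - x i) ^ 2 *
        (ell A a b c (t - p.1) (Qd x p.2 + ε) ^ 2 + ell2 A a b c (t - p.1) (Qd x p.2 + ε))) =
    (mono Λ A a b c (t - p.1) (Qd x p.2 + ε) * 4 *
        (ell A a b c (t - p.1) (Qd x p.2 + ε) ^ 2 + ell2 A a b c (t - p.1) (Qd x p.2 + ε))) * (p.2 i - x i) ^ 2 := fun i => by ring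
  simp only [e1]
  have e3 : ∑ i, (mono Λ A a b c (t - p.1) (Qd x p.2 + ε) * 4 *
        (ell A a b c (t - p.1) (Qd x p.2 + ε) ^ 2 + ell2 A a b c (t - p.1) (Qd x p.2 + ε))) * (p.2 i - x i) ^ 2 =
     (mono Λ A a b c (t - p.1) (Qd x p.2 + ε) * 4 *
        (ell A a b c (t - p.1) (Qd x p.2 + ε) ^ 2 + ell2 A a b c (t - p.1) (Qd x p.2 + ε))) * Qd x p.2 := by
    rw [← Finset.mul_sum]; rfl
  rw [e3]
  simp only [Finset.sum_const, Finset.card_univ, Fintype.card_fin, nsmul_eq_mul]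
  unfold LM
  ring

end HeatAux

namespace HeatAux

set_option linter.all false
open Set Topology

variable {N : ℕ}

instance prod_linv : (volume : Measure (ℝ × Euc N)).IsAddLeftInvariant :=
  inferInstanceAs (((volume : Measure ℝ).prod (volume : Measure (Euc N))).IsAddLeftInvariant)

instance prod_haar : (volume : Measure (ℝ × Euc N)).IsAddHaarMeasure :=
  inferInstanceAs (((volume : Measure ℝ).prod (volume : Measure (Euc N))).IsAddHaarMeasure)

instance prod_ninv : (volume : Measure (ℝ × Euc N)).IsNegInvariant := inferInstance

lemma one_add_rpow {u p : ℝ} (hu : 0 ≤ u) (hp : 0 ≤ p) : (1 + u) ^ p ≤ 2 ^ p * (1 + u ^ p) := by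
  have h1 : 1 + u ≤ 2 * max 1 u := by
    have := le_max_left 1 u; have := le_max_right 1 u; linarith
  have h0 : 0 ≤ max 1 u := le_max_of_le_left zero_le_one
  calc (1 + u) ^ p ≤ (2 * max 1 u) ^ p := by gcongr
    _ = 2 ^ p * (max 1 u) ^ p := Real.mul_rpow (by norm_num) h0
    _ ≤ _ := by
      gcongr
      rcases le_total 1 u with h | h
      · rw [max_eq_right h]; linarith
      · rw [max_eq_left h, Real.one_rpow]; have := Real.rpow_nonneg hu p; linarith

lemma sq_inv_rpow {x : Euc N} (k : ℝ) : ((‖x‖ ^ 2)⁻¹) ^ k = ‖x‖ ^ (-(2 * k)) := by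
  rw [Real.inv_rpow (by positivity), ← Real.rpow_natCast, ← Real.rpow_mul (norm_nonneg _), Real.rpow_neg (norm_nonneg _)]
  norm_num

lemma wt_of_X {x : Euc N} {k : ℝ} (hk : 0 ≤ k) : (1 + (‖x‖ ^ 2)⁻¹) ^ k ≤ 2 ^ k * wt (2 * k) x := by
  have := one_add_rpow (u := (‖x‖ ^ 2)⁻¹) (by positivity) hk
  rwa [sq_inv_rpow] at this

lemma mono_zero_le {Λ A a b c X : ℝ} (habc : a + b + c = 0) (hac : 0 ≤ a + c) (hX : 0 ≤ X) :
    |mono Λ A a b c 0 X| ≤ 1 := by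
  unfold mono
  simp only [mul_zero, Real.exp_zero, one_mul, add_zero]
  rcases hX.eq_or_lt with h | h
  · subst h
    simp only [add_zero, Real.one_rpow, mul_one]
    rw [abs_mul]
    have : ∀ z : ℝ, |(0:ℝ) ^ z| ≤ 1 := fun z => by
      by_cases hz : z = 0
      · simp [hz]
      · simp [Real.zero_rpow hz]
    exact mul_le_one₀ (this a) (abs_nonneg _) (this c)
  · have hb : b = -(a + c) := by linarith
    have e : X ^ a * (1 + X) ^ b * X ^ c = (X / (1 + X)) ^ (a + c) := by
      rw [Real.div_rpow h.le (by positivity), hb, Real.rpow_neg (by positivity), Real.rpow_add h]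
      field_simp
    rw [e, abs_of_nonneg (by positivity)]
    refine Real.rpow_le_one (by positivity) ?_ hac
    rw [div_le_one (by positivity)]; linarith

def LF (N : ℕ) (Λ A a b c : ℝ) (q : ℝ × Euc N) : ℝ :=
  if 0 < q.1 ∧ q.1 ≤ 1 ∧ q.2 ≠ 0 then LM N Λ A a b c q.1 (‖q.2‖ ^ 2) (‖q.2‖ ^ 2) else 0

def LFe (N : ℕ) (Λ A a b c ε : ℝ) (q : ℝ × Euc N) : ℝ :=
  if 0 < q.1 ∧ q.1 ≤ 1 ∧ q.2 ≠ 0 then LM N Λ A a b c q.1 (‖q.2‖ ^ 2 + ε) (‖q.2‖ ^ 2) else 0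

lemma LF_eq (Λ A a b c : ℝ) (q : ℝ × Euc N) : LF N Λ A a b c q = LFe N Λ A a b c 0 q := by
  unfold LF LFe; simp

lemma LFe_measurable (Λ A a b c ε : ℝ) : Measurable (LFe N Λ A a b c ε) := by
  unfold LFe
  have hs : MeasurableSet {q : ℝ × Euc N | 0 < q.1 ∧ q.1 ≤ 1 ∧ q.2 ≠ 0} := by
    refine (measurableSet_lt measurable_const measurable_fst).inter ((measurableSet_le measurable_fst measurable_const).inter ?_)
    exact (measurable_snd (measurableSet_singleton (0 : Euc N))).compl
  refine Measurable.ite hs ?_ measurable_const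
  unfold LM mono ell ell2
  fun_prop

lemma LF_measurable (Λ A a b c : ℝ) : Measurable (LF N Λ A a b c) := by
  have : LF N Λ A a b c = LFe N Λ A a b c 0 := funext (LF_eq Λ A a b c)
  rw [this]; exact LFe_measurable _ _ _ _ _ _

lemma LFe_le {Λ A a b c k : ℝ} (hA : 1 ≤ A) (hΛ : 0 ≤ Λ) (hak : -a ≤ k) (hk : 0 ≤ k) (hc : 0 ≤ c) (habc : a + b + c = 0) :
    ∃ C : ℝ, 0 < C ∧ ∀ ε, 0 ≤ ε → ∀ q : ℝ × Euc N, |LFe N Λ A a b c ε q| ≤ C * (if 0 < q.1 then wt (2 * k + 2) q.2 else 0) := by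
  obtain ⟨C, hC, h⟩ := LM_le (n := N) hA hΛ hak hk hc habc
  refine ⟨C * 2 ^ (k + 1), by positivity, fun ε hε q => ?_⟩
  unfold LFe
  split_ifs with h1 h2 h2
  · have hp : 0 < ‖q.2‖ ^ 2 := by have := norm_pos_iff.2 h1.2.2; positivity
    refine (h q.1 (‖q.2‖ ^ 2 + ε) (‖q.2‖ ^ 2) h1.1.le h1.2.1 (by linarith) (by positivity) (by linarith)).trans ?_
    have e : 2 * k + 2 = 2 * (k + 1) := by ring
    rw [mul_assoc, e]
    refine mul_le_mul_of_nonneg_left (le_trans ?_ (wt_of_X (x := q.2) (by linarith))) hC.le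
    gcongr; linarith
  · exact absurd h1.1 h2
  · have := wt_pos (2 * k + 2) q.2
    rw [abs_zero]; positivity
  · simp

lemma LF_le {Λ A a b c k : ℝ} (hA : 1 ≤ A) (hΛ : 0 ≤ Λ) (hak : -a ≤ k) (hk : 0 ≤ k) (hc : 0 ≤ c) (habc : a + b + c = 0) :
    ∃ C : ℝ, 0 < C ∧ ∀ q : ℝ × Euc N, |LF N Λ A a b c q| ≤ C * wt (2 * k + 2) q.2 := by
  obtain ⟨C, hC, h⟩ := LFe_le (N := N) hA hΛ hak hk hc habc
  refine ⟨C, hC, fun q => ?_⟩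
  rw [LF_eq]
  refine (h 0 le_rfl q).trans ?_
  have := wt_pos (2 * k + 2) q.2
  gcongr
  split_ifs <;> linarith

lemma reg_identity' {Λ A a b c k ε t : ℝ} [NeZero N] (hA : 1 ≤ A) (hΛ : 0 ≤ Λ) (hak : -a ≤ k) (hk0 : 0 ≤ k) (hc : 0 ≤ c) (habc : a + b + c = 0)
    (hε : 0 < ε) (ht : 0 < t) (ht1 : t ≤ 1) (x : Euc N) :
    ∫ q : ℝ × Euc N, hk (t - q.1) (x - q.2) * LFe N Λ A a b c ε q =
      mono Λ A a b c t (‖x‖ ^ 2 + ε) - ∫ y : Euc N, hk t (x - y) * mono Λ A a b c 0 (‖y‖ ^ 2 + ε) := by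
  have h := reg_identity hA hΛ hak hk0 hc habc hε ht ht1 x
  rw [Qd_eq, sub_zero] at h
  have e2 : ∫ y : Euc N, hk t (x - y) * mono Λ A a b c 0 (‖y‖ ^ 2 + ε) = ∫ z : Euc N, hk t z * mono Λ A a b c 0 (Qd x z + ε) := by
    rw [← integral_sub_left_eq_self (fun z => hk t z * mono Λ A a b c 0 (Qd x z + ε)) volume x]
    refine integral_congr_ae (ae_of_all _ fun y => ?_)
    simp only [Qd_eq, sub_sub_cancel]
  rw [e2, ← h]
  rw [← integral_indicator (measurableSet_Ioo.prod MeasurableSet.univ)]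
  rw [← integral_sub_left_eq_self (fun p : ℝ × Euc N => (Ioo 0 t ×ˢ (univ : Set (Euc N))).indicator
    (fun p => hk p.1 p.2 * LM N Λ A a b c (t - p.1) (Qd x p.2 + ε) (Qd x p.2)) p) volume (t, x)]
  refine integral_congr_ae ?_
  filter_upwards [ae_snd_ne (N := N)] with q hq
  simp only [indicator, mem_prod, mem_Ioo, mem_univ, and_true, Prod.fst_sub, Prod.snd_sub, sub_pos, Qd_eq, sub_sub_cancel]
  by_cases h1 : q.1 < t
  · by_cases h2 : 0 < q.1
    · rw [if_pos ⟨h1, by linarith⟩]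
      unfold LFe
      rw [if_pos ⟨h2, by linarith, hq⟩]
    · rw [if_neg (fun h => h2 (by linarith [h.2]))]
      unfold LFe
      rw [if_neg (fun h => h2 h.1), mul_zero]
  · rw [if_neg (fun h => h1 h.1), hk_of_nonpos (by linarith), zero_mul]

lemma mono_repr {Λ A a b c k t : ℝ} [NeZero N] (hA : 1 ≤ A) (hΛ : 0 ≤ Λ) (hak : -a ≤ k) (hk0 : 0 ≤ k) (hc : 0 ≤ c) (habc : a + b + c = 0)
    (hac : 0 ≤ a + c) (hkN : 2 * k + 2 < N) (ht : 0 < t) (ht1 : t ≤ 1) {x : Euc N} (hx : x ≠ 0) :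
    mono Λ A a b c t (‖x‖ ^ 2) = He (fun y => mono Λ A a b c 0 (‖y‖ ^ 2)) (t, x) + Dh (LF N Λ A a b c) (t, x) := by
  have hA0 : 0 ≤ A := by linarith
  have hle : 𝓝[>] (0:ℝ) ≤ 𝓝 0 := nhdsWithin_le_nhds
  have hpos : ∀ᶠ ε : ℝ in 𝓝[>] 0, 0 < ε := self_mem_nhdsWithin
  have tadd : ∀ y : Euc N, Tendsto (fun ε : ℝ => ‖y‖ ^ 2 + ε) (𝓝[>] 0) (𝓝 (‖y‖ ^ 2)) := fun y => by
    have : Tendsto (fun ε : ℝ => ‖y‖ ^ 2 + ε) (𝓝 0) (𝓝 (‖y‖ ^ 2 + 0)) := tendsto_const_nhds.add tendsto_id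
    rw [add_zero] at this
    exact this.mono_left hle
  have mc : ∀ s, 0 ≤ s → ∀ y : Euc N, y ≠ 0 → Tendsto (fun ε : ℝ => mono Λ A a b c s (‖y‖ ^ 2 + ε)) (𝓝[>] 0) (𝓝 (mono Λ A a b c s (‖y‖ ^ 2))) := by
    intro s hs y hy
    have hp : 0 < ‖y‖ ^ 2 := by have := norm_pos_iff.2 hy; positivity
    have hc := mono_contOn (Λ := Λ) (a := a) (b := b) (c := c) hA0 (s := Ioi (0:ℝ)) (S := fun _ => s) (X := fun X => X)
      continuousOn_const continuousOn_id (fun _ _ => hs) (fun p hp => hp)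
    exact (hc.continuousAt (Ioi_mem_nhds hp)).tendsto.comp (tadd y)
  have lc : ∀ s, 0 ≤ s → ∀ y : Euc N, y ≠ 0 → Tendsto (fun ε : ℝ => LM N Λ A a b c s (‖y‖ ^ 2 + ε) (‖y‖ ^ 2)) (𝓝[>] 0) (𝓝 (LM N Λ A a b c s (‖y‖ ^ 2) (‖y‖ ^ 2))) := by
    intro s hs y hy
    have hp : 0 < ‖y‖ ^ 2 := by have := norm_pos_iff.2 hy; positivity
    have hc := LM_contOn (n := N) (Λ := Λ) (a := a) (b := b) (c := c) hA0 (s := Ioi (0:ℝ)) (S := fun _ => s) (X := fun X => X) (r := fun _ => ‖y‖ ^ 2)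
      continuousOn_const continuousOn_id continuousOn_const (fun _ _ => hs) (fun p hp => hp)
    exact (hc.continuousAt (Ioi_mem_nhds hp)).tendsto.comp (tadd y)
  obtain ⟨C, hC, hCb⟩ := LFe_le (N := N) hA hΛ hak hk0 hc habc
  obtain ⟨K, hK, hcore⟩ := dh_core (N := N) (γ := 2 * k + 2) (by linarith) hkN
  have T1 : Tendsto (fun ε : ℝ => ∫ q : ℝ × Euc N, hk (t - q.1) (x - q.2) * LFe N Λ A a b c ε q) (𝓝[>] 0) (𝓝 (Dh (LF N Λ A a b c) (t, x))) := by
    unfold Dh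
    refine tendsto_integral_filter_of_dominated_convergence
      (fun q => C * (hk (t - q.1) (x - q.2) * (if 0 < q.1 then wt (2 * k + 2) q.2 else 0))) ?_ ?_ ?_ ?_
    · exact Eventually.of_forall fun ε => ((hk_meas_sub (t, x)).mul (LFe_measurable _ _ _ _ _ _)).aestronglyMeasurable
    · filter_upwards [hpos] with ε hε
      refine ae_of_all _ fun q => ?_
      rw [norm_mul, Real.norm_eq_abs, Real.norm_eq_abs, abs_of_nonneg (hk_nonneg _ _)]
      have := mul_le_mul_of_nonneg_left (hCb ε hε.le q) (hk_nonneg (t - q.1) (x - q.2))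
      linarith
    · exact (hcore 0 (t, x) hx ht.le).1.const_mul C
    · refine ae_of_all _ fun q => ?_
      refine Tendsto.const_mul _ ?_
      unfold LFe LF
      by_cases h : 0 < q.1 ∧ q.1 ≤ 1 ∧ q.2 ≠ 0
      · simp only [if_pos h]; exact lc q.1 h.1.le q.2 h.2.2
      · simp only [if_neg h]; exact tendsto_const_nhds
  have T2 : Tendsto (fun ε : ℝ => ∫ y : Euc N, hk t (x - y) * mono Λ A a b c 0 (‖y‖ ^ 2 + ε)) (𝓝[>] 0)
      (𝓝 (He (fun y => mono Λ A a b c 0 (‖y‖ ^ 2)) (t, x))) := by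
    unfold He
    refine tendsto_integral_filter_of_dominated_convergence (fun y => hk t (x - y)) ?_ ?_ (hk_comp_sub_integrable x) ?_
    · refine Eventually.of_forall fun ε => ?_
      refine (hk_comp_sub_integrable x).aestronglyMeasurable.mul (Measurable.aestronglyMeasurable ?_)
      unfold mono; fun_prop
    · filter_upwards [hpos] with ε hε
      refine ae_of_all _ fun y => ?_
      rw [norm_mul, Real.norm_eq_abs, Real.norm_eq_abs, abs_of_nonneg (hk_nonneg _ _)]
      exact mul_le_of_le_one_right (hk_nonneg _ _) (mono_zero_le habc hac (by positivity))
    · have : ∀ᵐ y : Euc N, y ≠ 0 := by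
        haveI : Nontrivial (Euc N) := by
          refine ⟨⟨x, 0, hx⟩⟩
        simp [ae_iff]
      filter_upwards [this] with y hy
      exact (mc 0 le_rfl y hy).const_mul _
  have T3 := (mc t ht.le x hx).sub T2
  have := tendsto_nhds_unique (T1.congr' ?_) T3
  · linarith
  · filter_upwards [hpos] with ε hε
    exact reg_identity' hA hΛ hak hk0 hc habc hε ht ht1 x

end HeatAux

namespace HeatAux

set_option linter.all false
open Set Topology

variable {N : ℕ}

def Jf (n : ℕ) (Λ A a b c X xp xq iX iP iQ : ℝ) : ℝ :=
  Λ + c * A * iQ - (2 * n * a + 4 * a ^ 2 - 4 * a) * iX - (2 * n * b + 8 * a * b) * iP - 4 * (b ^ 2 - b) * (xp * iP)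
    - (2 * n * c + 8 * a * c) * iQ - 4 * (c ^ 2 - c) * (xq * iQ) - 8 * b * c * (xq * iP)

lemma LM_J (n : ℕ) {Λ A a b c s X : ℝ} (hX : 0 < X) (hQ : 0 < X + A * s) :
    LM n Λ A a b c s X X = mono Λ A a b c s X * Jf n Λ A a b c X (X * (1 + X)⁻¹) (X * (X + A * s)⁻¹) X⁻¹ (1 + X)⁻¹ (X + A * s)⁻¹ := by
  unfold LM Jf ell ell2
  have hP : 0 < 1 + X := by linarith
  congr 1
  generalize X + A * s = Q at *
  field_simp
  ring

lemma mono_ratio {Λ A a b c σ s X : ℝ} (hX : 0 < X) (hQ : 0 < X + A * s) :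
    mono Λ A (a + σ) b (c - σ) s X = mono Λ A a b c s X * (X / (X + A * s)) ^ σ := by
  unfold mono
  rw [Real.div_rpow hX.le hQ.le, Real.rpow_add hX, Real.rpow_sub hQ]
  ring

set_option maxHeartbeats 1000000 in
lemma super1 (n : ℕ) {m k σ A : ℝ} (hσ : 0 < σ) (hσk : σ < k) (hm : k + 1 ≤ m)
    (hA : A = 16 * (1 + n + k) * m) :
    ∃ C : ℝ, 0 ≤ C ∧ ∀ Λ s X : ℝ, 0 ≤ Λ → 0 ≤ s → 0 < X →
      mono Λ A (-k) (-(m - k)) m s X * (Λ - C + (2 * k * (n - 2 - 2 * k) - 2 * (k - σ) * (n - 2 - 2 * (k - σ))) * (X / (X + A * s)) ^ σ * X⁻¹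
          + m * A / 2 * (X + A * s)⁻¹) + 2 * k * (n - 2 - 2 * k) * X⁻¹ * (2 * mono Λ A (-k) (-(m - k)) m s X - mono Λ A (-k + σ) (-(m - k)) (m - σ) s X)
      ≤ 2 * LM n Λ A (-k) (-(m - k)) m s X X - LM n Λ A (-k + σ) (-(m - k)) (m - σ) s X X := by
  have hn : (0:ℝ) ≤ n := Nat.cast_nonneg n
  have hk : 0 < k := by linarith
  have hm0 : 0 < m := by linarith
  have hA0 : 0 < A := by rw [hA]; positivity
  obtain ⟨d, hd⟩ : ∃ d, d = m - k := ⟨_, rfl⟩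
  have hd1 : 1 ≤ d := by linarith
  have hdm : d ≤ m := by linarith
  refine ⟨2 * (8 * k * d + 4 * (d ^ 2 + d)) + (2 * n * d + 8 * m * m), by positivity, fun Λ s X hΛ hs hX => ?_⟩
  rw [← hd]
  have hQ : 0 < X + A * s := by positivity
  have hP : 0 < 1 + X := by positivity
  rw [LM_J n hX hQ, LM_J n hX hQ, mono_ratio hX hQ]
  have hg := mono_nonneg (Λ := Λ) (a := -k) (b := -d) (c := m) hA0.le hs hX.le
  generalize mono Λ A (-k) (-d) m s X = g at *
  have hZ0 : 0 ≤ (X / (X + A * s)) ^ σ := by positivity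
  have hZ1 : (X / (X + A * s)) ^ σ ≤ 1 := by
    refine Real.rpow_le_one (by positivity) ?_ hσ.le
    rw [div_le_one hQ]; nlinarith
  generalize (X / (X + A * s)) ^ σ = z at *
  have p1 : 0 ≤ X * (1 + X)⁻¹ := by positivity
  have p2 : X * (1 + X)⁻¹ ≤ 1 := by rw [← div_eq_mul_inv, div_le_one hP]; linarith
  have q1 : 0 ≤ X * (X + A * s)⁻¹ := by positivity
  have q2 : X * (X + A * s)⁻¹ ≤ 1 := by rw [← div_eq_mul_inv, div_le_one hQ]; nlinarith
  have r1 : 0 < (1 + X)⁻¹ := by positivity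
  have r2 : (1 + X)⁻¹ ≤ 1 := inv_le_one_of_one_le₀ (by linarith)
  have w1 : 0 < (X + A * s)⁻¹ := by positivity
  have v1 : 0 < X⁻¹ := by positivity
  generalize X * (1 + X)⁻¹ = xp at *
  generalize X * (X + A * s)⁻¹ = xq at *
  generalize (1 + X)⁻¹ = iP at *
  generalize (X + A * s)⁻¹ = iQ at *
  generalize X⁻¹ = iX at *
  have L1 : Λ + m * A * iQ + 2 * k * (n - 2 - 2 * k) * iX - (8 * k * d + 4 * (d ^ 2 + d)) - (2 * n * m + 4 * m ^ 2) * iQ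
      ≤ Jf n Λ A (-k) (-d) m X xp xq iX iP iQ := by
    unfold Jf
    have a1 : k * d * iP ≤ k * d := mul_le_of_le_one_right (by positivity) r2
    have a2 : 0 ≤ n * d * iP := by positivity
    have a3 : xp * iP ≤ 1 := mul_le_one₀ p2 r1.le r2
    have a3' : (d ^ 2 + d) * (xp * iP) ≤ d ^ 2 + d := mul_le_of_le_one_right (by positivity) a3
    have a4 : 0 ≤ k * m * iQ := by positivity
    have a5 : xq * iQ ≤ iQ := mul_le_of_le_one_left w1.le q2
    have a6 : m ^ 2 * (xq * iQ) ≤ m ^ 2 * iQ := by gcongr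
    have a7 : 0 ≤ m * (xq * iQ) := by positivity
    have a8 : 0 ≤ d * m * (xq * iP) := by positivity
    linarith
  have L2 : Jf n Λ A (-k + σ) (-d) (m - σ) X xp xq iX iP iQ ≤ Λ + (2 * n * d + 8 * m * m) + (m * A + 8 * k * m) * iQ + 2 * (k - σ) * (n - 2 - 2 * (k - σ)) * iX := by
    unfold Jf
    obtain ⟨e, he⟩ : ∃ e, e = k - σ := ⟨_, rfl⟩
    obtain ⟨c, hc⟩ : ∃ c, c = m - σ := ⟨_, rfl⟩
    have he0 : 0 < e := by linarith
    have hek : e ≤ k := by linarith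
    have hc1 : 1 ≤ c := by linarith
    have hcm : c ≤ m := by linarith
    have e1 : -k + σ = -e := by linarith
    rw [e1, ← he, ← hc]
    have a1 : n * d * iP ≤ n * d := mul_le_of_le_one_right (by positivity) r2
    have a2 : 0 ≤ e * d * iP := by positivity
    have a3 : 0 ≤ (d ^ 2 + d) * (xp * iP) := by positivity
    have a4 : e * c * iQ ≤ k * m * iQ := by gcongr
    have a5 : 0 ≤ n * c * iQ := by positivity
    have a6 : 0 ≤ (c ^ 2 - c) * (xq * iQ) := by
      have : 0 ≤ c ^ 2 - c := by nlinarith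
      positivity
    have a7 : d * c * (xq * iP) ≤ m * m * 1 := by
      gcongr; exact mul_le_one₀ q2 r1.le r2
    have a8 : c * A * iQ ≤ m * A * iQ := by gcongr
    linarith
  have hAm : m * A / 2 + (4 * n * m + 8 * m ^ 2 + 8 * k * m) ≤ m * A := by
    have h1 : 16 * (n + m + k) ≤ A := by
      rw [hA]
      have : 1 ≤ m := by linarith
      have h5 : (n + k) * 1 ≤ (n + k) * m := by gcongr
      have h6 : 16 * (1 + n + k) * m = 16 * m + 16 * ((n + k) * m) := by ring
      rw [h6]; linarith
    have h2 : m * (16 * (n + m + k)) ≤ m * A := by gcongr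
    have h3 : 0 ≤ n * m := by positivity
    linarith
  have S1 := mul_le_mul_of_nonneg_left L1 hg
  have S2 := mul_le_mul_of_nonneg_left L2 (mul_nonneg hg hZ0)
  have hbr : 0 ≤ Λ + (2 * n * d + 8 * m * m) + (m * A + 8 * k * m) * iQ := by positivity
  have S3 : g * z * (Λ + (2 * n * d + 8 * m * m) + (m * A + 8 * k * m) * iQ) ≤ g * (Λ + (2 * n * d + 8 * m * m) + (m * A + 8 * k * m) * iQ) := by
    refine mul_le_mul_of_nonneg_right ?_ hbr
    exact mul_le_of_le_one_right hg hZ1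
  have S4 := mul_le_mul_of_nonneg_left hAm (mul_nonneg hg w1.le)
  linarith

end HeatAux

namespace HeatAux

set_option linter.all false
open Set Topology

variable {N : ℕ}

lemma ineq_i {c C1 a0 σ k : ℝ} (hc : 0 < c) (hC1 : 0 < C1) (ha0 : 1 ≤ a0) (hσ : 0 < σ) (hσ4 : σ ≤ 1 / 4) :
    ∃ m : ℝ, k + 1 ≤ m ∧ 1 ≤ m ∧ ∀ s X : ℝ, 0 ≤ s → 0 < X →
      2 * C1 * (X / (X + s)) ^ (2 * σ) ≤ c / 2 * (X / (X + a0 * m * s)) ^ σ + m * (a0 * m) / 2 * (X / (X + a0 * m * s)) := by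
  obtain ⟨q, hq⟩ : ∃ q, q = c / (4 * C1) := ⟨_, rfl⟩
  have hq0 : 0 < q := by rw [hq]; positivity
  obtain ⟨q', hq'⟩ : ∃ q', q' = q ^ (1 / σ) := ⟨_, rfl⟩
  have hq'0 : 0 < q' := by rw [hq']; positivity
  have hq'σ : q' ^ σ = q := by
    rw [hq', ← Real.rpow_mul hq0.le, one_div_mul_cancel hσ.ne', Real.rpow_one]
  have hev := (tendsto_rpow_atTop (by linarith : 0 < 2 * σ)).eventually_ge_atTop (4 * C1 * (a0 / q') ^ (1 - 2 * σ))
  obtain ⟨m, ⟨hm1, hm2⟩, hm3⟩ := ((hev.and (eventually_ge_atTop (k + 1))).and (eventually_ge_atTop 1)).exists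
  refine ⟨m, hm2, hm3, fun s X hs hX => ?_⟩
  have hm0 : 0 < m := by linarith
  obtain ⟨A, hA⟩ : ∃ A, A = a0 * m := ⟨_, rfl⟩
  have hA1 : 1 ≤ A := by rw [hA]; exact one_le_mul_of_one_le_of_one_le ha0 hm3
  have hA0 : 0 < A := by linarith
  rw [← hA]
  have hY : 0 < X + s := by positivity
  have hQ : 0 < X + A * s := by positivity
  obtain ⟨y, hy⟩ : ∃ y, y = X / (X + s) := ⟨_, rfl⟩
  obtain ⟨z, hz⟩ : ∃ z, z = X / (X + A * s) := ⟨_, rfl⟩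
  have hy0 : 0 < y := by rw [hy]; positivity
  have hz0 : 0 < z := by rw [hz]; positivity
  have hyz : y / A ≤ z := by
    rw [hy, hz, div_div]
    gcongr
    nlinarith
  rw [← hy, ← hz]
  have e2 : y ^ (2 * σ) = y ^ σ * y ^ σ := by rw [two_mul, Real.rpow_add hy0]
  rcases le_or_gt y (q' / A) with h | h
  · have h1 : y ^ σ ≤ q / A ^ σ := by
      rw [← hq'σ, ← Real.div_rpow hq'0.le hA0.le]
      gcongr
    have h2 : y ^ σ / A ^ σ ≤ z ^ σ := by
      rw [← Real.div_rpow hy0.le hA0.le]; gcongr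
    have h3 : 2 * C1 * (y ^ σ * y ^ σ) ≤ 2 * C1 * (q / A ^ σ * y ^ σ) := by gcongr
    have h4 : 2 * C1 * (q / A ^ σ * y ^ σ) = c / 2 * (y ^ σ / A ^ σ) := by rw [hq]; field_simp; ring
    have h5 : c / 2 * (y ^ σ / A ^ σ) ≤ c / 2 * z ^ σ := by gcongr
    rw [e2]
    have : 0 ≤ m * A / 2 * z := by positivity
    linarith
  · have h1 : (q' / A) ^ (1 - 2 * σ) ≤ y ^ (1 - 2 * σ) := Real.rpow_le_rpow (by positivity) h.le (by linarith)
    have h2 : m * (q' / A) ^ (1 - 2 * σ) = m ^ (2 * σ) / (a0 / q') ^ (1 - 2 * σ) := by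
      have e : q' / A = m⁻¹ * (a0 / q')⁻¹ := by rw [hA]; field_simp
      rw [e, Real.mul_rpow (by positivity) (by positivity), Real.inv_rpow (by positivity), Real.inv_rpow (by positivity),
        Real.rpow_sub hm0, Real.rpow_one]
      field_simp
    have h3 : 4 * C1 ≤ m * (q' / A) ^ (1 - 2 * σ) := by
      rw [h2, le_div_iff₀ (by positivity)]; exact hm1
    have h4 : 4 * C1 ≤ m * y ^ (1 - 2 * σ) := h3.trans (by gcongr)
    have h5 : y ^ (1 - 2 * σ) * y ^ (2 * σ) = y := by
      rw [← Real.rpow_add hy0]; simp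
    have h6 : 4 * C1 * y ^ (2 * σ) ≤ m * y := by
      calc 4 * C1 * y ^ (2 * σ) ≤ m * y ^ (1 - 2 * σ) * y ^ (2 * σ) := by gcongr
        _ = m * y := by rw [mul_assoc, h5]
    have h7 : m * y ≤ m * (A * z) := by
      gcongr
      rw [div_le_iff₀ hA0] at hyz; linarith
    have : 0 ≤ c / 2 * z ^ σ := by positivity
    linarith

lemma ineq_ii {c CB A σ : ℝ} (hc : 0 < c) (hCB : 0 < CB) (hA : 1 ≤ A) (hσ : 0 < σ) (hσ4 : σ ≤ 1 / 4) :
    ∃ Λ : ℝ, 0 ≤ Λ ∧ ∀ s X : ℝ, 0 ≤ s → s ≤ 1 → 0 < X →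
      2 * CB * X ^ (2 * σ) ≤ c / 2 * (X / (X + A * s)) ^ σ + Λ * X := by
  obtain ⟨q, hq⟩ : ∃ q, q = c / (4 * CB) := ⟨_, rfl⟩
  have hq0 : 0 < q := by rw [hq]; positivity
  obtain ⟨q', hq'⟩ : ∃ q', q' = q ^ (1 / σ) := ⟨_, rfl⟩
  have hq'0 : 0 < q' := by rw [hq']; positivity
  have hq'σ : q' ^ σ = q := by
    rw [hq', ← Real.rpow_mul hq0.le, one_div_mul_cancel hσ.ne', Real.rpow_one]
  have hA0 : 0 < A := by linarith
  obtain ⟨x0, hx0⟩ : ∃ x0, x0 = min 1 (q' / (1 + A)) := ⟨_, rfl⟩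
  have hx0p : 0 < x0 := by rw [hx0]; positivity
  have hx01 : x0 ≤ 1 := by rw [hx0]; exact min_le_left _ _
  refine ⟨2 * CB / x0, by positivity, fun s X hs hs1 hX => ?_⟩
  have hQ : 0 < X + A * s := by positivity
  rcases le_or_gt X x0 with h | h
  · have hX1 : X ≤ 1 := h.trans hx01
    have hXq : X ≤ q' / (1 + A) := h.trans (by rw [hx0]; exact min_le_right _ _)
    have h1 : X ^ σ ≤ q / (1 + A) ^ σ := by
      rw [← hq'σ, ← Real.div_rpow hq'0.le (by positivity)]
      gcongr
    have h2 : X ^ σ / (1 + A) ^ σ ≤ (X / (X + A * s)) ^ σ := by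
      rw [← Real.div_rpow hX.le (by positivity)]
      have : X + A * s ≤ 1 + A := by nlinarith
      gcongr
    have e2 : X ^ (2 * σ) = X ^ σ * X ^ σ := by rw [two_mul, Real.rpow_add hX]
    have h3 : 2 * CB * (X ^ σ * X ^ σ) ≤ 2 * CB * (q / (1 + A) ^ σ * X ^ σ) := by gcongr
    have h4 : 2 * CB * (q / (1 + A) ^ σ * X ^ σ) = c / 2 * (X ^ σ / (1 + A) ^ σ) := by rw [hq]; field_simp; ring
    have h5 : c / 2 * (X ^ σ / (1 + A) ^ σ) ≤ c / 2 * (X / (X + A * s)) ^ σ := by gcongr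
    rw [e2]
    have : 0 ≤ 2 * CB / x0 * X := by positivity
    linarith
  · have h1 : X ^ (2 * σ) ≤ X / x0 := by
      rcases le_total X 1 with hX1 | hX1
      · have : X ^ (2 * σ) ≤ 1 := Real.rpow_le_one hX.le hX1 (by linarith)
        refine this.trans ?_
        rw [le_div_iff₀ hx0p]; linarith
      · have h2 : X ^ (2 * σ) ≤ X ^ (1:ℝ) := Real.rpow_le_rpow_of_exponent_le hX1 (by linarith)
        rw [Real.rpow_one] at h2
        refine h2.trans ?_
        rw [le_div_iff₀ hx0p]; nlinarith
    have h2 : 2 * CB * X ^ (2 * σ) ≤ 2 * CB * (X / x0) := by gcongr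
    have h3 : 2 * CB * (X / x0) = 2 * CB / x0 * X := by ring
    have : 0 ≤ c / 2 * (X / (X + A * s)) ^ σ := by positivity
    linarith

lemma lip_rpow {b w1 α : ℝ} (hb : 0 < b) (hw : 0 < w1) (hα : 0 < α) :
    ∃ L : ℝ, 0 < L ∧ ∀ W, 0 ≤ W → W ≤ w1 → (b + W) ^ α ≤ b ^ α + L * W := by
  refine ⟨α * (b ^ (α - 1) + (b + w1) ^ (α - 1)), by positivity, fun W h0 h1 => ?_⟩
  have hd : ∀ x ∈ Icc b (b + W), HasDerivWithinAt (fun x : ℝ => x ^ α) (α * x ^ (α - 1)) (Icc b (b + W)) x := by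
    intro x hx
    exact (Real.hasDerivAt_rpow_const (Or.inl (lt_of_lt_of_le hb hx.1).ne')).hasDerivWithinAt
  have hbd : ∀ x ∈ Icc b (b + W), ‖α * x ^ (α - 1)‖ ≤ α * (b ^ (α - 1) + (b + w1) ^ (α - 1)) := by
    intro x hx
    have hx0 : 0 < x := by linarith [hx.1]
    rw [Real.norm_of_nonneg (by positivity)]
    have p1 : 0 ≤ b ^ (α - 1) := by positivity
    have p2 : 0 ≤ (b + w1) ^ (α - 1) := by positivity
    gcongr
    rcases le_total 1 α with h | h
    · have : x ^ (α - 1) ≤ (b + w1) ^ (α - 1) := by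
        refine Real.rpow_le_rpow hx0.le (by linarith [hx.2]) (by linarith)
      linarith
    · have : x ^ (α - 1) ≤ b ^ (α - 1) := Real.rpow_le_rpow_of_nonpos hb hx.1 (by linarith)
      linarith
  have := Convex.norm_image_sub_le_of_norm_hasDerivWithin_le hd hbd (convex_Icc _ _) (left_mem_Icc.2 (by linarith)) (right_mem_Icc.2 (by linarith))
  rw [add_sub_cancel_left, Real.norm_of_nonneg h0] at this
  have := (le_abs_self _).trans this
  linarith

lemma Vbound {α b C₀ η σ ρ : ℝ} (hα : 0 < α) (hb : 0 < b) (hC₀ : 0 ≤ C₀) (hσ : 0 < σ) (hη : 0 < η) (hρ : 4 * σ ≤ ρ) (hση : 4 * σ ≤ 2 / α - η) :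
    ∃ C1 : ℝ, 0 < C1 ∧ ∀ B, 0 ≤ B → ∃ CB : ℝ, 0 < CB ∧ ∀ t r U ψ : ℝ, 0 < t → 0 < r → 0 ≤ ψ →
      |r ^ (2 / α) * U - b| ≤ C₀ * ((r / (r + Real.sqrt t)) ^ ρ + r ^ (2 / α)) → ψ ≤ B * (1 + r ^ (-η)) →
      (α + 1) * (|U| + ψ) ^ α ≤ (α + 1) * b ^ α * (r ^ 2)⁻¹ + C1 * ((r ^ 2)⁻¹ * (r ^ 2 / (r ^ 2 + t)) ^ (2 * σ))
        + CB * ((r ^ 2)⁻¹ * (r ^ 2) ^ (2 * σ) + 1) := by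
  obtain ⟨L, hL, hlip⟩ := lip_rpow hb (by linarith : 0 < C₀ + 1) hα
  refine ⟨(α + 1) * L * (C₀ + 1), by positivity, fun B hB => ?_⟩
  obtain ⟨r1, hr1⟩ : ∃ r1, r1 = min 1 ((C₀ + 2 * B + 1)⁻¹ ^ (1 / (4 * σ))) := ⟨_, rfl⟩
  have hr1p : 0 < r1 := by rw [hr1]; positivity
  have h2α : 0 < 2 / α := by positivity
  refine ⟨(α + 1) * L * (C₀ + 2 * B) + (α + 1) * ((b + C₀) * r1 ^ (-(2 / α)) + C₀ + B * (1 + r1 ^ (-η))) ^ α, by positivity, fun t r U ψ ht hr hψ hU hψB => ?_⟩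
  have hst : 0 < Real.sqrt t := Real.sqrt_pos.2 ht
  have hre : 0 < r ^ (2 / α) := by positivity
  have hy1 : 0 < r / (r + Real.sqrt t) := by positivity
  have hy1' : r / (r + Real.sqrt t) ≤ 1 := by rw [div_le_one (by positivity)]; linarith
  have hUa : r ^ (2 / α) * |U| ≤ b + C₀ * ((r / (r + Real.sqrt t)) ^ ρ + r ^ (2 / α)) := by
    have : r ^ (2 / α) * |U| = |r ^ (2 / α) * U| := by rw [abs_mul, abs_of_pos hre]
    rw [this]
    have h1 : |r ^ (2 / α) * U| ≤ |r ^ (2 / α) * U - b| + |b| := by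
      have := abs_add_le (r ^ (2 / α) * U - b) b
      rwa [sub_add_cancel] at this
    rw [abs_of_pos hb] at h1
    linarith
  have pX : 0 ≤ (r ^ 2)⁻¹ * (r ^ 2) ^ (2 * σ) := by positivity
  have pY : 0 ≤ (r ^ 2)⁻¹ * (r ^ 2 / (r ^ 2 + t)) ^ (2 * σ) := by positivity
  obtain ⟨CC, hCC⟩ : ∃ CC, CC = (α + 1) * ((b + C₀) * r1 ^ (-(2 / α)) + C₀ + B * (1 + r1 ^ (-η))) ^ α := ⟨_, rfl⟩
  have hCC0 : 0 ≤ CC := by rw [hCC]; positivity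
  rw [← hCC]
  rcases le_or_gt r1 r with h | h
  · have h1 : |U| ≤ (b + C₀) * r1 ^ (-(2 / α)) + C₀ := by
      have e1 : (r / (r + Real.sqrt t)) ^ ρ ≤ 1 := Real.rpow_le_one hy1.le hy1' (by linarith)
      have e2 : r ^ (2 / α) * |U| ≤ b + C₀ + C₀ * r ^ (2 / α) := by
        have : C₀ * ((r / (r + Real.sqrt t)) ^ ρ + r ^ (2 / α)) ≤ C₀ * (1 + r ^ (2 / α)) := by gcongr
        linarith
      have e3 : |U| ≤ (b + C₀) * r ^ (-(2 / α)) + C₀ := by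
        rw [Real.rpow_neg hr.le]
        have : |U| = (r ^ (2 / α))⁻¹ * (r ^ (2 / α) * |U|) := by field_simp
        rw [this]
        calc (r ^ (2 / α))⁻¹ * (r ^ (2 / α) * |U|) ≤ (r ^ (2 / α))⁻¹ * (b + C₀ + C₀ * r ^ (2 / α)) := by gcongr
          _ = _ := by field_simp
      have e4 : r ^ (-(2 / α)) ≤ r1 ^ (-(2 / α)) := Real.rpow_le_rpow_of_nonpos hr1p h (by linarith)
      have : (b + C₀) * r ^ (-(2 / α)) ≤ (b + C₀) * r1 ^ (-(2 / α)) := by gcongr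
      linarith
    have h2 : ψ ≤ B * (1 + r1 ^ (-η)) := by
      have e4 : r ^ (-η) ≤ r1 ^ (-η) := Real.rpow_le_rpow_of_nonpos hr1p h (by linarith)
      refine hψB.trans ?_
      gcongr
    have h3 : (α + 1) * (|U| + ψ) ^ α ≤ CC := by
      rw [hCC]
      have : 0 ≤ |U| := abs_nonneg _
      gcongr
    have p1 : 0 ≤ (α + 1) * b ^ α * (r ^ 2)⁻¹ := by positivity
    have p2 : 0 ≤ (α + 1) * L * (C₀ + 1) * ((r ^ 2)⁻¹ * (r ^ 2 / (r ^ 2 + t)) ^ (2 * σ)) := by positivity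
    have p3 : 0 ≤ (α + 1) * L * (C₀ + 2 * B) * ((r ^ 2)⁻¹ * (r ^ 2) ^ (2 * σ) + 1) := by positivity
    have p4 : 0 ≤ CC * ((r ^ 2)⁻¹ * (r ^ 2) ^ (2 * σ)) := by positivity
    rw [add_mul]
    linarith
  · have hr1' : r ≤ 1 := h.le.trans (by rw [hr1]; exact min_le_left _ _)
    have eX : (r ^ 2) ^ (2 * σ) = r ^ (4 * σ) := by
      rw [← Real.rpow_natCast, ← Real.rpow_mul hr.le]; norm_num; ring_nf
    obtain ⟨x, hx⟩ : ∃ x, x = r ^ (4 * σ) := ⟨_, rfl⟩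
    have hx0 : 0 < x := by rw [hx]; positivity
    have hxs : (C₀ + 2 * B) * x ≤ 1 := by
      have e1 : r ≤ (C₀ + 2 * B + 1)⁻¹ ^ (1 / (4 * σ)) := h.le.trans (by rw [hr1]; exact min_le_right _ _)
      have e2 : x ≤ (C₀ + 2 * B + 1)⁻¹ := by
        rw [hx]
        calc r ^ (4 * σ) ≤ ((C₀ + 2 * B + 1)⁻¹ ^ (1 / (4 * σ))) ^ (4 * σ) := by gcongr
          _ = _ := by rw [← Real.rpow_mul (by positivity), one_div_mul_cancel (by positivity), Real.rpow_one]
      calc (C₀ + 2 * B) * x ≤ (C₀ + 2 * B + 1) * (C₀ + 2 * B + 1)⁻¹ := mul_le_mul (by linarith) e2 hx0.le (by positivity)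
        _ = 1 := mul_inv_cancel₀ (by positivity)
    obtain ⟨Y, hY⟩ : ∃ Y, Y = (r ^ 2 / (r ^ 2 + t)) ^ (2 * σ) := ⟨_, rfl⟩
    have hY0 : 0 ≤ Y := by rw [hY]; positivity
    have hyy : (r / (r + Real.sqrt t)) ^ ρ ≤ Y := by
      calc (r / (r + Real.sqrt t)) ^ ρ ≤ (r / (r + Real.sqrt t)) ^ (4 * σ) := Real.rpow_le_rpow_of_exponent_ge hy1 hy1' hρ
        _ = ((r / (r + Real.sqrt t)) ^ 2) ^ (2 * σ) := by
          rw [← Real.rpow_natCast, ← Real.rpow_mul hy1.le]; norm_num; ring_nf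
        _ ≤ Y := by
          rw [hY, div_pow]
          have e : r ^ 2 + t ≤ (r + Real.sqrt t) ^ 2 := by
            have := Real.sq_sqrt ht.le
            nlinarith [mul_pos hr hst]
          gcongr
    have hY1 : Y ≤ 1 := by
      rw [hY]
      refine Real.rpow_le_one (by positivity) ?_ (by linarith)
      rw [div_le_one (by positivity)]; linarith
    have hra : r ^ (2 / α) ≤ x := by
      rw [hx]; exact Real.rpow_le_rpow_of_exponent_ge hr hr1' (by linarith)
    have hrb : r ^ (2 / α) * r ^ (-η) ≤ x := by
      rw [hx, ← Real.rpow_add hr]; exact Real.rpow_le_rpow_of_exponent_ge hr hr1' (by linarith)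
    have hG : r ^ (2 / α) * (|U| + ψ) ≤ b + (C₀ * Y + (C₀ + 2 * B) * x) := by
      have e1 : r ^ (2 / α) * ψ ≤ B * (r ^ (2 / α) + r ^ (2 / α) * r ^ (-η)) := by
        calc r ^ (2 / α) * ψ ≤ r ^ (2 / α) * (B * (1 + r ^ (-η))) := by gcongr
          _ = _ := by ring
      have e2 : B * (r ^ (2 / α) + r ^ (2 / α) * r ^ (-η)) ≤ B * (x + x) := by gcongr
      have e3 : C₀ * ((r / (r + Real.sqrt t)) ^ ρ + r ^ (2 / α)) ≤ C₀ * (Y + x) := by gcongr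
      rw [mul_add]
      linarith
    have e0 : (r ^ (2 / α)) ^ α = r ^ 2 := by
      rw [← Real.rpow_mul hr.le, div_mul_cancel₀ _ hα.ne']; norm_num
    have hG2 : (|U| + ψ) ^ α = (r ^ 2)⁻¹ * (r ^ (2 / α) * (|U| + ψ)) ^ α := by
      rw [Real.mul_rpow hre.le (by positivity), e0]; field_simp
    have hW : (b + (C₀ * Y + (C₀ + 2 * B) * x)) ^ α ≤ b ^ α + L * (C₀ * Y + (C₀ + 2 * B) * x) := by
      refine hlip _ (by positivity) ?_
      have : C₀ * Y ≤ C₀ := mul_le_of_le_one_right hC₀ hY1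
      linarith
    have hG3 : (r ^ (2 / α) * (|U| + ψ)) ^ α ≤ b ^ α + L * (C₀ * Y + (C₀ + 2 * B) * x) := by
      refine le_trans ?_ hW
      have : 0 ≤ |U| := abs_nonneg _
      gcongr
    rw [hG2, ← hY, eX, ← hx]
    have i0 : 0 < (r ^ 2)⁻¹ := by positivity
    generalize (r ^ 2)⁻¹ = i at *
    have f1 : (α + 1) * (i * (r ^ (2 / α) * (|U| + ψ)) ^ α) ≤ (α + 1) * (i * (b ^ α + L * (C₀ * Y + (C₀ + 2 * B) * x))) := by gcongr
    refine f1.trans ?_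
    have g1 : 0 ≤ (α + 1) * L * (i * Y) := by positivity
    have g2 : 0 ≤ (α + 1) * L * (C₀ + 2 * B) := by positivity
    have g3 : 0 ≤ CC * (i * x + 1) := by positivity
    linarith

end HeatAux

namespace HeatAux

set_option linter.all false
open Set Topology

variable {N : ℕ}

lemma mono_exp (Λ A a b c s X : ℝ) : mono Λ A a b c s X = Real.exp (Λ * s) * mono 0 A a b c s X := by
  unfold mono; simp only [zero_mul, Real.exp_zero, one_mul]; ring

lemma He_lin {f1 f2 : Euc N → ℝ} (h1 : Measurable f1) (h2 : Measurable f2) {M1 M2 : ℝ} (b1 : ∀ y, |f1 y| ≤ M1) (b2 : ∀ y, |f2 y| ≤ M2)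
    (D : ℝ) (p : ℝ × Euc N) : He (fun y => D * (2 * f1 y - f2 y)) p = D * (2 * He f1 p - He f2 p) := by
  unfold He
  have i1 : Integrable (fun y => hk p.1 (p.2 - y) * f1 y) :=
    (hk_comp_sub_integrable p.2).mul_bdd (c := M1) h1.aestronglyMeasurable (ae_of_all _ b1)
  have i2 : Integrable (fun y => hk p.1 (p.2 - y) * f2 y) :=
    (hk_comp_sub_integrable p.2).mul_bdd (c := M2) h2.aestronglyMeasurable (ae_of_all _ b2)
  rw [← integral_const_mul, ← integral_sub (i1.const_mul 2) i2, ← integral_const_mul]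
  congr 1; ext y; ring

lemma Dh_lin {f1 f2 : ℝ × Euc N → ℝ} {p : ℝ × Euc N}
    (i1 : Integrable (fun q : ℝ × Euc N => hk (p.1 - q.1) (p.2 - q.2) * f1 q))
    (i2 : Integrable (fun q : ℝ × Euc N => hk (p.1 - q.1) (p.2 - q.2) * f2 q))
    (D : ℝ) : Dh (fun y => D * (2 * f1 y - f2 y)) p = D * (2 * Dh f1 p - Dh f2 p) := by
  unfold Dh
  rw [← integral_const_mul, ← integral_sub (i1.const_mul 2) i2, ← integral_const_mul]
  congr 1; ext y; ring

lemma mono_meas_sq (Λ A a b c : ℝ) : Measurable (fun p : ℝ × Euc N => mono Λ A a b c p.1 (‖p.2‖ ^ 2)) := by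
  unfold mono; fun_prop

set_option maxHeartbeats 1000000 in
lemma super_exists [NeZero N] {α b C₀ η ρ S δ M : ℝ} (hα : 0 < α) (hb : 0 < b) (hC₀ : 0 ≤ C₀) (hη : 0 < η)
    (hηN : 2 * η < N - 2) (hκ : (α + 1) * b ^ α = η * (N - 2 - η)) (hρ : 0 < ρ) (hηα : η < 2 / α) (hS : 0 < S) (hδ : 0 < δ) (hM : 0 ≤ M)
    {U : ℝ → Euc N → ℝ}
    (hUest : ∀ t : ℝ, ∀ x : Euc N, 0 < t → t < S → x ≠ 0 →
      |‖x‖ ^ (2 / α) * U t x - b| ≤ C₀ * ((‖x‖ / (‖x‖ + Real.sqrt t)) ^ ρ + ‖x‖ ^ (2 / α))) :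
    ∃ T : ℝ, 0 < T ∧ T < S ∧ ∃ (ψ : ℝ × Euc N → ℝ) (ψ0 : Euc N → ℝ) (g : ℝ × Euc N → ℝ) (B M' Cg : ℝ),
      Measurable ψ ∧ Measurable ψ0 ∧ (∀ y, |ψ0 y| ≤ M') ∧ (∀ y, 0 ≤ ψ0 y) ∧ (∀ y, δ ≤ ‖y‖ → M ≤ ψ0 y) ∧
      Measurable g ∧ (∀ q, |g q| ≤ Cg * wt (η + 2) q.2) ∧ (∀ q, q.1 ≤ 0 → g q = 0) ∧
      ∀ t : ℝ, ∀ x : Euc N, 0 < t → t < T → x ≠ 0 → ψ (t, x) = He ψ0 (t, x) + Dh g (t, x) ∧ 0 ≤ ψ (t, x) ∧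
        ψ (t, x) ≤ B * wt η x ∧ (α + 1) * (|U t x| + ψ (t, x)) ^ α * ψ (t, x) ≤ g (t, x) := by
  obtain ⟨k, hk⟩ : ∃ k, k = η / 2 := ⟨_, rfl⟩
  have hk0 : 0 < k := by linarith
  have hη2 : η = 2 * k := by linarith
  obtain ⟨σ, hσ0, hσ1, hσ2, hσ3, hσ4⟩ : ∃ σ : ℝ, 0 < σ ∧ σ < k ∧ σ ≤ 1 / 4 ∧ 4 * σ ≤ ρ ∧ 4 * σ ≤ 2 / α - η := by
    have p : 0 < 2 / α - η := by linarith
    refine ⟨min (min (k / 2) (1 / 4)) (min (ρ / 4) ((2 / α - η) / 4)), by positivity, ?_, ?_, ?_, ?_⟩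
    · have := (min_le_left (min (k / 2) (1 / 4)) (min (ρ / 4) ((2 / α - η) / 4))).trans (min_le_left _ _); linarith
    · exact (min_le_left (min (k / 2) (1 / 4)) (min (ρ / 4) ((2 / α - η) / 4))).trans (min_le_right _ _)
    · have := (min_le_right (min (k / 2) (1 / 4)) (min (ρ / 4) ((2 / α - η) / 4))).trans (min_le_left _ _); linarith
    · have := (min_le_right (min (k / 2) (1 / 4)) (min (ρ / 4) ((2 / α - η) / 4))).trans (min_le_right _ _); linarith
  obtain ⟨C1, hC1, hV⟩ := Vbound hα hb hC₀ hσ0 hη hσ3 hσ4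
  obtain ⟨c, hc⟩ : ∃ c, c = 2 * k * ((N:ℝ) - 2 - 2 * k) - 2 * (k - σ) * (N - 2 - 2 * (k - σ)) := ⟨_, rfl⟩
  have hc0 : 0 < c := by
    have : c = 2 * σ * (N - 2 - 4 * k + 2 * σ) := by rw [hc]; ring
    rw [this]
    have : 0 < (N:ℝ) - 2 - 4 * k + 2 * σ := by linarith
    positivity
  have hNn : (0:ℝ) ≤ N := Nat.cast_nonneg N
  obtain ⟨m, hmk, hm1, hI⟩ := ineq_i (k := k) (a0 := 16 * (1 + N + k)) hc0 hC1 (by linarith) hσ0 hσ2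
  obtain ⟨A, hA⟩ : ∃ A, A = 16 * (1 + N + k) * m := ⟨_, rfl⟩
  rw [← hA] at hI
  have hA1 : 1 ≤ A := by
    rw [hA]; exact one_le_mul_of_one_le_of_one_le (by linarith) hm1
  have hA0 : 0 < A := by linarith
  obtain ⟨C, hC, hsup⟩ := super1 N hσ0 hσ1 hmk hA
  rw [← hc] at hsup
  have hκ' : 2 * k * ((N:ℝ) - 2 - 2 * k) = (α + 1) * b ^ α := by rw [hκ, hη2]
  rw [hκ'] at hsup
  obtain ⟨D, hD⟩ : ∃ D, D = M / (δ ^ 2 / (1 + δ ^ 2)) ^ (m - k) := ⟨_, rfl⟩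
  have hD0 : 0 ≤ D := by rw [hD]; positivity
  obtain ⟨B, hB⟩ : ∃ B, B = 4 * D * A ^ m * 2 ^ k := ⟨_, rfl⟩
  have hB0 : 0 ≤ B := by rw [hB]; positivity
  obtain ⟨CB, hCB, hVB⟩ := hV B hB0
  obtain ⟨Λ0, hΛ0, hII⟩ := ineq_ii hc0 hCB hA1 hσ0 hσ2
  obtain ⟨Λ, hΛ⟩ : ∃ Λ, Λ = Λ0 + C + 2 * CB := ⟨_, rfl⟩
  have hΛp : 0 < Λ := by linarith
  have hlog : 0 < Real.log 2 := Real.log_pos (by norm_num)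
  obtain ⟨T, hT⟩ : ∃ T, T = min (min 1 (S / 2)) (Real.log 2 / Λ) := ⟨_, rfl⟩
  have hT0 : 0 < T := by rw [hT]; positivity
  have hT1 : T ≤ 1 := by rw [hT]; exact (min_le_left _ _).trans (min_le_left _ _)
  have hTS : T < S := by
    have : T ≤ S / 2 := by rw [hT]; exact (min_le_left _ _).trans (min_le_right _ _)
    linarith
  have hTΛ : Λ * T ≤ Real.log 2 := by
    have : T ≤ Real.log 2 / Λ := by rw [hT]; exact min_le_right _ _
    rw [le_div_iff₀ hΛp] at this; linarith
  have abc1 : -k + -(m - k) + m = 0 := by ring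
  have abc2 : (-k + σ) + -(m - k) + (m - σ) = 0 := by ring
  obtain ⟨K1, hK1, hLF1⟩ := LF_le (N := N) (Λ := Λ) (a := -k) (b := -(m - k)) (c := m) (k := k) hA1 hΛp.le (by linarith) hk0.le (by linarith) abc1
  obtain ⟨K2, hK2, hLF2⟩ := LF_le (N := N) (Λ := Λ) (a := -k + σ) (b := -(m - k)) (c := m - σ) (k := k) hA1 hΛp.le (by linarith) hk0.le (by linarith) abc2
  have hkN : 2 * k + 2 < N := by linarith
  have hmz : ∀ a b c : ℝ, Measurable (fun y : Euc N => mono Λ A a b c 0 (‖y‖ ^ 2)) := by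
    intro a b c; unfold mono; fun_prop
  have hz1 : ∀ y : Euc N, |mono Λ A (-k) (-(m - k)) m 0 (‖y‖ ^ 2)| ≤ 1 := fun y =>
    mono_zero_le abc1 (by linarith) (by positivity)
  have hz2 : ∀ y : Euc N, |mono Λ A (-k + σ) (-(m - k)) (m - σ) 0 (‖y‖ ^ 2)| ≤ 1 := fun y =>
    mono_zero_le abc2 (by linarith) (by positivity)
  have hψ0 : ∀ y : Euc N, y ≠ 0 → 2 * mono Λ A (-k) (-(m - k)) m 0 (‖y‖ ^ 2) - mono Λ A (-k + σ) (-(m - k)) (m - σ) 0 (‖y‖ ^ 2) =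
      (‖y‖ ^ 2 / (1 + ‖y‖ ^ 2)) ^ (m - k) := by
    intro y hy
    have hX : 0 < ‖y‖ ^ 2 := by have := norm_pos_iff.2 hy; positivity
    rw [mono_ratio hX (by simpa using hX)]
    simp only [mul_zero, add_zero, div_self hX.ne', Real.one_rpow, mul_one]
    unfold mono
    rw [Real.div_rpow hX.le (by positivity), Real.rpow_neg (by positivity : (0:ℝ) ≤ 1 + ‖y‖ ^ 2), Real.rpow_sub hX m k, Real.rpow_neg hX.le]
    simp only [mul_zero, add_zero, Real.exp_zero]
    ring
  refine ⟨T, hT0, hTS, fun p => D * (2 * mono Λ A (-k) (-(m - k)) m p.1 (‖p.2‖ ^ 2) - mono Λ A (-k + σ) (-(m - k)) (m - σ) p.1 (‖p.2‖ ^ 2)),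
    fun y => D * (2 * mono Λ A (-k) (-(m - k)) m 0 (‖y‖ ^ 2) - mono Λ A (-k + σ) (-(m - k)) (m - σ) 0 (‖y‖ ^ 2)),
    fun q => D * (2 * LF N Λ A (-k) (-(m - k)) m q - LF N Λ A (-k + σ) (-(m - k)) (m - σ) q), B, D * 3, D * (2 * K1 + K2),
    ?_, ?_, ?_, ?_, ?_, ?_, ?_, ?_, ?_⟩
  · exact (((mono_meas_sq _ _ _ _ _).const_mul 2).sub (mono_meas_sq _ _ _ _ _)).const_mul D
  · exact (((hmz _ _ _).const_mul 2).sub (hmz _ _ _)).const_mul D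
  · intro y
    rw [abs_mul, abs_of_nonneg hD0]
    refine mul_le_mul_of_nonneg_left ((abs_sub _ _).trans ?_) hD0
    rw [abs_mul, abs_two]
    linarith [hz1 y, hz2 y]
  · intro y
    by_cases hy : y = 0
    · refine mul_nonneg hD0 ?_
      subst hy
      unfold mono
      have h0 : (0:ℝ) ^ (-k) = 0 := Real.zero_rpow (by linarith)
      have h1 : (0:ℝ) ^ (-k + σ) = 0 := Real.zero_rpow (by linarith)
      simp [h0, h1]
    · beta_reduce; rw [hψ0 y hy]; positivity
  · intro y hy
    have hy0 : y ≠ 0 := by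
      intro h; rw [h, norm_zero] at hy; linarith
    beta_reduce
    rw [hψ0 y hy0]
    have h1 : (δ ^ 2 / (1 + δ ^ 2)) ^ (m - k) ≤ (‖y‖ ^ 2 / (1 + ‖y‖ ^ 2)) ^ (m - k) := by
      refine Real.rpow_le_rpow (by positivity) ?_ (by linarith)
      have : δ ^ 2 ≤ ‖y‖ ^ 2 := by gcongr
      rw [div_le_div_iff₀ (by positivity) (by positivity)]
      linarith
    have h2 : M = D * (δ ^ 2 / (1 + δ ^ 2)) ^ (m - k) := by rw [hD]; field_simp
    rw [h2]
    gcongr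
  · exact (((LF_measurable _ _ _ _ _).const_mul 2).sub (LF_measurable _ _ _ _ _)).const_mul D
  · intro q
    rw [abs_mul, abs_of_nonneg hD0, mul_assoc]
    refine mul_le_mul_of_nonneg_left ((abs_sub _ _).trans ?_) hD0
    rw [abs_mul, abs_two, hη2]
    linarith [hLF1 q, hLF2 q]
  · intro q hq
    have h0 : ¬ (0 < q.1 ∧ q.1 ≤ 1 ∧ q.2 ≠ 0) := fun h => by linarith [h.1]
    simp only [LF, if_neg h0]; ring
  · intro t x ht htT hx
    have ht1 : t ≤ 1 := by linarith
    have hX : 0 < ‖x‖ ^ 2 := by have := norm_pos_iff.2 hx; positivity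
    have hQ : 0 < ‖x‖ ^ 2 + A * t := by positivity
    have hg1 := mono_nonneg (Λ := Λ) (a := -k) (b := -(m - k)) (c := m) hA0.le ht.le hX.le
    have hg2 := mono_nonneg (Λ := Λ) (a := -k + σ) (b := -(m - k)) (c := m - σ) hA0.le ht.le hX.le
    have hg12 : mono Λ A (-k + σ) (-(m - k)) (m - σ) t (‖x‖ ^ 2) ≤ mono Λ A (-k) (-(m - k)) m t (‖x‖ ^ 2) := by
      rw [mono_ratio hX hQ]
      refine mul_le_of_le_one_right hg1 (Real.rpow_le_one (by positivity) ?_ hσ0.le)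
      rw [div_le_one hQ]; nlinarith
    have hψn : 0 ≤ D * (2 * mono Λ A (-k) (-(m - k)) m t (‖x‖ ^ 2) - mono Λ A (-k + σ) (-(m - k)) (m - σ) t (‖x‖ ^ 2)) :=
      mul_nonneg hD0 (by linarith)
    have hψB : D * (2 * mono Λ A (-k) (-(m - k)) m t (‖x‖ ^ 2) - mono Λ A (-k + σ) (-(m - k)) (m - σ) t (‖x‖ ^ 2)) ≤ B * wt η x := by
      have h1 : mono Λ A (-k) (-(m - k)) m t (‖x‖ ^ 2) ≤ 2 * (A ^ m * (2 ^ k * wt η x)) := by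
        rw [mono_exp]
        have e1 : Real.exp (Λ * t) ≤ 2 := by
          have : Λ * t ≤ Real.log 2 := le_trans (by gcongr) hTΛ
          calc _ ≤ Real.exp (Real.log 2) := Real.exp_le_exp.2 this
            _ = 2 := Real.exp_log (by norm_num)
        have e2 := mono_le (Λ := 0) (a := -k) (b := -(m - k)) (c := m) (k := k) hA1 le_rfl (by linarith) (by linarith) abc1 ht.le ht1 hX
        rw [Real.exp_zero, one_mul] at e2
        have e3 := wt_of_X (x := x) hk0.le
        rw [← hη2] at e3
        have e4 := mono_nonneg (Λ := 0) (a := -k) (b := -(m - k)) (c := m) hA0.le ht.le hX.le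
        refine mul_le_mul e1 (e2.trans ?_) e4 (by norm_num)
        gcongr
      have h2 : 2 * mono Λ A (-k) (-(m - k)) m t (‖x‖ ^ 2) - mono Λ A (-k + σ) (-(m - k)) (m - σ) t (‖x‖ ^ 2) ≤ 4 * (A ^ m * (2 ^ k * wt η x)) := by linarith
      calc _ ≤ D * (4 * (A ^ m * (2 ^ k * wt η x))) := by gcongr
        _ = B * wt η x := by rw [hB]; ring
    refine ⟨?_, hψn, hψB, ?_⟩
    · obtain ⟨K, hK, hdb⟩ := dh_bound (N := N) (γ := 2 * k + 2) (by linarith) hkN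
      have hL0 : ∀ a b c : ℝ, ∀ q : ℝ × Euc N, q.1 ≤ 0 → LF N Λ A a b c q = 0 := by
        intro a b c q hq
        have h0 : ¬ (0 < q.1 ∧ q.1 ≤ 1 ∧ q.2 ≠ 0) := fun h => by linarith [h.1]
        simp only [LF, if_neg h0]
      have i1 := (hdb 0 K1 _ (LF_measurable _ _ _ _ _) hLF1 (hL0 _ _ _) (t, x) hx ht.le).1
      have i2 := (hdb 0 K2 _ (LF_measurable _ _ _ _ _) hLF2 (hL0 _ _ _) (t, x) hx ht.le).1
      rw [He_lin (hmz _ _ _) (hmz _ _ _) hz1 hz2, Dh_lin i1 i2]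
      have r1 := mono_repr (Λ := Λ) (a := -k) (b := -(m - k)) (c := m) (k := k) hA1 hΛp.le (by linarith) hk0.le (by linarith) abc1 (by linarith) hkN ht ht1 hx
      have r2 := mono_repr (Λ := Λ) (a := -k + σ) (b := -(m - k)) (c := m - σ) (k := k) hA1 hΛp.le (by linarith) hk0.le (by linarith) abc2 (by linarith) hkN ht ht1 hx
      simp only [r1, r2]
      ring
    · have hr : 0 < ‖x‖ := norm_pos_iff.2 hx
      have hVV := hVB t ‖x‖ (U t x) _ ht hr hψn (hUest t x ht (by linarith) hx) hψB
      have hs := hsup Λ t (‖x‖ ^ 2) hΛp.le ht.le hX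
      have hi := hI t (‖x‖ ^ 2) ht.le hX
      have hii := hII t (‖x‖ ^ 2) ht.le ht1 hX
      have hcond : 0 < t ∧ t ≤ 1 ∧ x ≠ 0 := ⟨ht, ht1, hx⟩
      simp only [LF, if_pos hcond]
      refine le_trans (mul_le_mul_of_nonneg_right hVV hψn) ?_
      rw [mul_left_comm]
      refine mul_le_mul_of_nonneg_left (le_trans ?_ hs) hD0
      generalize mono Λ A (-k) (-(m - k)) m t (‖x‖ ^ 2) = g1 at *
      generalize mono Λ A (-k + σ) (-(m - k)) (m - σ) t (‖x‖ ^ 2) = g2 at *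
      have hQi : (‖x‖ ^ 2 + A * t)⁻¹ = (‖x‖ ^ 2 / (‖x‖ ^ 2 + A * t)) * (‖x‖ ^ 2)⁻¹ := by field_simp
      rw [hQi]
      have hiX : 0 < (‖x‖ ^ 2)⁻¹ := by positivity
      have hXi : ‖x‖ ^ 2 * (‖x‖ ^ 2)⁻¹ = 1 := mul_inv_cancel₀ hX.ne'
      have hY0 : 0 ≤ (‖x‖ ^ 2 / (‖x‖ ^ 2 + t)) ^ (2 * σ) := by positivity
      have hX0 : 0 ≤ (‖x‖ ^ 2) ^ (2 * σ) := by positivity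
      generalize (‖x‖ ^ 2 / (‖x‖ ^ 2 + A * t)) ^ σ = Zσ at *
      generalize ‖x‖ ^ 2 / (‖x‖ ^ 2 + A * t) = Z at *
      generalize (‖x‖ ^ 2 / (‖x‖ ^ 2 + t)) ^ (2 * σ) = Y at *
      generalize (‖x‖ ^ 2) ^ (2 * σ) = X2 at *
      generalize (‖x‖ ^ 2)⁻¹ = i at *
      generalize ‖x‖ ^ 2 = X at *
      have k1 : (C1 * (i * Y) + CB * (i * X2 + 1)) * (2 * g1 - g2) ≤ (C1 * (i * Y) + CB * (i * X2 + 1)) * (2 * g1) := by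
        gcongr; linarith
      have k2 := mul_le_mul_of_nonneg_right (add_le_add hi hii) (mul_nonneg hg1 hiX.le)
      have k3 : Λ0 * X * (g1 * i) = Λ0 * g1 := by
        calc _ = Λ0 * g1 * (X * i) := by ring
          _ = _ := by rw [hXi, mul_one]
      rw [hΛ]
      linarith

end HeatAux

namespace HeatAux

set_option linter.all false
open Set Topology

variable {N : ℕ}

def pw (α x : ℝ) : ℝ := |x| ^ α * x

lemma pw_cont {α : ℝ} (hα : 0 < α) : Continuous (pw α) := by
  unfold pw
  exact (continuous_abs.rpow_const (fun x => Or.inr hα.le)).mul continuous_id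

lemma pw_neg (α x : ℝ) : pw α (-x) = - pw α x := by unfold pw; rw [abs_neg]; ring

lemma pw_nonneg {α x : ℝ} (hx : 0 ≤ x) : 0 ≤ pw α x := by unfold pw; positivity

lemma pw_mono_pos {α : ℝ} (hα : 0 < α) {a b : ℝ} (hb : 0 ≤ b) (hab : b ≤ a) : pw α b ≤ pw α a := by
  unfold pw
  have : 0 ≤ a := hb.trans hab
  rw [abs_of_nonneg hb, abs_of_nonneg this]
  gcongr

lemma pw_monotone {α : ℝ} (hα : 0 < α) {a b : ℝ} (hab : b ≤ a) : pw α b ≤ pw α a := by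
  rcases le_total 0 b with hb | hb
  · exact pw_mono_pos hα hb hab
  · rcases le_total 0 a with ha | ha
    · have h1 := pw_nonneg (α := α) ha
      have h2 := pw_nonneg (α := α) (x := -b) (by linarith)
      rw [pw_neg] at h2; linarith
    · have := pw_mono_pos hα (a := -b) (b := -a) (by linarith) (by linarith)
      rw [pw_neg, pw_neg] at this; linarith

lemma pw_lip_pos {α : ℝ} (hα : 0 < α) {a b : ℝ} (hb : 0 ≤ b) (hab : b ≤ a) : pw α a - pw α b ≤ (α + 1) * a ^ α * (a - b) := by
  rcases hb.eq_or_lt with h0 | h0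
  · have h1 : pw α b = 0 := by rw [← h0]; unfold pw; simp
    rw [h1, ← h0]; unfold pw
    rw [abs_of_nonneg (by linarith)]
    have : 0 ≤ a ^ α * a := by have : 0 ≤ a := by linarith
                               positivity
    nlinarith
  · have ha : 0 < a := by linarith
    have hB := one_add_mul_self_le_rpow_one_add (s := (b - a) / a) (p := α + 1) (by rw [le_div_iff₀ ha]; linarith) (by linarith)
    have e1 : 1 + (b - a) / a = b / a := by field_simp; ring
    rw [e1, Real.div_rpow hb ha.le, Real.rpow_add_one ha.ne', Real.rpow_add_one h0.ne'] at hB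
    unfold pw
    rw [abs_of_pos ha, abs_of_pos h0]
    have hp : 0 < a ^ α * a := by positivity
    rw [le_div_iff₀ hp] at hB
    have e2 : (1 + (α + 1) * ((b - a) / a)) * (a ^ α * a) = a ^ α * a + (α + 1) * a ^ α * (b - a) := by field_simp
    linarith

lemma pw_lip_le {α : ℝ} (hα : 0 < α) {a b M : ℝ} (hab : b ≤ a) (ha : |a| ≤ M) (hb : |b| ≤ M) :
    pw α a - pw α b ≤ (α + 1) * M ^ α * (a - b) := by
  have hM : 0 ≤ M := (abs_nonneg a).trans ha
  rcases le_total 0 b with hb0 | hb0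
  · refine (pw_lip_pos hα hb0 hab).trans ?_
    have : a ≤ M := (le_abs_self a).trans ha
    have ha0 : 0 ≤ a := hb0.trans hab
    gcongr
  · rcases le_total 0 a with ha0 | ha0
    · have h1 : pw α a ≤ M ^ α * a := by unfold pw; gcongr
      have h2 : pw α (-b) ≤ M ^ α * (-b) := by
        unfold pw; rw [abs_neg]
        have : 0 ≤ -b := by linarith
        gcongr
      rw [pw_neg] at h2
      have h3 : 0 ≤ α * (M ^ α * (a - b)) := by
        have : 0 ≤ a - b := by linarith
        positivity
      nlinarith
    · have := pw_lip_pos hα (a := -b) (b := -a) (by linarith) (by linarith)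
      rw [pw_neg, pw_neg] at this
      have h4 : (α + 1) * (-b) ^ α * (-b - -a) ≤ (α + 1) * M ^ α * (-b - -a) := by
        have h5 : -b ≤ M := (neg_le_abs b).trans hb
        have h6 : 0 ≤ -b := by linarith
        gcongr; linarith
      linarith

lemma pw_lip {α : ℝ} (hα : 0 < α) {a w ψ : ℝ} (hw : |w| ≤ ψ) :
    |pw α (a + w) - pw α a| ≤ (α + 1) * (|a| + ψ) ^ α * ψ := by
  have hψ : 0 ≤ ψ := (abs_nonneg w).trans hw
  have h1 : |a + w| ≤ |a| + ψ := (abs_add_le _ _).trans (by linarith)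
  have h2 : |a| ≤ |a| + ψ := by linarith
  have hk : 0 ≤ (α + 1) * (|a| + ψ) ^ α := by positivity
  rcases le_total 0 w with h | h
  · have h3 := pw_monotone hα (a := a + w) (b := a) (by linarith)
    rw [abs_of_nonneg (by linarith)]
    refine (pw_lip_le hα (by linarith) h1 h2).trans ?_
    refine mul_le_mul_of_nonneg_left ?_ hk
    have := le_abs_self w; linarith
  · have h3 := pw_monotone hα (a := a) (b := a + w) (by linarith)
    rw [abs_of_nonpos (by linarith), neg_sub]
    refine (pw_lip_le hα (by linarith) h2 h1).trans ?_
    refine mul_le_mul_of_nonneg_left ?_ hk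
    have := neg_le_abs w; linarith

lemma Dh_measurable {f : ℝ × Euc N → ℝ} (hf : Measurable f) : Measurable (Dh f) := by
  have h : Measurable (fun z : (ℝ × Euc N) × (ℝ × Euc N) => hk (z.1.1 - z.2.1) (z.1.2 - z.2.2) * f z.2) := by
    refine Measurable.mul ?_ (hf.comp measurable_snd)
    have := hk_measurable (N := N)
    exact this.comp (f := fun z : (ℝ × Euc N) × (ℝ × Euc N) => ((z.1.1 - z.2.1), (z.1.2 - z.2.2))) (by fun_prop)
  exact (h.stronglyMeasurable.integral_prod_right').measurable

lemma He_measurable {f : Euc N → ℝ} (hf : Measurable f) : Measurable (He f) := by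
  have h : Measurable (fun z : (ℝ × Euc N) × (Euc N) => hk (z.1.1) (z.1.2 - z.2) * f z.2) := by
    refine Measurable.mul ?_ (hf.comp measurable_snd)
    have := hk_measurable (N := N)
    exact this.comp (f := fun z : (ℝ × Euc N) × (Euc N) => ((z.1.1), (z.1.2 - z.2))) (by fun_prop)
  exact (h.stronglyMeasurable.integral_prod_right').measurable

lemma He_mono {f g : Euc N → ℝ} (hf : Measurable f) (hg : Measurable g) {M M' : ℝ} (hfb : ∀ y, |f y| ≤ M) (hgb : ∀ y, |g y| ≤ M')
    (hfg : ∀ y, f y ≤ g y) (p : ℝ × Euc N) : He f p ≤ He g p := by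
  unfold He
  have i1 : Integrable (fun y => hk p.1 (p.2 - y) * f y) :=
    (hk_comp_sub_integrable p.2).mul_bdd (c := M) hf.aestronglyMeasurable (ae_of_all _ hfb)
  have i2 : Integrable (fun y => hk p.1 (p.2 - y) * g y) :=
    (hk_comp_sub_integrable p.2).mul_bdd (c := M') hg.aestronglyMeasurable (ae_of_all _ hgb)
  exact integral_mono i1 i2 (fun y => mul_le_mul_of_nonneg_left (hfg y) (hk_nonneg _ _))

lemma He_neg (f : Euc N → ℝ) (p : ℝ × Euc N) : He (fun y => - f y) p = - He f p := by
  unfold He; rw [← integral_neg]; congr 1; ext y; ring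

lemma Dh_neg (f : ℝ × Euc N → ℝ) (p : ℝ × Euc N) : Dh (fun y => - f y) p = - Dh f p := by
  unfold Dh; rw [← integral_neg]; congr 1; ext y; ring

/-- space-time domain -/
def Om (N : ℕ) (T : ℝ) : Set (ℝ × Euc N) := Ioo 0 T ×ˢ {x : Euc N | x ≠ 0}

lemma Om_open (T : ℝ) : IsOpen (Om N T) := isOpen_Ioo.prod isOpen_ne

lemma Dh_mono [NeZero N] {f g : ℝ × Euc N → ℝ} {T : ℝ} {p : ℝ × Euc N} (hp : p.1 < T)
    (i1 : Integrable (fun q : ℝ × Euc N => hk (p.1 - q.1) (p.2 - q.2) * f q))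
    (i2 : Integrable (fun q : ℝ × Euc N => hk (p.1 - q.1) (p.2 - q.2) * g q))
    (hf0 : ∀ q, q.1 ≤ 0 → f q = 0) (hg0 : ∀ q, q.1 ≤ 0 → g q = 0)
    (hfg : ∀ q ∈ Om N T, f q ≤ g q) : Dh f p ≤ Dh g p := by
  unfold Dh
  refine integral_mono_ae i1 i2 ?_
  filter_upwards [ae_snd_ne (N := N)] with q hq
  rcases le_or_gt q.1 0 with h | h
  · simp only [hf0 q h, hg0 q h]; exact le_rfl
  · rcases le_or_gt p.1 q.1 with h' | h'
    · simp only [hk_of_nonpos (sub_nonpos.2 h')]; simp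
    · exact mul_le_mul_of_nonneg_left (hfg q ⟨⟨h, h'.trans hp⟩, hq⟩) (hk_nonneg _ _)

open Classical in
def Fop (α T : ℝ) (V w : ℝ × Euc N → ℝ) (q : ℝ × Euc N) : ℝ :=
  if q ∈ Om N T then pw α (V q + w q) - pw α (V q) else 0

lemma Fop_meas {α T : ℝ} (hα : 0 < α) {V w : ℝ × Euc N → ℝ} (hV : Measurable V) (hw : Measurable w) : Measurable (Fop α T V w) := by
  classical
  unfold Fop
  have h := (pw_cont hα).measurable
  refine Measurable.ite (Om_open T).measurableSet ((h.comp (hV.add hw)).sub (h.comp hV)) measurable_const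

lemma iter_exists [NeZero N] {α γ T Cg M' : ℝ} (hα : 0 < α) (hγ0 : 0 ≤ γ) (hγ : γ < N)
    {V ψ g : ℝ × Euc N → ℝ} {ψ0 w₀ : Euc N → ℝ} (hV : Measurable V) (hψ : Measurable ψ) (hg : Measurable g)
    (hψ0 : Measurable ψ0) (hw₀ : Measurable w₀) (hψ0b : ∀ y, |ψ0 y| ≤ M') (hw₀b : ∀ y, |w₀ y| ≤ ψ0 y)
    (hgb : ∀ q, |g q| ≤ Cg * wt γ q.2) (hg0 : ∀ q, q.1 ≤ 0 → g q = 0)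
    (hψe : ∀ p ∈ Om N T, ψ p = He ψ0 p + Dh g p) (hψn : ∀ p ∈ Om N T, 0 ≤ ψ p)
    (hsup : ∀ p ∈ Om N T, (α + 1) * (|V p| + ψ p) ^ α * ψ p ≤ g p) :
    ∃ w f : ℝ × Euc N → ℝ, Measurable w ∧ Measurable f ∧ (∀ q, |f q| ≤ Cg * wt γ q.2) ∧ (∀ q, q.1 ≤ 0 → f q = 0) ∧
      (∀ q ∈ Om N T, f q = pw α (V q + w q) - pw α (V q)) ∧ (∀ p ∈ Om N T, w p = He w₀ p + Dh f p) ∧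
      (∀ p ∈ Om N T, |w p| ≤ ψ p) ∧ (∀ p, p ∉ Om N T → w p = 0) := by
  classical
  obtain ⟨K, hK, hdb⟩ := dh_bound (N := N) hγ0 hγ
  have hw₀M : ∀ y, |w₀ y| ≤ M' := fun y => (hw₀b y).trans ((le_abs_self _).trans (hψ0b y))
  have F0 : ∀ w : ℝ × Euc N → ℝ, ∀ q, q ∉ Om N T → Fop α T V w q = 0 := fun w q hq => if_neg hq
  have F1 : ∀ w : ℝ × Euc N → ℝ, ∀ q, q ∈ Om N T → Fop α T V w q = pw α (V q + w q) - pw α (V q) := fun w q hq => if_pos hq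
  have F00 : ∀ w : ℝ × Euc N → ℝ, ∀ q, q.1 ≤ 0 → Fop α T V w q = 0 := fun w q hq => F0 w q (fun h => by linarith [h.1.1])
  have Fg : ∀ w : ℝ × Euc N → ℝ, (∀ p ∈ Om N T, |w p| ≤ ψ p) → ∀ q ∈ Om N T, |Fop α T V w q| ≤ g q := by
    intro w hw q hq
    rw [F1 w q hq]
    exact (pw_lip hα (hw q hq)).trans (hsup q hq)
  have Fg' : ∀ w : ℝ × Euc N → ℝ, (∀ p ∈ Om N T, |w p| ≤ ψ p) → ∀ q, |Fop α T V w q| ≤ |g q| := by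
    intro w hw q
    by_cases hq : q ∈ Om N T
    · exact (Fg w hw q hq).trans (le_abs_self _)
    · rw [F0 w q hq, abs_zero]; positivity
  have Fb : ∀ w : ℝ × Euc N → ℝ, (∀ p ∈ Om N T, |w p| ≤ ψ p) → ∀ q, |Fop α T V w q| ≤ Cg * wt γ q.2 :=
    fun w hw q => (Fg' w hw q).trans (hgb q)
  have Fi : ∀ w : ℝ × Euc N → ℝ, Measurable w → (∀ p ∈ Om N T, |w p| ≤ ψ p) → ∀ p ∈ Om N T,
      Integrable (fun q : ℝ × Euc N => hk (p.1 - q.1) (p.2 - q.2) * Fop α T V w q) := fun w hwm hw p hp =>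
    (hdb 0 Cg _ (Fop_meas hα hV hwm) (Fb w hw) (F00 w) p hp.2 hp.1.1.le).1
  have gi : ∀ p ∈ Om N T, Integrable (fun q : ℝ × Euc N => hk (p.1 - q.1) (p.2 - q.2) * g q) := fun p hp =>
    (hdb 0 Cg _ hg hgb hg0 p hp.2 hp.1.1.le).1
  have Pb : ∀ w : ℝ × Euc N → ℝ, Measurable w → (∀ p ∈ Om N T, |w p| ≤ ψ p) → ∀ p ∈ Om N T,
      |He w₀ p + Dh (Fop α T V w) p| ≤ ψ p := by
    intro w hwm hw p hp
    rw [hψe p hp]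
    have h1 := He_mono hw₀ hψ0 hw₀M hψ0b (fun y => (le_abs_self _).trans (hw₀b y)) p
    have h2 := He_mono (f := fun y => - w₀ y) hw₀.neg hψ0 (M := M') (fun y => by rw [abs_neg]; exact hw₀M y) hψ0b (fun y => (neg_le_abs _).trans (hw₀b y)) p
    rw [He_neg] at h2
    have h3 := Dh_mono hp.1.2 (Fi w hwm hw p hp) (gi p hp) (F00 w) hg0 (fun q hq => (le_abs_self _).trans (Fg w hw q hq))
    have h4 := Dh_mono (f := fun q => - Fop α T V w q) hp.1.2 (by simpa using (Fi w hwm hw p hp).neg) (gi p hp) (fun q hq => by rw [F00 w q hq, neg_zero]) hg0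
      (fun q hq => (neg_le_abs _).trans (Fg w hw q hq))
    rw [Dh_neg] at h4
    rw [abs_le]; constructor <;> linarith
  let W : ℕ → ℝ × Euc N → ℝ := fun n => Nat.rec ψ (fun _ w p => He w₀ p + Dh (Fop α T V w) p) n
  have W0 : W 0 = ψ := rfl
  have W1 : ∀ n, W (n+1) = fun p => He w₀ p + Dh (Fop α T V (W n)) p := fun n => rfl
  have Wm : ∀ n, Measurable (W n) := by
    intro n
    induction n with
    | zero => exact hψ
    | succ n ih => rw [W1]; exact (He_measurable hw₀).add (Dh_measurable (Fop_meas hα hV ih))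
  have Wb : ∀ n, ∀ p ∈ Om N T, |W n p| ≤ ψ p := by
    intro n
    induction n with
    | zero => intro p hp; rw [W0, abs_of_nonneg (hψn p hp)]
    | succ n ih => rw [W1]; exact Pb _ (Wm n) ih
  have Wd : ∀ n, ∀ p ∈ Om N T, W (n+1) p ≤ W n p := by
    intro n
    induction n with
    | zero => intro p hp; rw [W0]; exact (le_abs_self _).trans (Wb 1 p hp)
    | succ n ih =>
      intro p hp
      rw [W1 (n+1), W1 n]
      beta_reduce
      have := Dh_mono hp.1.2 (Fi _ (Wm (n+1)) (Wb (n+1)) p hp) (Fi _ (Wm n) (Wb n) p hp) (F00 _) (F00 _) (fun q hq => by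
        rw [F1 _ q hq, F1 _ q hq]
        have := pw_monotone hα (a := V q + W n q) (b := V q + W (n+1) q) (by linarith [ih q hq])
        linarith)
      linarith
  let w : ℝ × Euc N → ℝ := fun p => ⨅ n, (Om N T).indicator (W n) p
  have wt' : ∀ p ∈ Om N T, Tendsto (fun n => W n p) atTop (𝓝 (w p)) := by
    intro p hp
    have h1 : w p = ⨅ n, W n p := by simp only [w, indicator_of_mem hp]
    rw [h1]
    refine tendsto_atTop_ciInf (antitone_nat_of_succ_le (fun n => Wd n p hp)) ⟨-ψ p, ?_⟩
    rintro _ ⟨n, rfl⟩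
    exact (abs_le.1 (Wb n p hp)).1
  have w0 : ∀ p, p ∉ Om N T → w p = 0 := by
    intro p hp
    simp only [w, indicator_of_notMem hp]; simp
  have wm : Measurable w := Measurable.iInf (fun n => (Wm n).indicator (Om_open T).measurableSet)
  have wb : ∀ p ∈ Om N T, |w p| ≤ ψ p := fun p hp => le_of_tendsto (wt' p hp).abs (Eventually.of_forall (fun n => Wb n p hp))
  refine ⟨w, Fop α T V w, wm, Fop_meas hα hV wm, Fb w wb, F00 w, F1 w, ?_, wb, w0⟩
  intro p hp
  have hD : Tendsto (fun n => Dh (Fop α T V (W n)) p) atTop (𝓝 (Dh (Fop α T V w) p)) := by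
    unfold Dh
    refine tendsto_integral_of_dominated_convergence (fun q => |hk (p.1 - q.1) (p.2 - q.2) * g q|) (fun n => (Fi _ (Wm n) (Wb n) p hp).aestronglyMeasurable) (gi p hp).abs ?_ ?_
    · intro n
      refine ae_of_all _ (fun q => ?_)
      rw [Real.norm_eq_abs, abs_mul, abs_mul]
      exact mul_le_mul_of_nonneg_left (Fg' _ (Wb n) q) (abs_nonneg _)
    · refine ae_of_all _ (fun q => ?_)
      refine Tendsto.const_mul _ ?_
      by_cases hq : q ∈ Om N T
      · simp only [F1 _ q hq]
        exact (((pw_cont hα).tendsto _).comp ((wt' q hq).const_add (V q))).sub_const _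
      · simp only [F0 _ q hq]; exact tendsto_const_nhds
  have h1 := (tendsto_add_atTop_iff_nat 1).2 (wt' p hp)
  have h2 : Tendsto (fun n => W (n+1) p) atTop (𝓝 (He w₀ p + Dh (Fop α T V w) p)) := by
    simp only [W1]; exact hD.const_add _
  exact tendsto_nhds_unique h1 h2

end HeatAux

namespace HeatAux

set_option linter.all false
open Set Topology

variable {N : ℕ}

lemma params (hN : 3 ≤ N) {α α₀ β ρ η : ℝ}
    (hα₀ : α₀ = 4 / ((N : ℝ) - 4 + 2 * Real.sqrt ((N : ℝ) - 1)))
    (hα1 : 2 / ((N : ℝ) - 2) < α) (hα2 : α < α₀)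
    (hβ : β = 2 / α * ((N : ℝ) - 2 - 2 / α))
    (hρ : ρ = 2 / α - ((N : ℝ) - 2) / 2 - Real.sqrt (((N : ℝ) - 2) ^ 2 / 4 - β * (α + 1)))
    (hη : η = ((N : ℝ) - 2) / 2 - Real.sqrt (((N : ℝ) - 2) ^ 2 / 4 - β * (α + 1))) :
    0 < α ∧ 0 < β ∧ 0 < η ∧ 2 * η < N - 2 ∧ (α + 1) * β = η * (N - 2 - η) ∧ 0 < ρ ∧ η < 2 / α ∧ 2 / α < N - 2 := by
  have hN3 : (3:ℝ) ≤ N := by exact_mod_cast hN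
  have hα : 0 < α := lt_trans (div_pos two_pos (by linarith)) hα1
  obtain ⟨n, hn⟩ : ∃ n : ℝ, n = N - 2 := ⟨_, rfl⟩
  obtain ⟨l, hl⟩ : ∃ l : ℝ, l = 2 / α := ⟨_, rfl⟩
  have hl0 : 0 < l := by rw [hl]; positivity
  have hαl : α * l = 2 := by rw [hl]; field_simp
  have hs1 : (1:ℝ) < Real.sqrt (N - 1) := by
    rw [Real.lt_sqrt (by norm_num)]; linarith
  have hsq : Real.sqrt ((N:ℝ) - 1) ^ 2 = N - 1 := Real.sq_sqrt (by linarith)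
  obtain ⟨s, hs⟩ : ∃ s : ℝ, s = Real.sqrt (N - 1) := ⟨_, rfl⟩
  rw [← hs] at hs1 hsq hα₀
  rw [← hn] at hα1 hβ hρ hη ⊢
  rw [← hl] at hβ hρ ⊢
  have hn1 : 1 ≤ n := by linarith
  have hln : l < n := by
    rw [div_lt_iff₀ (by linarith)] at hα1
    by_contra h
    push Not at h
    nlinarith
  have hden : 0 < (N:ℝ) - 4 + 2 * s := by linarith
  have hl2 : (n - 2) / 2 + s < l := by
    rw [hα₀, lt_div_iff₀ hden] at hα2
    by_contra h
    push Not at h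
    have : α * l ≤ α * ((n - 2) / 2 + s) := by gcongr
    nlinarith
  have hβ0 : 0 < β := by rw [hβ]; apply mul_pos hl0; linarith
  have hκ : β * (α + 1) = (l + 2) * (n - l) := by
    rw [hβ]
    calc l * (n - l) * (α + 1) = (α * l + l) * (n - l) := by ring
      _ = _ := by rw [hαl]; ring
  rw [hκ] at hρ hη
  have hκ0 : 0 < (l + 2) * (n - l) := mul_pos (by linarith) (by linarith)
  have hlt : (l + 2) * (n - l) < n ^ 2 / 4 := by
    have h1 : s ^ 2 < (l - (n - 2) / 2) ^ 2 := by
      apply pow_lt_pow_left₀ (by linarith) (by linarith) (by norm_num)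
    nlinarith
  obtain ⟨r, hr⟩ : ∃ r : ℝ, r = Real.sqrt (n ^ 2 / 4 - (l + 2) * (n - l)) := ⟨_, rfl⟩
  have hr0 : 0 < r := by rw [hr]; exact Real.sqrt_pos.2 (by linarith)
  have hr2 : r ^ 2 = n ^ 2 / 4 - (l + 2) * (n - l) := by rw [hr]; exact Real.sq_sqrt (by linarith)
  rw [← hr] at hρ hη
  have hrn : r < n / 2 := by
    apply lt_of_pow_lt_pow_left₀ 2 (by linarith); nlinarith
  have hrl : r < l - n / 2 := by
    apply lt_of_pow_lt_pow_left₀ 2 (by linarith); nlinarith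
  refine ⟨hα, hβ0, by linarith, by linarith, ?_, by linarith, by linarith, hln⟩
  rw [mul_comm, hκ, hη]; nlinarith

lemma U_bound {l b C₀ ρ S : ℝ} (hb : 0 < b) (hC₀ : 0 ≤ C₀) (hρ : 0 < ρ) {U : ℝ → Euc N → ℝ}
    (hUest : ∀ t : ℝ, ∀ x : Euc N, 0 < t → t < S → x ≠ 0 →
      |‖x‖ ^ l * U t x - b| ≤ C₀ * ((‖x‖ / (‖x‖ + Real.sqrt t)) ^ ρ + ‖x‖ ^ l)) :
    ∀ t : ℝ, ∀ x : Euc N, 0 < t → t < S → x ≠ 0 → |U t x| ≤ (b + C₀) * wt l x := by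
  intro t x ht htS hx
  have h := hUest t x ht htS hx
  have hr : 0 < ‖x‖ := norm_pos_iff.2 hx
  have hst := Real.sqrt_nonneg t
  have h1 : (‖x‖ / (‖x‖ + Real.sqrt t)) ^ ρ ≤ 1 := by
    refine Real.rpow_le_one (by positivity) ?_ hρ.le
    rw [div_le_one (by positivity)]; linarith
  have hp : 0 < ‖x‖ ^ l := by positivity
  have h2 : ‖x‖ ^ l * |U t x| ≤ b + C₀ * (1 + ‖x‖ ^ l) := by
    have e : ‖x‖ ^ l * |U t x| = |‖x‖ ^ l * U t x| := by rw [abs_mul, abs_of_pos hp]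
    have e2 : |‖x‖ ^ l * U t x| ≤ |‖x‖ ^ l * U t x - b| + b := by
      have := abs_add_le (‖x‖ ^ l * U t x - b) b
      rw [sub_add_cancel, abs_of_pos hb] at this; exact this
    have e3 : C₀ * ((‖x‖ / (‖x‖ + Real.sqrt t)) ^ ρ + ‖x‖ ^ l) ≤ C₀ * (1 + ‖x‖ ^ l) := by gcongr
    linarith
  unfold wt
  rw [Real.rpow_neg hr.le]
  refine le_of_mul_le_mul_left (h2.trans ?_) hp
  have : ‖x‖ ^ l * ((b + C₀) * (1 + (‖x‖ ^ l)⁻¹)) = (b + C₀) * (‖x‖ ^ l + 1) := by field_simp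
  rw [this]
  nlinarith [mul_pos hb hp]

lemma U_slice [NeZero N] {S : ℝ} {U : ℝ → Euc N → ℝ} (hUcont : ContinuousOn (fun p : ℝ × Euc N => U p.1 p.2) (Om N S))
    {l C : ℝ} (hl : l < N) (hb : ∀ t : ℝ, ∀ x : Euc N, 0 < t → t < S → x ≠ 0 → |U t x| ≤ C * wt l x) {t : ℝ} (ht : 0 < t) (htS : t < S) (R : ℝ) :
    IntegrableOn (U t) (Metric.ball 0 R) := by
  have hx : ∀ᵐ x : Euc N, x ≠ 0 := by rw [ae_iff]; simp
  have hc : ContinuousOn (U t) {x : Euc N | x ≠ 0} := by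
    have : ContinuousOn (fun x : Euc N => (t, x)) {x : Euc N | x ≠ 0} := by fun_prop
    exact hUcont.comp this (fun x hx => ⟨⟨ht, htS⟩, hx⟩)
  have hm : AEStronglyMeasurable (U t) volume := by
    have h1 := hc.aestronglyMeasurable (μ := volume) isOpen_ne.measurableSet
    rwa [Measure.restrict_eq_self_of_ae_mem] at h1
    exact hx
  refine ((wt_integrableOn_ball hl R).const_mul C).mono' hm.restrict ?_
  exact ae_restrict_of_ae (hx.mono fun x hx => hb t x ht htS hx)

lemma w0_exists [NeZero N] {S : ℝ} (hS : 0 < S) {U : ℝ → Euc N → ℝ} (hUcont : ContinuousOn (fun p : ℝ × Euc N => U p.1 p.2) (Om N S))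
    {l C : ℝ} (hl0 : 0 < l) (hl : l < N) (hC : 0 ≤ C) (hb : ∀ t : ℝ, ∀ x : Euc N, 0 < t → t < S → x ≠ 0 → |U t x| ≤ C * wt l x)
    (U₀ : Euc N → ℝ) (hU₀ : LocallyIntegrable U₀)
    (hUconv : ∀ R : ℝ, 0 < R →
      Tendsto (fun t => ∫ x in Metric.ball (0 : Euc N) R, |U t x - U₀ x|)
        (nhdsWithin 0 (Set.Ioi 0)) (nhds 0))
    (δ : ℝ) (hδ : 0 < δ)
    (u₀ : Euc N → ℝ) (hu₀loc : LocallyIntegrable u₀)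
    (hu₀bdd : ∃ M : ℝ, ∀ᵐ x ∂(volume : Measure (Euc N)), δ < ‖x‖ → |u₀ x| ≤ M)
    (hu₀eq : ∀ᵐ x ∂(volume : Measure (Euc N)), ‖x‖ < δ → u₀ x = U₀ x) :
    ∃ w₀ : Euc N → ℝ, ∃ M : ℝ, 0 ≤ M ∧ Measurable w₀ ∧ (∀ y, ‖y‖ < δ → w₀ y = 0) ∧ (∀ y, |w₀ y| ≤ M) ∧
      (∀ᵐ x, u₀ x = U₀ x + w₀ x) := by
  obtain ⟨M, hM⟩ := hu₀bdd
  obtain ⟨M1, hM1⟩ : ∃ M1, M1 = C * (1 + δ ^ (-l)) := ⟨_, rfl⟩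
  have hM10 : 0 ≤ M1 := by rw [hM1]; positivity
  have hUδ : ∀ t : ℝ, ∀ x : Euc N, 0 < t → t < S → δ ≤ ‖x‖ → |U t x| ≤ M1 := by
    intro t x ht htS hx
    refine (hb t x ht htS (by intro h; rw [h, norm_zero] at hx; linarith)).trans ?_
    rw [hM1]; unfold wt
    have := Real.rpow_le_rpow_of_nonpos hδ hx (by linarith : -l ≤ 0)
    gcongr
  have hU₀i : ∀ R, IntegrableOn U₀ (Metric.ball 0 R) := fun R =>
    (hU₀.integrableOn_isCompact (isCompact_closedBall 0 R)).mono_set Metric.ball_subset_closedBall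
  have key : ∀ᵐ x : Euc N, δ ≤ ‖x‖ → |U₀ x| ≤ M1 := by
    have kR : ∀ n : ℕ, ∀ᵐ x : Euc N, x ∈ Metric.ball (0 : Euc N) (n + 1) → δ ≤ ‖x‖ → |U₀ x| ≤ M1 := by
      intro n
      obtain ⟨R, hR⟩ : ∃ R : ℝ, R = n + 1 := ⟨_, rfl⟩
      have hR0 : 0 < R := by rw [hR]; positivity
      rw [← hR]
      obtain ⟨f, hf⟩ : ∃ f : Euc N → ℝ, f = ({x : Euc N | δ ≤ ‖x‖}).indicator (fun x => max (|U₀ x| - M1) 0) := ⟨_, rfl⟩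
      have hms : MeasurableSet {x : Euc N | δ ≤ ‖x‖} := measurableSet_le measurable_const measurable_norm
      have hf0 : ∀ x, 0 ≤ f x := by
        intro x; rw [hf]; exact indicator_nonneg (fun x _ => le_max_right _ _) x
      have hfle : ∀ t x, 0 < t → t < S → f x ≤ |U t x - U₀ x| := by
        intro t x ht htS
        rw [hf]
        by_cases hx : x ∈ {x : Euc N | δ ≤ ‖x‖}
        · rw [indicator_of_mem hx]
          refine max_le ?_ (abs_nonneg _)
          have h1 := hUδ t x ht htS hx
          have h2 := abs_sub_abs_le_abs_sub (U₀ x) (U t x)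
          rw [abs_sub_comm] at h2; linarith
        · rw [indicator_of_notMem hx]; positivity
      have hfi : IntegrableOn f (Metric.ball 0 R) := by
        rw [hf]
        refine (Integrable.indicator ?_ hms)
        refine (hU₀i R).abs.mono' ?_ (ae_of_all _ fun x => ?_)
        · exact ((hU₀i R).abs.aestronglyMeasurable.sub aestronglyMeasurable_const).sup aestronglyMeasurable_const
        · rw [Real.norm_eq_abs, abs_of_nonneg (le_max_right _ _)]
          exact max_le (by linarith) (abs_nonneg _)
      have hle : ∫ x in Metric.ball (0 : Euc N) R, f x ≤ 0 := by
        refine ge_of_tendsto (hUconv R hR0) ?_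
        filter_upwards [Ioo_mem_nhdsGT hS] with t ht
        refine setIntegral_mono hfi ((U_slice hUcont hl hb ht.1 ht.2 R).sub (hU₀i R)).abs (fun x => hfle t x ht.1 ht.2)
      have hz : ∫ x in Metric.ball (0 : Euc N) R, f x = 0 := le_antisymm hle (integral_nonneg hf0)
      rw [integral_eq_zero_iff_of_nonneg hf0 hfi] at hz
      have hz' := (ae_restrict_iff' measurableSet_ball).1 hz
      filter_upwards [hz'] with x hx hxb hxδ
      have h1 := hx hxb
      rw [hf, indicator_of_mem (show x ∈ {x : Euc N | δ ≤ ‖x‖} from hxδ)] at h1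
      have h2 : |U₀ x| - M1 ≤ 0 := (le_max_left _ _).trans h1.le
      linarith
    filter_upwards [ae_all_iff.2 kR] with x hx
    obtain ⟨n, hn⟩ := exists_nat_gt ‖x‖
    exact hx n (by rw [mem_ball_zero_iff]; linarith)
  have hm : AEMeasurable (fun x => u₀ x - U₀ x) volume := (hu₀loc.aestronglyMeasurable.sub hU₀.aestronglyMeasurable).aemeasurable
  obtain ⟨v, hv, hve⟩ := hm
  obtain ⟨M2, hM2⟩ : ∃ M2, M2 = |M| + M1 := ⟨_, rfl⟩
  have hM20 : 0 ≤ M2 := by rw [hM2]; positivity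
  have hms : MeasurableSet {x : Euc N | δ ≤ ‖x‖} := measurableSet_le measurable_const measurable_norm
  refine ⟨({x : Euc N | δ ≤ ‖x‖}).indicator (fun x => max (-M2) (min (v x) M2)), M2, hM20, ?_, ?_, ?_, ?_⟩
  · exact (measurable_const.max (hv.min measurable_const)).indicator hms
  · intro y hy; exact indicator_of_notMem (by simpa using hy) _
  · intro y
    by_cases hy : y ∈ {x : Euc N | δ ≤ ‖x‖}
    · rw [indicator_of_mem hy, abs_le]
      exact ⟨le_max_left _ _, max_le (by linarith) (min_le_right _ _)⟩
    · rw [indicator_of_notMem hy, abs_zero]; exact hM20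
  · have hsph : ∀ᵐ x : Euc N, ‖x‖ ≠ δ := by
      rw [ae_iff]
      have : {a : Euc N | ¬ ‖a‖ ≠ δ} = Metric.sphere 0 δ := by ext; simp
      rw [this]; exact Measure.addHaar_sphere_of_ne_zero _ _ hδ.ne'
    filter_upwards [hsph, key, hM, hu₀eq, hve] with x h1 h2 h3 h4 h5
    rcases lt_or_gt_of_ne h1 with h | h
    · rw [indicator_of_notMem (by simpa using h), h4 h, add_zero]
    · rw [indicator_of_mem (show x ∈ {x : Euc N | δ ≤ ‖x‖} from h.le)]
      have h6 : |v x| ≤ M2 := by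
        rw [← h5, hM2]
        refine (abs_sub _ _).trans (add_le_add ((h3 h).trans (le_abs_self _)) (h2 h.le))
      rw [min_eq_left (abs_le.1 h6).2, max_eq_right (abs_le.1 h6).1, ← h5]; ring

end HeatAux

namespace HeatAux

set_option linter.all false
open Set Topology

variable {N : ℕ}

lemma wt_le_two {η l : ℝ} (hη : 0 ≤ η) (h : η ≤ l) {x : Euc N} (hx : x ≠ 0) : wt η x ≤ 2 * wt l x := by
  have hr : 0 < ‖x‖ := norm_pos_iff.2 hx
  unfold wt
  have hp : 0 < ‖x‖ ^ (-l) := by positivity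
  rcases le_total 1 ‖x‖ with h1 | h1
  · have := Real.rpow_le_one_of_one_le_of_nonpos h1 (by linarith : -η ≤ 0)
    linarith
  · have := Real.rpow_le_rpow_of_exponent_ge hr h1 (by linarith : -l ≤ -η)
    linarith

lemma wt_rpow {l p : ℝ} (hp : 0 ≤ p) (x : Euc N) : wt l x ^ p ≤ 2 ^ p * wt (l * p) x := by
  unfold wt
  refine (one_add_rpow (by positivity) hp).trans (le_of_eq ?_)
  rw [← Real.rpow_mul (norm_nonneg x)]
  congr 4; ring

lemma Lp_loc [NeZero N] {T l α C : ℝ} (hα : 0 < α) (hl : l * (α + 1) < N) {u V w : ℝ × Euc N → ℝ} (hV : Measurable V) (hw : Measurable w)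
    (hu : ∀ p ∈ Om N T, u p = V p + w p) (hub : ∀ p ∈ Om N T, |u p| ≤ C * wt l p.2) (hC : 0 ≤ C)
    {a b R : ℝ} (ha : 0 < a) (hbT : b < T) :
    IntegrableOn (fun p => |u p| ^ (α + 1)) (Ioo a b ×ˢ Metric.ball 0 R) := by
  have hms : MeasurableSet (Ioo a b ×ˢ Metric.ball (0 : Euc N) R) := measurableSet_Ioo.prod measurableSet_ball
  have hae : ∀ᵐ p ∂(volume.restrict (Ioo a b ×ˢ Metric.ball (0 : Euc N) R)), p ∈ Ioo a b ×ˢ Metric.ball (0 : Euc N) R ∧ p ∈ Om N T := by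
    filter_upwards [ae_restrict_mem hms, ae_restrict_of_ae (ae_snd_ne (N := N))] with p hp hp2
    exact ⟨hp, ⟨⟨ha.trans hp.1.1, hp.1.2.trans hbT⟩, hp2⟩⟩
  have hi := (strip_wt_integrable (N := N) hl (C ^ (α + 1) * 2 ^ (α + 1)) T R).integrableOn (s := Ioo a b ×ˢ Metric.ball (0 : Euc N) R)
  refine hi.mono' ?_ ?_
  · have hm : Measurable (fun p => |V p + w p| ^ (α + 1)) := by
      have := hV.add hw
      fun_prop
    refine hm.aestronglyMeasurable.congr ?_
    filter_upwards [hae] with p hp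
    rw [hu p hp.2]
  · filter_upwards [hae] with p hp
    rw [indicator_of_mem (show p.1 ∈ Ioo 0 T from hp.2.1), indicator_of_mem hp.1.2, Real.norm_eq_abs, abs_of_nonneg (by positivity)]
    have hw0 := wt_pos l p.2
    calc |u p| ^ (α + 1) ≤ (C * wt l p.2) ^ (α + 1) := by
          have := hub p hp.2
          gcongr
      _ = C ^ (α + 1) * wt l p.2 ^ (α + 1) := Real.mul_rpow hC hw0.le
      _ ≤ C ^ (α + 1) * (2 ^ (α + 1) * wt (l * (α + 1)) p.2) := by
          have := wt_rpow (l := l) (p := α + 1) (by linarith) p.2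
          gcongr
      _ = _ := by ring

lemma weak_form [NeZero N] {T γ Cg M' : ℝ} (hγ0 : 0 ≤ γ) (hγ : γ < N) {w f h : ℝ × Euc N → ℝ} {w₀ : Euc N → ℝ} (hf : Measurable f)
    (hw₀ : Measurable w₀) (hM : ∀ y, |w₀ y| ≤ M') (hfb : ∀ q, |f q| ≤ Cg * wt γ q.2) (hf0 : ∀ q, q.1 ≤ 0 → f q = 0)
    (hfh : ∀ q ∈ Om N T, h q = f q) (hwe : ∀ p ∈ Om N T, w p = He w₀ p + Dh f p)
    {ζ : ℝ × Euc N → ℝ} (hζ : ContDiff ℝ (⊤ : ℕ∞) ζ) (hs : HasCompactSupport ζ)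
    (ht : tsupport ζ ⊆ Ioo 0 T ×ˢ (univ : Set (Euc N))) :
    ∫ p in Ioo 0 T ×ˢ (univ : Set (Euc N)), w p * bh ζ p = ∫ p in Ioo 0 T ×ˢ (univ : Set (Euc N)), h p * ζ p := by
  have hms : MeasurableSet (Ioo 0 T ×ˢ (univ : Set (Euc N))) := measurableSet_Ioo.prod MeasurableSet.univ
  have hae : ∀ᵐ p ∂(volume.restrict (Ioo 0 T ×ˢ (univ : Set (Euc N)))), p ∈ Om N T := by
    filter_upwards [ae_restrict_mem hms, ae_restrict_of_ae (ae_snd_ne (N := N))] with p hp hp2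
    exact ⟨hp.1, hp2⟩
  obtain ⟨i1, e1⟩ := He_test hw₀ hM hζ hs ht
  obtain ⟨i2, e2⟩ := Dh_test hγ0 hγ hf hfb hf0 hζ hs ht
  calc ∫ p in Ioo 0 T ×ˢ (univ : Set (Euc N)), w p * bh ζ p
      = ∫ p in Ioo 0 T ×ˢ (univ : Set (Euc N)), (He w₀ p * bh ζ p + Dh f p * bh ζ p) := by
        refine integral_congr_ae ?_
        filter_upwards [hae] with p hp
        rw [hwe p hp]; ring
    _ = ∫ p, (He w₀ p * bh ζ p + Dh f p * bh ζ p) := by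
        refine setIntegral_eq_integral_of_forall_compl_eq_zero (fun p hp => ?_)
        rw [bh_zero hζ (fun h => hp (ht h))]; ring
    _ = ∫ p, f p * ζ p := by rw [integral_add i1 i2, e1, e2, zero_add]
    _ = ∫ p in Ioo 0 T ×ˢ (univ : Set (Euc N)), f p * ζ p := by
        symm
        refine setIntegral_eq_integral_of_forall_compl_eq_zero (fun p hp => ?_)
        rw [image_eq_zero_of_notMem_tsupport (fun h => hp (ht h))]; ring
    _ = _ := by
        refine integral_congr_ae ?_
        filter_upwards [hae] with p hp
        rw [hfh p hp]

lemma init_conv [NeZero N] {S T γ Cg M' : ℝ} (hT : 0 < T) (hTS : T < S) (hγ0 : 0 ≤ γ) (hγ : γ < N) {w f : ℝ × Euc N → ℝ} {w₀ U₀ u₀ : Euc N → ℝ}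
    {U : ℝ → Euc N → ℝ} (hf : Measurable f)
    (hw₀ : Measurable w₀) (hM : ∀ y, |w₀ y| ≤ M') (hfb : ∀ q, |f q| ≤ Cg * wt γ q.2) (hf0 : ∀ q, q.1 ≤ 0 → f q = 0)
    (hwe : ∀ p ∈ Om N T, w p = He w₀ p + Dh f p) (hu₀ : ∀ᵐ x, u₀ x = U₀ x + w₀ x)
    (hU₀ : LocallyIntegrable U₀) {R : ℝ} (hUi : ∀ t, 0 < t → t < S → IntegrableOn (U t) (Metric.ball 0 R))
    (hUconv : Tendsto (fun t => ∫ x in Metric.ball (0 : Euc N) R, |U t x - U₀ x|) (nhdsWithin 0 (Set.Ioi 0)) (nhds 0)) :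
    Tendsto (fun t => ∫ x in Metric.ball (0 : Euc N) R, |(U t x + w (t, x)) - u₀ x|) (nhdsWithin 0 (Set.Ioi 0)) (nhds 0) := by
  obtain ⟨K, hK, hdb⟩ := dh_bound (N := N) hγ0 hγ
  have hU₀i : IntegrableOn U₀ (Metric.ball 0 R) :=
    (hU₀.integrableOn_isCompact (isCompact_closedBall 0 R)).mono_set Metric.ball_subset_closedBall
  have hx : ∀ᵐ x : Euc N, x ≠ 0 := by rw [ae_iff]; simp
  obtain ⟨I, hI⟩ : ∃ I, I = ∫ x in Metric.ball (0 : Euc N) R, wt γ x := ⟨_, rfl⟩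
  have hlim : Tendsto (fun t : ℝ => (∫ x in Metric.ball (0 : Euc N) R, |U t x - U₀ x|) + (∫ x in Metric.ball (0 : Euc N) R, |He w₀ (t, x) - w₀ x|) + Cg * (t * K) * I) (𝓝[>] 0) (𝓝 0) := by
    have h3 : Tendsto (fun t : ℝ => Cg * (t * K) * I) (𝓝[>] 0) (𝓝 0) := by
      have : Continuous (fun t : ℝ => Cg * (t * K) * I) := by fun_prop
      have h := this.tendsto 0
      simp only [zero_mul, mul_zero] at h
      exact h.mono_left nhdsWithin_le_nhds
    simpa using (hUconv.add (He_tendsto hw₀ hM R)).add h3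
  refine tendsto_of_tendsto_of_tendsto_of_le_of_le' tendsto_const_nhds hlim (Eventually.of_forall fun t => integral_nonneg fun x => abs_nonneg _) ?_
  filter_upwards [Ioo_mem_nhdsGT hT] with t ht
  have i1 : IntegrableOn (fun x => |U t x - U₀ x|) (Metric.ball 0 R) := ((hUi t ht.1 (ht.2.trans hTS)).sub hU₀i).abs
  have hfin : volume (Metric.ball (0 : Euc N) R) ≠ ⊤ := Metric.isBounded_ball.measure_lt_top.ne
  have i2 : IntegrableOn (fun x => |He w₀ (t, x) - w₀ x|) (Metric.ball 0 R) := by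
    have hm : Measurable (fun x => He w₀ (t, x) - w₀ x) := ((He_measurable hw₀).comp (measurable_const.prodMk measurable_id)).sub hw₀
    refine Integrable.mono' (g := fun _ => M' + M') (integrableOn_const hfin) hm.abs.aestronglyMeasurable (ae_of_all _ fun x => ?_)
    rw [Real.norm_eq_abs, abs_abs]
    exact (abs_sub _ _).trans (add_le_add (He_bound hM _) (hM x))
  have i3 : IntegrableOn (fun x => Cg * (t * K) * wt γ x) (Metric.ball (0 : Euc N) R) := (wt_integrableOn_ball hγ R).const_mul _
  have i12 : IntegrableOn (fun x => |U t x - U₀ x| + |He w₀ (t, x) - w₀ x|) (Metric.ball 0 R) := i1.add i2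
  rw [hI, ← integral_const_mul, ← integral_add i1 i2, ← integral_add i12 i3]
  refine integral_mono_of_nonneg (ae_of_all _ fun x => abs_nonneg _) (i12.add i3) ?_
  filter_upwards [ae_restrict_of_ae hx, ae_restrict_of_ae hu₀] with x hx hux
  have hD := (hdb 0 Cg f hf hfb hf0 (t, x) hx ht.1.le).2
  rw [hwe (t, x) ⟨ht, hx⟩, hux]
  have e : U t x + (He w₀ (t, x) + Dh f (t, x)) - (U₀ x + w₀ x) = (U t x - U₀ x) + (He w₀ (t, x) - w₀ x) + Dh f (t, x) := by ring
  rw [e]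
  refine (abs_add_three _ _ _).trans ?_
  have : |Dh f (t, x)| ≤ Cg * (t * K) * wt γ x := by
    refine hD.trans (le_of_eq ?_); simp only [sub_zero]; ring
  linarith

end HeatAux

theorem stmt_0 (N : ℕ) (hN : 3 ≤ N) (α α₀ β ρ η : ℝ)
    (hα₀ : α₀ = 4 / ((N : ℝ) - 4 + 2 * Real.sqrt ((N : ℝ) - 1)))
    (hα1 : 2 / ((N : ℝ) - 2) < α) (hα2 : α < α₀)
    (hβ : β = 2 / α * ((N : ℝ) - 2 - 2 / α))
    (hρ : ρ = 2 / α - ((N : ℝ) - 2) / 2 - Real.sqrt (((N : ℝ) - 2) ^ 2 / 4 - β * (α + 1)))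
    (hη : η = ((N : ℝ) - 2) / 2 - Real.sqrt (((N : ℝ) - 2) ^ 2 / 4 - β * (α + 1)))
    (S : ℝ) (hS : 0 < S)
    (U : ℝ → Euc N → ℝ)
    (hUloc : ∀ a b R : ℝ, 0 < a → a < b → b < S → 0 < R →
      IntegrableOn (fun p : ℝ × Euc N => |U p.1 p.2| ^ (α + 1))
        (Set.Ioo a b ×ˢ Metric.ball 0 R))
    (hUcont : ContinuousOn (fun p : ℝ × Euc N => U p.1 p.2)
      (Set.Ioo 0 S ×ˢ {x : Euc N | x ≠ 0}))
    (C₀ : ℝ)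
    (hUest : ∀ t : ℝ, ∀ x : Euc N, 0 < t → t < S → x ≠ 0 →
      |‖x‖ ^ (2 / α) * U t x - β ^ (1 / α)| ≤
        C₀ * ((‖x‖ / (‖x‖ + Real.sqrt t)) ^ ρ + ‖x‖ ^ (2 / α)))
    (U₀ : Euc N → ℝ) (hU₀ : LocallyIntegrable U₀)
    (hUconv : ∀ R : ℝ, 0 < R →
      Tendsto (fun t => ∫ x in Metric.ball (0 : Euc N) R, |U t x - U₀ x|)
        (nhdsWithin 0 (Set.Ioi 0)) (nhds 0))
    (δ : ℝ) (hδ : 0 < δ)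
    (u₀ : Euc N → ℝ) (hu₀loc : LocallyIntegrable u₀)
    (hu₀bdd : ∃ M : ℝ, ∀ᵐ x ∂(volume : Measure (Euc N)), δ < ‖x‖ → |u₀ x| ≤ M)
    (hu₀eq : ∀ᵐ x ∂(volume : Measure (Euc N)), ‖x‖ < δ → u₀ x = U₀ x) :
    ∃ T : ℝ, 0 < T ∧ T < S ∧ ∃ C : ℝ, ∃ u : ℝ → Euc N → ℝ,
      -- u ∈ L^{α+1}_loc((0,T) × ℝ^N)
      (∀ a b R : ℝ, 0 < a → a < b → b < T → 0 < R →
        IntegrableOn (fun p : ℝ × Euc N => |u p.1 p.2| ^ (α + 1))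
          (Set.Ioo a b ×ˢ Metric.ball 0 R)) ∧
      -- u continuous on (0,T) × (ℝ^N ∖ {0})
      ContinuousOn (fun p : ℝ × Euc N => u p.1 p.2)
        (Set.Ioo 0 T ×ˢ {x : Euc N | x ≠ 0}) ∧
      -- (a) distributional equation ∂ₜu − Δu = |u|^α u − [∂ₜU − ΔU − |U|^α U]
      (∀ ζ : ℝ × Euc N → ℝ, ContDiff ℝ (⊤ : ℕ∞) ζ → HasCompactSupport ζ →
        tsupport ζ ⊆ Set.Ioo 0 T ×ˢ (Set.univ : Set (Euc N)) →
        (∫ p in Set.Ioo 0 T ×ˢ (Set.univ : Set (Euc N)),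
            (u p.1 p.2 - U p.1 p.2) *
              (-(deriv (fun s => ζ (s, p.2)) p.1) - lapl (fun y => ζ (p.1, y)) p.2))
          = ∫ p in Set.Ioo 0 T ×ˢ (Set.univ : Set (Euc N)),
              (|u p.1 p.2| ^ α * u p.1 p.2 - |U p.1 p.2| ^ α * U p.1 p.2) * ζ p) ∧
      -- (b) u(t) → u₀ in L¹_loc as t → 0
      (∀ R : ℝ, 0 < R →
        Tendsto (fun t => ∫ x in Metric.ball (0 : Euc N) R, |u t x - u₀ x|)
          (nhdsWithin 0 (Set.Ioi 0)) (nhds 0)) ∧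
      -- (c) |u − U| ≤ C (1 + |x|^{-η})
      (∀ t : ℝ, ∀ x : Euc N, 0 < t → t < T → x ≠ 0 →
        |u t x - U t x| ≤ C * (1 + ‖x‖ ^ (-η))) := by
  have hN0 : NeZero N := ⟨by omega⟩
  obtain ⟨hα, hβ0, hη0, hηN, hκ, hρ0, hηl, hlN⟩ := HeatAux.params hN hα₀ hα1 hα2 hβ hρ hη
  have hb : 0 < β ^ (1 / α) := Real.rpow_pos_of_pos hβ0 _
  have hbα : (β ^ (1 / α)) ^ α = β := by
    rw [← Real.rpow_mul hβ0.le, one_div, inv_mul_cancel₀ hα.ne', Real.rpow_one]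
  have hUest' : ∀ t : ℝ, ∀ x : Euc N, 0 < t → t < S → x ≠ 0 →
      |‖x‖ ^ (2 / α) * U t x - β ^ (1 / α)| ≤
        |C₀| * ((‖x‖ / (‖x‖ + Real.sqrt t)) ^ ρ + ‖x‖ ^ (2 / α)) := by
    intro t x ht htS hx
    refine (hUest t x ht htS hx).trans ?_
    have h1 := le_abs_self C₀
    have h2 : 0 ≤ (‖x‖ / (‖x‖ + Real.sqrt t)) ^ ρ + ‖x‖ ^ (2 / α) := by positivity
    exact mul_le_mul_of_nonneg_right h1 h2
  have hl0 : 0 < 2 / α := by positivity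
  have hlN' : 2 / α < N := by linarith
  have hUb := HeatAux.U_bound hb (abs_nonneg C₀) hρ0 hUest'
  obtain ⟨CU, hCU⟩ : ∃ CU, CU = β ^ (1 / α) + |C₀| := ⟨_, rfl⟩
  have hCU0 : 0 ≤ CU := by rw [hCU]; positivity
  rw [← hCU] at hUb
  obtain ⟨w₀, M, hM0, hw₀m, hw₀z, hw₀b, hw₀e⟩ := HeatAux.w0_exists hS hUcont hl0 hlN' hCU0 hUb U₀ hU₀ hUconv δ hδ u₀ hu₀loc hu₀bdd hu₀eq
  obtain ⟨T, hT0, hTS, ψ, ψ0, g, B, M', Cg, hψm, hψ0m, hψ0b, hψ0n, hψ0M, hgm, hgb, hg0, hmain⟩ :=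
    HeatAux.super_exists hα hb (abs_nonneg C₀) hη0 hηN (by rw [hbα]; exact hκ) hρ0 hηl hS hδ hM0 hUest'
  have hOmS : HeatAux.Om N T ⊆ HeatAux.Om N S := Set.prod_mono (Set.Ioo_subset_Ioo_right hTS.le) subset_rfl
  have hUc : ContinuousOn (fun p : ℝ × Euc N => U p.1 p.2) (HeatAux.Om N T) := ContinuousOn.mono hUcont hOmS
  obtain ⟨V, hVm, hVe⟩ : ∃ V : ℝ × Euc N → ℝ, Measurable V ∧ ∀ p ∈ HeatAux.Om N T, V p = U p.1 p.2 := by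
    classical
    refine ⟨(HeatAux.Om N T).piecewise (fun p => U p.1 p.2) (fun _ => 0), ?_, fun p hp => Set.piecewise_eq_of_mem _ _ _ hp⟩
    exact hUc.measurable_piecewise continuousOn_const (HeatAux.Om_open T).measurableSet
  have hw₀ψ : ∀ y, |w₀ y| ≤ ψ0 y := by
    intro y
    rcases lt_or_ge ‖y‖ δ with h | h
    · rw [hw₀z y h, abs_zero]; exact hψ0n y
    · exact (hw₀b y).trans (hψ0M y h)
  have hγ0 : 0 ≤ η + 2 := by linarith
  have hγ : η + 2 < N := by linarith
  obtain ⟨w, f, hwm, hfm, hfb, hf0, hfe, hwe, hwψ, hwz⟩ := HeatAux.iter_exists (T := T) hα hγ0 hγ hVm hψm hgm hψ0m hw₀m hψ0b hw₀ψ hgb hg0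
    (fun p hp => (hmain p.1 p.2 hp.1.1 hp.1.2 hp.2).1) (fun p hp => (hmain p.1 p.2 hp.1.1 hp.1.2 hp.2).2.1)
    (fun p hp => by rw [hVe p hp]; exact (hmain p.1 p.2 hp.1.1 hp.1.2 hp.2).2.2.2)
  have hwB : ∀ p ∈ HeatAux.Om N T, |w p| ≤ B * HeatAux.wt η p.2 := fun p hp =>
    (hwψ p hp).trans (hmain p.1 p.2 hp.1.1 hp.1.2 hp.2).2.2.1
  refine ⟨T, hT0, hTS, B, fun t x => U t x + w (t, x), ?_, ?_, ?_, ?_, ?_⟩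
  · intro a b R ha hab hbT hR
    have hl1 : 2 / α * (α + 1) < N := by
      have : 2 / α * (α + 1) = 2 + 2 / α := by field_simp
      linarith
    refine HeatAux.Lp_loc (T := T) (l := 2 / α) (C := CU + 2 * |B|) (u := fun p => U p.1 p.2 + w (p.1, p.2)) hα hl1 hVm hwm ?_ ?_ (by positivity) ha hbT
    · intro p hp; rw [hVe p hp]
    · intro p hp
      refine (abs_add_le _ _).trans ?_
      have h1 := hUb p.1 p.2 hp.1.1 (hp.1.2.trans hTS) hp.2
      have h2 := hwB p hp
      have h3 := HeatAux.wt_le_two hη0.le hηl.le (x := p.2) hp.2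
      have h4 : B * HeatAux.wt η p.2 ≤ |B| * (2 * HeatAux.wt (2 / α) p.2) :=
        mul_le_mul (le_abs_self B) h3 (HeatAux.wt_pos _ _).le (abs_nonneg _)
      linarith
  · refine hUc.add ?_
    have hc : ContinuousOn w (HeatAux.Om N T) := by
      intro p hp
      have h1 : ContinuousAt (fun p => HeatAux.He w₀ p + HeatAux.Dh f p) p :=
        (HeatAux.He_cont hw₀m hw₀b hp.1.1).add (HeatAux.Dh_cont hγ0 hγ hfm hfb hf0 hp.2 hp.1.1)
      refine (h1.continuousWithinAt).congr (fun q hq => hwe q hq) (hwe p hp)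
    exact hc
  · intro ζ hζ hs ht
    have h := HeatAux.weak_form (T := T) (w := w) (h := fun p => HeatAux.pw α (U p.1 p.2 + w p) - HeatAux.pw α (U p.1 p.2)) hγ0 hγ hfm hw₀m hw₀b hfb hf0
      (fun q hq => by rw [hfe q hq, hVe q hq]) hwe hζ hs ht
    unfold HeatAux.bh HeatAux.pw at h
    simp only [add_sub_cancel_left]
    exact h
  · intro R hR
    exact HeatAux.init_conv hT0 hTS hγ0 hγ hfm hw₀m hw₀b hfb hf0 hwe hw₀e hU₀
      (fun t ht htS => HeatAux.U_slice hUcont hlN' hUb ht htS R) (hUconv R hR)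
  · intro t x ht htT hx
    have h := hwB (t, x) ⟨⟨ht, htT⟩, hx⟩
    simp only [add_sub_cancel_left]
    exact h


end
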